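/- Let 2 ≤ k < s be integers with s ≥ 5k² and s not divisible by k. For every γ > 0 there exists n₀ = n₀(k, s, γ) such that for all n ≥ n₀ with n divisible by s: every k-graph H on n vertices with δ_{k−1}(H) ≥ (1/2 + 1/(2s) + γ)n has a perfect C_s^k-tiling. -/

import Mathlib

set_option autoImplicit false

open Finset

section Defs

variable {V : Type} [Fintype V] [DecidableEq V]

/-- `E` is the edge set of a `k`-uniform hypergraph on `V`. -/
def IsKGraph (k : ℕ) (E : Finset (Finset V)) : Prop := ∀ e ∈ E, e.card = k

/-- The degree of a vertex set `S`: the number of edges containing `S`. -/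
def degS (E : Finset (Finset V)) (S : Finset V) : ℕ := (E.filter fun e => S ⊆ e).card

/-- `C` is the (cyclically ordered) vertex list of a copy of a tight cycle:
the vertices are distinct and every `k` cyclically consecutive vertices form an edge. -/
def IsTightCycleList (k : ℕ) (E : Finset (Finset V)) (C : List V) : Prop :=
  C.Nodup ∧ ∀ i < C.length, (((C ++ C).drop i).take k).toFinset ∈ E

/-- `H` has a `C_s^k`-covering: every vertex lies in a copy of the tight cycle on `s` vertices. -/
def HasCsCovering (k s : ℕ) (E : Finset (Finset V)) : Prop :=
  ∀ v : V, ∃ C : List V, C.length = s ∧ IsTightCycleList k E C ∧ v ∈ C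

/-- `H` contains a copy of `C_s^k`. -/
def HasCsCopy (k s : ℕ) (E : Finset (Finset V)) : Prop :=
  ∃ C : List V, C.length = s ∧ IsTightCycleList k E C

/-- `A` is the vertex set of a copy of `C_s^k` in `H`. -/
def SpansCs (k s : ℕ) (E : Finset (Finset V)) (A : Finset V) : Prop :=
  ∃ C : List V, C.length = s ∧ IsTightCycleList k E C ∧ C.toFinset = A

/-- a `C_s^k`-tiling: a set of pairwise disjoint vertex sets of copies of `C_s^k`. -/
def IsCsTiling (k s : ℕ) (E : Finset (Finset V)) (T : Finset (Finset V)) : Prop :=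
  (T : Set (Finset V)).PairwiseDisjoint id ∧ ∀ A ∈ T, SpansCs k s E A

/-- a perfect `C_s^k`-tiling of the induced subgraph on `U`. -/
def HasPerfectCsTilingOn (k s : ℕ) (E : Finset (Finset V)) (U : Finset V) : Prop :=
  ∃ T : Finset (Finset V), IsCsTiling k s E T ∧ T.biUnion id = U

/-- a perfect `C_s^k`-tiling of `H`. -/
def HasPerfectCsTiling (k s : ℕ) (E : Finset (Finset V)) : Prop :=
  HasPerfectCsTilingOn k s E Finset.univ

/-- the pair `(k,s)` is admissible if `gcd k s = 1` or `k / gcd k s` is even. -/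
def AdmissiblePair (k s : ℕ) : Prop := Nat.gcd k s = 1 ∨ Even (k / Nat.gcd k s)

/-- The `k`-graph `H₀^k(A,B)`: edges are the `k`-subsets `e` of `A ∪ B`
with `|e ∩ A| ≢ k (mod 2)`. -/
def H0edges (k : ℕ) (A B : Finset V) : Finset (Finset V) :=
  ((A ∪ B).powersetCard k).filter fun e => ¬ (e ∩ A).card % 2 = k % 2

/-- `P` is (the vertex list of) a tight path: distinct vertices, every `k`
consecutive vertices form an edge. -/
def IsTightPath (k : ℕ) (E : Finset (Finset V)) (P : List V) : Prop :=
  P.Nodup ∧ ∀ i, i + k ≤ P.length → ((P.drop i).take k).toFinset ∈ E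

/-- `P = v₁ ⋯ v_ℓ` has start of type `σ` w.r.t. classes `Vc`: `v_i ∈ V_{σ(i)}`
for `1 ≤ i ≤ k-1` (0-indexed below). -/
def hasStartType (k : ℕ) (Vc : Fin k → Finset V) (P : List V) (σ : Equiv.Perm (Fin k)) : Prop :=
  k ≤ P.length + 1 ∧ ∀ j : Fin k, (j : ℕ) + 1 < k → ∀ v ∈ P[(j : ℕ)]?, v ∈ Vc (σ j)

/-- `P = v₁ ⋯ v_ℓ` has end of type `σ` w.r.t. classes `Vc`: `v_{ℓ-k+i} ∈ V_{σ(i)}`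
for `2 ≤ i ≤ k` (0-indexed below). -/
def hasEndType (k : ℕ) (Vc : Fin k → Finset V) (P : List V) (σ : Equiv.Perm (Fin k)) : Prop :=
  k ≤ P.length + 1 ∧ ∀ j : Fin k, (j : ℕ) ≠ 0 →
    ∀ v ∈ P[(P.length + (j : ℕ) - k)]?, v ∈ Vc (σ j)

/-- `Vc` are the classes of a complete `(k,k)`-graph in `H`: nonempty, pairwise disjoint,
and every transversal is an edge. -/
def IsCompletePartite (k : ℕ) (E : Finset (Finset V)) (Vc : Fin k → Finset V) : Prop :=
  (∀ i, (Vc i).Nonempty) ∧ (∀ i j, i ≠ j → Disjoint (Vc i) (Vc j)) ∧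
  ∀ g : Fin k → V, (∀ i, g i ∈ Vc i) → Finset.image g Finset.univ ∈ E

/-- the cyclic permutation `τ = (1 2 ⋯ k)` (0-indexed: `j ↦ j + 1 mod k`). -/
def cyc (k : ℕ) : Equiv.Perm (Fin k) := finRotate k

/-- `W` is a `G`-gadget for the complete `(k,k)`-graph with classes `Vc` avoiding `S`. -/
def IsGadget (k : ℕ) (E : Finset (Finset V)) (Vc : Fin k → Finset V)
    (G : SimpleGraph (Fin k)) (S : Finset V) (W : Fin k → Fin k → Finset V) : Prop :=
  (∀ i j, G.Adj i j → W i j = W j i) ∧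
  (∀ i j, G.Adj i j →
    (W i j).card = 2 * k - 1 ∧
    (W i j \ Finset.univ.biUnion Vc).card = 1 ∧
    Disjoint (W i j) S ∧
    (∀ i' : Fin k, (W i j ∩ Vc i').card = if i' = i ∨ i' = j then 1 else 2) ∧
    (∀ σ : Equiv.Perm (Fin k), (∃ z : Fin k, (z : ℕ) = 0 ∧ (σ z = i ∨ σ z = j)) →
      ∃ Q : List V, IsTightPath k E Q ∧ Q.toFinset = W i j ∧
        hasStartType k Vc Q (σ * cyc k) ∧ hasEndType k Vc Q (Equiv.swap i j * σ))) ∧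
  (∀ i j i' j', G.Adj i j → G.Adj i' j' → ({i, j} : Finset (Fin k)) ≠ {i', j'} →
    Disjoint (W i j) (W i' j'))

open Classical in
/-- the set of vertices `w_{ij}`, `ij ∈ E(G)`, of a gadget `W`. -/
noncomputable def gadgetVerts (k : ℕ) (Vc : Fin k → Finset V)
    (G : SimpleGraph (Fin k)) (W : Fin k → Fin k → Finset V) : Finset V :=
  (Finset.univ.filter fun p : Fin k × Fin k => G.Adj p.1 p.2).biUnion
    fun p => W p.1 p.2 \ Finset.univ.biUnion Vc

/-- the graph on `[k]` consisting of the paths given by the lists in `L`. -/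
def pathsGraph (k : ℕ) (L : List (List (Fin k))) : SimpleGraph (Fin k) :=
  SimpleGraph.fromEdgeSet {e | ∃ l ∈ L, ∃ p ∈ l.zip l.tail, e = s(p.1, p.2)}

/-- `G` is a vertex-disjoint union of paths. -/
def IsUnionOfPaths (k : ℕ) (G : SimpleGraph (Fin k)) : Prop :=
  ∃ L : List (List (Fin k)), (∀ l ∈ L, l.Nodup) ∧
    L.Pairwise (fun l₁ l₂ => ∀ a ∈ l₁, ∀ b ∈ l₂, a ≠ b) ∧ G = pathsGraph k L

/-- `m(σ)` (1-indexed), read off from the normalized cycle decomposition `L` of `σ`: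
the last element of the last cycle, or `1` if `L` is empty. -/
def mOf (k : ℕ) (L : List (List (Fin k))) : ℕ :=
  ((L.getLast?.bind List.getLast?).map (fun x => (x : ℕ) + 1)).getD 1

/-- `L` is the normalized cycle decomposition of `σ`: disjoint cycles of length ≥ 2,
each cycle listed ending with its minimal element, the cycles ordered by increasing
last elements. -/
def IsNormCycleDecomp (k : ℕ) (σ : Equiv.Perm (Fin k)) (L : List (List (Fin k))) : Prop :=
  (∀ l ∈ L, 2 ≤ l.length ∧ l.Nodup) ∧
  L.Pairwise (fun l₁ l₂ => ∀ a ∈ l₁, ∀ b ∈ l₂, a ≠ b) ∧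
  σ = (L.map List.formPerm).prod ∧
  (∀ l ∈ L, ∀ a ∈ l.getLast?, ∀ b ∈ l, a ≤ b) ∧
  L.Pairwise (fun l₁ l₂ => ∀ a ∈ l₁.getLast?, ∀ b ∈ l₂.getLast?, a < b)

/-- `H` is `(μ, θ)`-dense. -/
def IsDense (k : ℕ) (μ θ : ℝ) (E : Finset (Finset V)) : Prop :=
  ∃ 𝒮 : Finset (Finset V), (∀ S ∈ 𝒮, S.card = k - 1) ∧
    (𝒮.card : ℝ) ≤ θ * ((Fintype.card V).choose (k - 1)) ∧
    ∀ S : Finset V, S.card = k - 1 → S ∉ 𝒮 →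
      μ * ((Fintype.card V : ℝ) - k + 1) ≤ (degS E S : ℝ)

/-- `H` is strongly `(μ, θ)`-dense. -/
def IsStronglyDense (k : ℕ) (μ θ : ℝ) (E : Finset (Finset V)) : Prop :=
  IsDense k μ θ E ∧ ∀ e ∈ E, ∀ X ⊆ e, X.card = k - 1 →
    μ * ((Fintype.card V : ℝ) - k + 1) ≤ (degS E X : ℝ)

/-- the vertex set of `F(K,G)` inside the ambient type: all core vertices, plus one
pendant vertex for each edge of `G`. -/
def FsVertexSet (k : ℕ) (a : Fin k → ℕ) (G : SimpleGraph (Fin k)) :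
    Set ((Σ i : Fin k, Fin (a i)) ⊕ Sym2 (Fin k)) :=
  Set.range Sum.inl ∪ Sum.inr '' G.edgeSet

/-- the edges of `F(K,G)`, where `K = K^k(a)`: all transversals of the classes, plus,
for each edge `ij` of `G`, all `k`-sets consisting of the pendant vertex `w_{ij}` and one
vertex from each class other than `i` (resp. other than `j`). -/
def FKGedges (k : ℕ) (a : Fin k → ℕ) (G : SimpleGraph (Fin k)) :
    Set (Finset ((Σ i : Fin k, Fin (a i)) ⊕ Sym2 (Fin k))) :=
  {e | (∃ g : ∀ i, Fin (a i), e = Finset.univ.image fun i => Sum.inl ⟨i, g i⟩) ∨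
    (∃ i j, G.Adj i j ∧ ∃ g : ∀ i', Fin (a i'),
      e = insert (Sum.inr s(i, j)) ((Finset.univ.erase i).image fun i' => Sum.inl ⟨i', g i'⟩))}

/-- `F(K^k(a), G)` contains a spanning copy of the tight cycle `C_s^k`. -/
def FsHasSpanningCs (k s : ℕ) (a : Fin k → ℕ) (G : SimpleGraph (Fin k)) : Prop :=
  ∃ C : List ((Σ i : Fin k, Fin (a i)) ⊕ Sym2 (Fin k)),
    C.Nodup ∧ C.length = s ∧ (↑C.toFinset : Set _) = FsVertexSet k a G ∧
    ∀ i < C.length, (((C ++ C).drop i).take k).toFinset ∈ FKGedges k a G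

/-- `A` is the vertex set of a copy of `K^k(t)` in `H`. -/
def SpansEsCopy (k t : ℕ) (E : Finset (Finset V)) (A : Finset V) : Prop :=
  ∃ f : Fin k × Fin t → V, Function.Injective f ∧ Finset.univ.image f = A ∧
    ∀ g : Fin k → Fin t, (Finset.univ.image fun i => f (i, g i)) ∈ E

/-- `A` is the vertex set of a copy of `F_s = F(K^k(a), G)` in `H`. -/
def SpansFsCopy (k : ℕ) (a : Fin k → ℕ) (G : SimpleGraph (Fin k))
    (E : Finset (Finset V)) (A : Finset V) : Prop :=
  ∃ f : ((Σ i : Fin k, Fin (a i)) ⊕ Sym2 (Fin k)) → V,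
    Set.InjOn f (FsVertexSet k a G) ∧ f '' FsVertexSet k a G = ↑A ∧
    ∀ e ∈ FKGedges k a G, e.image f ∈ E

/-- `(TF, TE)` is an `{F_s, E_s}`-tiling of `H`, given as the families of vertex sets of
the copies of `F_s` and of `E_s = K^k(max_i a_i)`. -/
def IsFETiling (k : ℕ) (a : Fin k → ℕ) (G : SimpleGraph (Fin k))
    (E : Finset (Finset V)) (TF TE : Finset (Finset V)) : Prop :=
  ((↑(TF ∪ TE) : Set (Finset V)).PairwiseDisjoint id) ∧
  (∀ A ∈ TF, SpansFsCopy k a G E A) ∧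
  (∀ A ∈ TE, SpansEsCopy k (Finset.univ.sup a) E A)

/-- `φ(𝒯) = (n - s(|ℱ_𝒯| + (3/5)|ℰ_𝒯|))/n`. -/
noncomputable def phiTiling (s : ℕ) (TF TE : Finset (Finset V)) : ℝ :=
  ((Fintype.card V : ℝ) - s * ((TF.card : ℝ) + (3 / 5) * (TE.card : ℝ))) / (Fintype.card V : ℝ)

/-- `φ(H)`: the minimum of `φ(𝒯)` over all `{F_s, E_s}`-tilings of `H`. -/
noncomputable def phiMin (k s : ℕ) (a : Fin k → ℕ) (G : SimpleGraph (Fin k))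
    (E : Finset (Finset V)) : ℝ :=
  sInf {x | ∃ TF TE : Finset (Finset V), IsFETiling k a G E TF TE ∧ x = phiTiling s TF TE}

/-- `Φ(n, μ, θ)`: the maximum of `φ(H)` over all `(μ,θ)`-dense `k`-graphs `H` on `n` vertices. -/
noncomputable def PhiMax (k s : ℕ) (a : Fin k → ℕ) (G : SimpleGraph (Fin k))
    (n : ℕ) (μ θ : ℝ) : ℝ :=
  sSup {x | ∃ E : Finset (Finset (Fin n)), IsKGraph k E ∧ IsDense k μ θ E ∧
    x = phiMin k s a G E}

end Defs

/-- The product of the adjacent transpositions `(i i+1)`, `i < j`, `ℓ ∤ i + 1`, later ones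
acting on the left. -/
def adjSwapProd (k ℓ : ℕ) : ℕ → Equiv.Perm (Fin k)
  | 0 => 1
  | j + 1 => if h : j + 1 < k ∧ ¬ ℓ ∣ j + 1 then
      Equiv.swap ⟨j, by omega⟩ ⟨j + 1, h.1⟩ * adjSwapProd k ℓ j else adjSwapProd k ℓ j

theorem adjSwapProd_val {k ℓ : ℕ} (hℓ : 0 < ℓ) (hℓk : ℓ ∣ k) (j : ℕ) (v : Fin k) :
    (adjSwapProd k ℓ j v : ℕ) =
      if j < v then (v : ℕ) else if ℓ ∣ v then min (v + ℓ - 1) j else v - 1 := by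
  induction j with
  | zero =>
    rcases Nat.eq_zero_or_pos (v : ℕ) with h | h
    · simp [adjSwapProd, h]
    · simp [adjSwapProd, h]
  | succ j ih =>
    have hv := v.2
    by_cases h : j + 1 < k ∧ ¬ ℓ ∣ j + 1
    · have h1 : adjSwapProd k ℓ (j + 1) v
          = Equiv.swap ⟨j, by omega⟩ ⟨j + 1, h.1⟩ (adjSwapProd k ℓ j v) := by
        rw [adjSwapProd, dif_pos h]; rfl
      have h2 : ((adjSwapProd k ℓ (j + 1) v : Fin k) : ℕ)
          = if (adjSwapProd k ℓ j v : ℕ) = j then j + 1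
            else if (adjSwapProd k ℓ j v : ℕ) = j + 1 then j
            else (adjSwapProd k ℓ j v : ℕ) := by
        rw [h1, Equiv.swap_apply_def]
        simp only [Fin.ext_iff]
        split_ifs <;> rfl
      rw [h2, ih]
      have key : ℓ ∣ (v : ℕ) → (v : ℕ) + ℓ - 1 ≠ j := by
        intro hd he
        apply h.2
        have : j + 1 = v + ℓ := by omega
        rw [this]; exact (Nat.dvd_add_right hd).2 dvd_rfl
      have key2 : (v : ℕ) = j + 1 → ¬ ℓ ∣ (v : ℕ) := by
        intro e; rw [e]; exact h.2
      by_cases hd : ℓ ∣ (v : ℕ)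
      · have := key hd
        have h3 : (v : ℕ) ≠ j + 1 := fun e => key2 e hd
        simp only [hd, if_true]
        split_ifs <;> omega
      · have h0 : (v : ℕ) ≠ 0 := by intro e; rw [e] at hd; exact hd (dvd_zero _)
        simp only [hd, if_false]
        split_ifs <;> omega
    · have h1 : adjSwapProd k ℓ (j + 1) v = adjSwapProd k ℓ j v := by
        rw [adjSwapProd, dif_neg h]
      rw [h1, ih]
      by_cases hjk : j + 1 < k
      · have hd' : ℓ ∣ j + 1 := by by_contra hh; exact h ⟨hjk, hh⟩
        by_cases hd : ℓ ∣ (v : ℕ)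
        · simp only [hd, if_true]
          have h4 : (v : ℕ) ≤ j → (v : ℕ) + ℓ ≤ j + 1 := by
            intro hle
            obtain ⟨a, ha⟩ := hd
            obtain ⟨b, hb⟩ := hd'
            rw [ha, hb, ← Nat.mul_succ]
            apply Nat.mul_le_mul_left
            by_contra hcon
            have : b ≤ a := by omega
            have := Nat.mul_le_mul_left ℓ this
            omega
          split_ifs <;> omega
        · have h3 : (v : ℕ) ≠ j + 1 := by intro e; rw [e] at hd; exact hd hd'
          simp only [hd, if_false]
          split_ifs <;> omega
      · by_cases hd : ℓ ∣ (v : ℕ)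
        · simp only [hd, if_true]
          have h4 : (v : ℕ) + ℓ ≤ k := by
            obtain ⟨a, ha⟩ := hd
            obtain ⟨b, hb⟩ := hℓk
            rw [ha]; conv_rhs => rw [hb]
            rw [← Nat.mul_succ]
            apply Nat.mul_le_mul_left
            by_contra hcon
            have : b ≤ a := by omega
            have := Nat.mul_le_mul_left ℓ this
            omega
          split_ifs <;> omega
        · simp only [hd, if_false]
          split_ifs <;> omega

theorem adjSwapProd_stable {k ℓ : ℕ} (j : ℕ) (hj : k ≤ j) :
    adjSwapProd k ℓ j = adjSwapProd k ℓ k := by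
  induction j, hj using Nat.le_induction with
  | base => rfl
  | succ j hj ih => rw [adjSwapProd, dif_neg (by omega), ih]

/-- Every rotation of `k` positions is realised, up to relabelling the positions, by
successive transpositions of adjacent labels. -/
theorem exists_perm_sequence (k s : ℕ) (hk : 0 < k) :
    ∃ A : ℕ → Equiv.Perm (Fin k),
      (∀ j, A (j + 1) = A j ∨ ∃ h : j + 1 < k,
        A (j + 1) = Equiv.swap ⟨j, by omega⟩ ⟨j + 1, h⟩ * A j) ∧
      (∀ j, k ≤ j → A j = A k) ∧
      ∀ i i' : Fin k, (s + i) % k = i' → A k i' = A 0 i := by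
  obtain ⟨ℓ, hℓ⟩ : Nat.gcd k s ∣ k := Nat.gcd_dvd_left k s
  set d := Nat.gcd k s with hd
  have hd0 : 0 < d := Nat.gcd_pos_of_pos_left _ hk
  have hℓ0 : 0 < ℓ := by
    rcases Nat.eq_zero_or_pos ℓ with h | h
    · rw [h] at hℓ; omega
    · exact h
  have hℓk : ℓ ∣ k := ⟨d, by rw [hℓ, mul_comm]⟩
  obtain ⟨c, hc⟩ : d ∣ s := Nat.gcd_dvd_right k s
  have hcop : Nat.Coprime ℓ c := by
    have h := Nat.coprime_div_gcd_div_gcd (m := k) (n := s) hd0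
    rw [← hd] at h
    have e1 : k / d = ℓ := by rw [hℓ]; exact Nat.mul_div_cancel_left _ hd0
    have e2 : s / d = c := by rw [hc]; exact Nat.mul_div_cancel_left _ hd0
    rwa [e1, e2] at h
  let P : Fin k → Fin k := fun v => ⟨((v : ℕ) / ℓ + (v : ℕ) % ℓ * s) % k, Nat.mod_lt _ hk⟩
  have hPinj : Function.Injective P := by
    intro v w h
    have h1 : (v : ℕ) / ℓ + (v : ℕ) % ℓ * s ≡ (w : ℕ) / ℓ + (w : ℕ) % ℓ * s [MOD k] := by
      exact Fin.ext_iff.1 h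
    have hlt : ∀ u : Fin k, (u : ℕ) / ℓ < d := fun u => by
      rw [Nat.div_lt_iff_lt_mul hℓ0, ← hℓ]; exact u.2
    have hsd : ∀ x : ℕ, x * s ≡ 0 [MOD d] := fun x =>
      (Nat.modEq_zero_iff_dvd).2 (Dvd.dvd.mul_left ⟨c, hc⟩ x)
    have h2 : (v : ℕ) / ℓ ≡ (w : ℕ) / ℓ [MOD d] := by
      have h3 := h1.of_dvd ⟨ℓ, hℓ⟩
      have h4 := (Nat.ModEq.add_left ((v : ℕ) / ℓ) (hsd ((v : ℕ) % ℓ))).symm.trans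
        (h3.trans (Nat.ModEq.add_left _ (hsd ((w : ℕ) % ℓ))))
      simpa using h4
    have h3 : (v : ℕ) / ℓ = (w : ℕ) / ℓ := Nat.ModEq.eq_of_lt_of_lt h2 (hlt v) (hlt w)
    rw [h3] at h1
    have h4 := Nat.ModEq.add_left_cancel' _ h1
    have h5 : (v : ℕ) % ℓ * c ≡ (w : ℕ) % ℓ * c [MOD ℓ] := by
      have : d * ((v : ℕ) % ℓ * c) ≡ d * ((w : ℕ) % ℓ * c) [MOD d * ℓ] := by
        rw [← hℓ]; convert h4 using 1 <;> rw [hc] <;> ring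
      exact Nat.ModEq.mul_left_cancel' hd0.ne' this
    have h6 : (v : ℕ) % ℓ ≡ (w : ℕ) % ℓ [MOD ℓ] :=
      Nat.ModEq.cancel_right_of_coprime hcop h5
    have h7 : (v : ℕ) % ℓ = (w : ℕ) % ℓ :=
      Nat.ModEq.eq_of_lt_of_lt h6 (Nat.mod_lt _ hℓ0) (Nat.mod_lt _ hℓ0)
    apply Fin.ext
    rw [← Nat.div_add_mod (v : ℕ) ℓ, ← Nat.div_add_mod (w : ℕ) ℓ, h3, h7]
  let Q : Equiv.Perm (Fin k) := Equiv.ofBijective P (Finite.injective_iff_bijective.1 hPinj)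
  have hQ : ∀ v, Q v = P v := fun v => rfl
  refine ⟨fun j => adjSwapProd k ℓ j * Q⁻¹, ?_, ?_, ?_⟩
  · intro j
    dsimp only
    by_cases h : j + 1 < k ∧ ¬ ℓ ∣ j + 1
    · right
      refine ⟨h.1, ?_⟩
      rw [adjSwapProd, dif_pos h, mul_assoc]
    · left
      rw [adjSwapProd, dif_neg h]
  · intro j hj
    dsimp only
    rw [adjSwapProd_stable j hj]
  · intro i i' hii
    obtain ⟨v, rfl⟩ := Q.surjective i'
    obtain ⟨w, rfl⟩ := Q.surjective i
    have hQQ : ∀ x, Q⁻¹ (Q x) = x := fun x => Q.symm_apply_apply x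
    simp only [Equiv.Perm.mul_apply, hQQ, adjSwapProd, Equiv.Perm.one_apply]
    apply hPinj
    apply Fin.ext
    have hval := adjSwapProd_val hℓ0 hℓk k v
    set u := adjSwapProd k ℓ k v with hu
    rw [if_neg (by have := v.2; omega)] at hval
    have hPw : ((P w : Fin k) : ℕ) < k := (P w).2
    have hcong : ((P u : Fin k) : ℕ) + s ≡ ((P v : Fin k) : ℕ) [MOD k] := by
      have e1 : ((P u : Fin k) : ℕ) ≡ (u : ℕ) / ℓ + (u : ℕ) % ℓ * s [MOD k] := Nat.mod_modEq _ _
      have e2 : ((P v : Fin k) : ℕ) ≡ (v : ℕ) / ℓ + (v : ℕ) % ℓ * s [MOD k] := Nat.mod_modEq _ _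
      refine (e1.add_right s).trans (Nat.ModEq.trans ?_ e2.symm)
      set a := (v : ℕ) / ℓ with ha
      set b := (v : ℕ) % ℓ with hb
      have hbl : b < ℓ := Nat.mod_lt _ hℓ0
      have hvab : (v : ℕ) = ℓ * a + b := (Nat.div_add_mod _ _).symm
      by_cases hb0 : b = 0
      · have hdv : ℓ ∣ (v : ℕ) := Nat.dvd_of_mod_eq_zero hb0
        rw [if_pos hdv] at hval
        have hle : (v : ℕ) + ℓ ≤ k := by
          have ha' : a < d := by rw [ha, Nat.div_lt_iff_lt_mul hℓ0, ← hℓ]; exact v.2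
          rw [hvab, hb0, hℓ, mul_comm d ℓ, add_zero, ← Nat.mul_succ]
          exact Nat.mul_le_mul_left _ ha'
        have hu1 : (u : ℕ) = ℓ * a + (ℓ - 1) := by omega
        have hu2 : (u : ℕ) / ℓ = a := by
          rw [hu1, Nat.mul_add_div hℓ0, Nat.div_eq_of_lt (by omega), add_zero]
        have hu3 : (u : ℕ) % ℓ = ℓ - 1 := by
          rw [hu1, Nat.mul_add_mod, Nat.mod_eq_of_lt (by omega)]
        rw [hu2, hu3, hb0]
        have : a + (ℓ - 1) * s + s = a + k * c := by
          obtain ⟨m, rfl⟩ : ∃ m, ℓ = m + 1 := ⟨ℓ - 1, by omega⟩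
          rw [hℓ, hc]; simp only [Nat.add_sub_cancel]; ring
        rw [this, zero_mul, add_zero]
        exact (Nat.modEq_iff_dvd' (by omega)).2 (by simp) |>.symm
      · have hdv : ¬ ℓ ∣ (v : ℕ) := fun h => hb0 (Nat.mod_eq_zero_of_dvd h)
        rw [if_neg hdv] at hval
        have hu1 : (u : ℕ) = ℓ * a + (b - 1) := by omega
        have hu2 : (u : ℕ) / ℓ = a := by
          rw [hu1, Nat.mul_add_div hℓ0, Nat.div_eq_of_lt (by omega), add_zero]
        have hu3 : (u : ℕ) % ℓ = b - 1 := by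
          rw [hu1, Nat.mul_add_mod, Nat.mod_eq_of_lt (by omega)]
        rw [hu2, hu3]
        obtain ⟨m, hm⟩ : ∃ m, b = m + 1 := ⟨b - 1, by omega⟩
        rw [hm, Nat.add_sub_cancel]
        have : a + m * s + s = a + (m + 1) * s := by ring
        rw [this]
    have h3 : s + ((P w : Fin k) : ℕ) ≡ ((P v : Fin k) : ℕ) [MOD k] := by
      have : (s + ((P w : Fin k) : ℕ)) % k = ((P v : Fin k) : ℕ) := hii
      rw [Nat.ModEq, this, Nat.mod_eq_of_lt (P v).2]
    have h4 : s + ((P u : Fin k) : ℕ) ≡ s + ((P w : Fin k) : ℕ) [MOD k] := by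
      rw [add_comm s]; exact hcong.trans h3.symm
    exact Nat.ModEq.eq_of_lt_of_lt (Nat.ModEq.add_left_cancel' _ h4) (P u).2 (P w).2

/-- The label sets playing the role of edges: the `k` core labels, or the `k` core labels with
label `j` or `j + 1` replaced by the pendant label `j`. -/
def labelEdges (k : ℕ) : Set (Finset (Fin k ⊕ Fin k)) :=
  {L | L = univ.image Sum.inl ∨ ∃ i j : Fin k, (j : ℕ) + 1 < k ∧ (i = j ∨ (i : ℕ) = j + 1) ∧
    L = insert (Sum.inr j) ((univ.erase i).image Sum.inl)}

theorem card_of_mem_labelEdges {k : ℕ} {L : Finset (Fin k ⊕ Fin k)} (hL : L ∈ labelEdges k) :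
    L.card = k := by
  rcases hL with rfl | ⟨i, j, -, -, rfl⟩
  · rw [card_image_of_injective _ Sum.inl_injective]; simp
  · rw [card_insert_of_notMem (by simp), card_image_of_injective _ Sum.inl_injective,
      card_erase_of_mem (mem_univ _)]
    simp only [card_univ, Fintype.card_fin]
    have := i.2
    omega

theorem image_inl_perm {k : ℕ} (ρ : Equiv.Perm (Fin k)) :
    univ.image (fun i => (Sum.inl (ρ i) : Fin k ⊕ Fin k)) = univ.image Sum.inl := by
  ext x
  simp only [mem_image, mem_univ, true_and]
  constructor
  · rintro ⟨a, rfl⟩; exact ⟨_, rfl⟩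
  · rintro ⟨a, rfl⟩; exact ⟨ρ.symm a, by simp⟩

theorem image_update_perm {k : ℕ} (ρ : Equiv.Perm (Fin k)) (a j : Fin k) :
    univ.image (fun i => if i = a then (Sum.inr j : Fin k ⊕ Fin k) else Sum.inl (ρ i))
      = insert (Sum.inr j) ((univ.erase (ρ a)).image Sum.inl) := by
  ext x
  simp only [mem_image, mem_univ, true_and, mem_insert, mem_erase, and_true]
  constructor
  · rintro ⟨b, rfl⟩
    by_cases h : b = a
    · simp [h]
    · right
      rw [if_neg h]
      exact ⟨ρ b, fun e => h (ρ.injective e), rfl⟩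
  · rintro (rfl | ⟨b, hb, rfl⟩)
    · exact ⟨a, by simp⟩
    · refine ⟨ρ.symm b, ?_⟩
      rw [if_neg (by rintro rfl; simp at hb)]
      simp

/-- The windows of a sequence made of consecutive rounds of length `k`. -/
theorem image_window {α : Type*} [DecidableEq α] {k : ℕ} (hk : 0 < k) (R : ℕ → Fin k → α) (t : ℕ) :
    (Ico t (t + k)).image (fun m => R (m / k) ⟨m % k, Nat.mod_lt _ hk⟩)
      = univ.image (fun i : Fin k => if (i : ℕ) < t % k then R (t / k + 1) i else R (t / k) i) := by
  have ht := Nat.div_add_mod t k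
  have htk := Nat.mod_lt t hk
  set q := t / k
  set p := t % k
  ext x
  simp only [mem_image, mem_Ico, mem_univ, true_and]
  constructor
  · rintro ⟨m, ⟨h1, h2⟩, rfl⟩
    refine ⟨⟨m % k, Nat.mod_lt _ hk⟩, ?_⟩
    have hm := Nat.div_add_mod m k
    have hmk := Nat.mod_lt m hk
    have hq1 : q ≤ m / k := Nat.div_le_div_right h1
    have hq2 : m / k ≤ q + 1 := by
      have : (t + k) / k = q + 1 := Nat.add_div_right _ hk
      rw [← this]; exact Nat.div_le_div_right h2.le
    dsimp only
    rcases Nat.lt_or_ge q (m / k) with h | h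
    · have e : m / k = q + 1 := by omega
      rw [e] at hm
      rw [if_pos (by rw [Nat.mul_succ] at hm; omega), e]
    · have e : m / k = q := by omega
      rw [e] at hm
      rw [if_neg (by omega), e]
  · rintro ⟨i, rfl⟩
    have hi := i.2
    split_ifs with h
    · refine ⟨k * (q + 1) + i, ⟨?_, ?_⟩, ?_⟩
      · rw [Nat.mul_succ]; omega
      · rw [Nat.mul_succ]; omega
      · have e1 : (k * (q + 1) + i) / k = q + 1 := by
          rw [Nat.mul_add_div hk, Nat.div_eq_of_lt hi, add_zero]
        have e2 : (k * (q + 1) + i) % k = i := by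
          rw [Nat.mul_add_mod, Nat.mod_eq_of_lt hi]
        simp only [e1, e2]
    · refine ⟨k * q + i, ⟨?_, ?_⟩, ?_⟩
      · omega
      · omega
      · have e1 : (k * q + i) / k = q := by
          rw [Nat.mul_add_div hk, Nat.div_eq_of_lt hi, add_zero]
        have e2 : (k * q + i) % k = i := by
          rw [Nat.mul_add_mod, Nat.mod_eq_of_lt hi]
        simp only [e1, e2]

/-- A round exchanging two core labels through a pendant label. -/
theorem exists_transition {k : ℕ} (σ σ' : Equiv.Perm (Fin k)) (j : Fin k)
    (h : σ' = σ ∨ ∃ h : (j : ℕ) + 1 < k, σ' = Equiv.swap j ⟨j + 1, h⟩ * σ) :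
    ∃ B : Fin k → Fin k ⊕ Fin k,
      (∀ p : ℕ, univ.image (fun i : Fin k => if (i : ℕ) < p then B i else Sum.inl (σ i))
        ∈ labelEdges k) ∧
      (∀ p : ℕ, univ.image (fun i : Fin k => if (i : ℕ) < p then Sum.inl (σ' i) else B i)
        ∈ labelEdges k) ∧
      (∀ i i' j', B i = Sum.inr j' → B i' = Sum.inr j' → i = i') ∧
      (∀ i j', B i = Sum.inr j' → j' = j) ∧
      (σ' = σ → ∀ i, B i = Sum.inl (σ i)) := by
  by_cases h0 : σ' = σ
  · refine ⟨fun i => Sum.inl (σ i), fun p => ?_, fun p => ?_, by simp, by simp, fun _ i => rfl⟩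
    · simp only [ite_self]
      left; exact image_inl_perm σ
    · simp only [h0, ite_self]
      left; exact image_inl_perm σ
  obtain ⟨hj, hσ⟩ := h.resolve_left h0
  have main : ∀ a b : Fin k, a < b → ∀ u v : Fin k, (u = j ∨ (u : ℕ) = j + 1) →
      (v = j ∨ (v : ℕ) = j + 1) → u ≠ v → σ a = u → σ b = v → σ' = Equiv.swap u v * σ →
      ∃ B : Fin k → Fin k ⊕ Fin k,
      (∀ p : ℕ, univ.image (fun i : Fin k => if (i : ℕ) < p then B i else Sum.inl (σ i))
        ∈ labelEdges k) ∧
      (∀ p : ℕ, univ.image (fun i : Fin k => if (i : ℕ) < p then Sum.inl (σ' i) else B i)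
        ∈ labelEdges k) ∧
      (∀ i i' j', B i = Sum.inr j' → B i' = Sum.inr j' → i = i') ∧
      (∀ i j', B i = Sum.inr j' → j' = j) := by
    intro a b hab u v hu hv huv ha hb hσ'
    have e1 : σ' a = v := by rw [hσ']; simp [ha]
    have e2 : ∀ i, i ≠ a → i ≠ b → σ' i = σ i := by
      intro i h1 h2
      rw [hσ', Equiv.Perm.mul_apply, Equiv.swap_apply_of_ne_of_ne]
      · rw [← ha]; exact fun e => h1 (σ.injective e)
      · rw [← hb]; exact fun e => h2 (σ.injective e)
    refine ⟨fun i => if i = a then Sum.inr j else Sum.inl (σ' i), fun p => ?_, fun p => ?_, ?_, ?_⟩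
    · by_cases hp1 : p ≤ a
      · left
        rw [← image_inl_perm σ]
        congr 1
        funext i
        dsimp only
        by_cases hip : (i : ℕ) < p
        · have hia : i < a := by rw [Fin.lt_def]; omega
          rw [if_pos hip, if_neg hia.ne, e2 i hia.ne (hia.trans hab).ne]
        · rw [if_neg hip]
      · by_cases hp2 : p ≤ b
        · right
          refine ⟨σ a, j, hj, ha ▸ hu, ?_⟩
          rw [← image_update_perm]
          congr 1
          funext i
          dsimp only
          by_cases hip : (i : ℕ) < p
          · have hib : i < b := by rw [Fin.lt_def]; omega
            rw [if_pos hip]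
            by_cases hia : i = a
            · rw [if_pos hia, if_pos hia]
            · rw [if_neg hia, if_neg hia, e2 i hia hib.ne]
          · rw [if_neg hip, if_neg]
            rintro rfl; omega
        · right
          refine ⟨σ' a, j, hj, e1 ▸ hv, ?_⟩
          rw [← image_update_perm]
          congr 1
          funext i
          dsimp only
          by_cases hip : (i : ℕ) < p
          · rw [if_pos hip]
          · have hib : b < i := by rw [Fin.lt_def]; omega
            rw [if_neg hip, if_neg (hab.trans hib).ne', e2 i (hab.trans hib).ne' hib.ne']
    · by_cases hp1 : p ≤ a
      · right
        refine ⟨σ' a, j, hj, e1 ▸ hv, ?_⟩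
        rw [← image_update_perm]
        congr 1
        funext i
        dsimp only
        by_cases hip : (i : ℕ) < p
        · have hia : i < a := by rw [Fin.lt_def]; omega
          rw [if_pos hip, if_neg hia.ne]
        · rw [if_neg hip]
      · left
        rw [← image_inl_perm σ']
        congr 1
        funext i
        dsimp only
        by_cases hip : (i : ℕ) < p
        · rw [if_pos hip]
        · rw [if_neg hip, if_neg]
          rintro rfl; omega
    · intro i i' j' h1 h2
      dsimp only at h1 h2
      split_ifs at h1 h2 with h3 h4
      rw [h3, h4]
    · intro i j' h1
      dsimp only at h1
      split_ifs at h1 with h3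
      exact (Sum.inr_injective h1).symm
  have hjj : j ≠ ⟨j + 1, hj⟩ := by simp [Fin.ext_iff]
  rcases lt_trichotomy (σ.symm j) (σ.symm ⟨j + 1, hj⟩) with hlt | heq | hlt
  · obtain ⟨B, h1, h2, h3, h4⟩ := main _ _ hlt j ⟨j + 1, hj⟩ (Or.inl rfl) (Or.inr rfl) hjj
      (by simp) (by simp) hσ
    exact ⟨B, h1, h2, h3, h4, fun e => absurd e h0⟩
  · exact absurd (σ.symm.injective heq) hjj
  · obtain ⟨B, h1, h2, h3, h4⟩ := main _ _ hlt ⟨j + 1, hj⟩ j (Or.inr rfl) (Or.inl rfl) hjj.symm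
      (by simp) (by simp) (by rw [Equiv.swap_comm]; exact hσ)
    exact ⟨B, h1, h2, h3, h4, fun e => absurd e h0⟩

/-- A closed walk of length `s` on the labels whose windows are label edges. -/
theorem exists_label_walk (k s : ℕ) (hk : 2 ≤ k) (hs : 5 * k ^ 2 ≤ s) :
    ∃ g : ℕ → Fin k ⊕ Fin k, Function.Periodic g s ∧
      (∀ t, (Ico t (t + k)).image g ∈ labelEdges k) ∧
      (∀ t t', t < s → t' < s → ∀ j, g t = Sum.inr j → g t' = Sum.inr j → t = t') ∧
      ∀ i, ∃ t₀ < s, g t₀ = Sum.inl i ∧ k ≤ t₀ ∧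
        ∀ t, t₀ < t + k → t < t₀ + k → ∃ a, g t = Sum.inl a := by
  have hk0 : 0 < k := by omega
  obtain ⟨A, hA1, hA2, hA3⟩ := exists_perm_sequence k s hk0
  have hB : ∀ j : ℕ, ∃ B : Fin k → Fin k ⊕ Fin k,
      (∀ p : ℕ, univ.image (fun i : Fin k => if (i : ℕ) < p then B i else Sum.inl (A j i))
        ∈ labelEdges k) ∧
      (∀ p : ℕ, univ.image (fun i : Fin k => if (i : ℕ) < p then Sum.inl (A (j + 1) i) else B i)
        ∈ labelEdges k) ∧
      (∀ i i' j', B i = Sum.inr j' → B i' = Sum.inr j' → i = i') ∧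
      (∀ i j', B i = Sum.inr j' → (j' : ℕ) = j) ∧
      (k ≤ j → ∀ i, B i = Sum.inl (A j i)) := by
    intro j
    by_cases hj : j < k
    · obtain ⟨B, h1, h2, h3, h4, h5⟩ := exists_transition (A j) (A (j + 1)) ⟨j, hj⟩ (hA1 j)
      exact ⟨B, h1, h2, h3, fun i j' e => by rw [h4 i j' e], fun h => by omega⟩
    · have hj' : k ≤ j := by omega
      have e : A (j + 1) = A j := by rw [hA2 j hj', hA2 (j + 1) (by omega)]
      obtain ⟨B, h1, h2, h3, h4, h5⟩ := exists_transition (A j) (A (j + 1)) ⟨0, hk0⟩ (Or.inl e)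
      refine ⟨B, h1, h2, h3, fun i j' e' => ?_, fun _ => h5 e⟩
      rw [h5 e i] at e'; cases e'
  choose B hB1 hB2 hB3 hB4 hB5 using hB
  let R : ℕ → Fin k → Fin k ⊕ Fin k := fun q i =>
    if q % 2 = 0 then Sum.inl (A (q / 2) i) else B (q / 2) i
  let g₀ : ℕ → Fin k ⊕ Fin k := fun m => R (m / k) ⟨m % k, Nat.mod_lt _ hk0⟩
  have hks : (2 * k + 3) * k ≤ s := by nlinarith
  have hpureA : ∀ q, 2 * k ≤ q → ∀ i, R q i = Sum.inl (A k i) := by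
    intro q hq i
    by_cases h : q % 2 = 0
    · simp only [R, if_pos h, hA2 (q / 2) (by omega)]
    · simp only [R, if_neg h, hB5 (q / 2) (by omega), hA2 (q / 2) (by omega)]
  have hlarge : ∀ m, 2 * k * k ≤ m → ∃ a, g₀ m = Sum.inl a := fun m hm =>
    ⟨_, hpureA _ ((Nat.le_div_iff_mul_le hk0).2 hm) _⟩
  have hwin : ∀ t, (Ico t (t + k)).image g₀ ∈ labelEdges k := by
    intro t
    rw [image_window hk0 R t]
    rcases Nat.even_or_odd (t / k) with ⟨j, hj⟩ | ⟨j, hj⟩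
    · have e1 : ∀ i, R (t / k) i = Sum.inl (A j i) := fun i => by
        simp only [R, if_pos (show t / k % 2 = 0 by omega), show t / k / 2 = j by omega]
      have e2 : ∀ i, R (t / k + 1) i = B j i := fun i => by
        simp only [R, if_neg (show ¬ (t / k + 1) % 2 = 0 by omega),
          show (t / k + 1) / 2 = j by omega]
      simp only [e1, e2]
      exact hB1 j _
    · have e1 : ∀ i, R (t / k) i = B j i := fun i => by
        simp only [R, if_neg (show ¬ t / k % 2 = 0 by omega), show t / k / 2 = j by omega]
      have e2 : ∀ i, R (t / k + 1) i = Sum.inl (A (j + 1) i) := fun i => by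
        simp only [R, if_pos (show (t / k + 1) % 2 = 0 by omega),
          show (t / k + 1) / 2 = j + 1 by omega]
      simp only [e1, e2]
      exact hB2 j _
  have hclose : ∀ i < k, g₀ (s + i) = g₀ i := by
    intro i hi
    have h1 : g₀ (s + i) = Sum.inl (A k ⟨(s + i) % k, Nat.mod_lt _ hk0⟩) :=
      hpureA _ ((Nat.le_div_iff_mul_le hk0).2 (by nlinarith)) _
    have h2 : g₀ i = Sum.inl (A 0 ⟨i, hi⟩) := by
      simp only [g₀, R, Nat.div_eq_of_lt hi, Nat.mod_eq_of_lt hi, if_true, Nat.zero_mod,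
        Nat.zero_div]
    rw [h1, h2, hA3 ⟨i, hi⟩ _ rfl]
  have hper : ∀ m < s + k, g₀ (m % s) = g₀ m := by
    intro m hm
    have hks' : k ≤ s := by nlinarith
    rcases Nat.lt_or_ge m s with h | h
    · rw [Nat.mod_eq_of_lt h]
    · obtain ⟨i, rfl⟩ := Nat.exists_eq_add_of_le h
      rw [Nat.add_mod_left, Nat.mod_eq_of_lt (by omega), hclose i (by omega)]
  have hs0 : 0 < s := by nlinarith
  refine ⟨fun t => g₀ (t % s), fun t => by simp only [Nat.add_mod_right], fun t => ?_, ?_, ?_⟩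
  · have : (Ico t (t + k)).image (fun t => g₀ (t % s))
        = (Ico (t % s) (t % s + k)).image g₀ := by
      ext x
      simp only [mem_image, mem_Ico]
      have ht := Nat.div_add_mod t s
      have hts := Nat.mod_lt t hs0
      constructor
      · rintro ⟨m, ⟨h1, h2⟩, rfl⟩
        refine ⟨m - s * (t / s), by omega, ?_⟩
        rw [← hper _ (by omega)]
        congr 1
        conv_rhs => rw [show m = m - s * (t / s) + s * (t / s) by omega, Nat.add_mul_mod_self_left]
      · rintro ⟨m, ⟨h1, h2⟩, rfl⟩
        refine ⟨m + s * (t / s), by omega, ?_⟩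
        rw [Nat.add_mul_mod_self_left, hper _ (by omega)]
    rw [this]
    exact hwin _
  · intro t t' ht ht' j h1 h2
    simp only [Nat.mod_eq_of_lt ht] at h1
    simp only [Nat.mod_eq_of_lt ht'] at h2
    have key : ∀ t, g₀ t = Sum.inr j →
        t / k = 2 * j + 1 ∧ B j ⟨t % k, Nat.mod_lt _ hk0⟩ = Sum.inr j := by
      intro t h
      by_cases hq : t / k % 2 = 0
      · simp only [g₀, R, if_pos hq] at h; cases h
      · simp only [g₀, R, if_neg hq] at h
        have := hB4 _ _ _ h
        rw [← this] at h
        exact ⟨by omega, h⟩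
    obtain ⟨a1, a2⟩ := key t h1
    obtain ⟨b1, b2⟩ := key t' h2
    have := Fin.ext_iff.1 (hB3 _ _ _ _ a2 b2)
    dsimp only at this
    rw [← Nat.div_add_mod t k, ← Nat.div_add_mod t' k, a1, b1, this]
  · intro i
    set p : Fin k := (A k)⁻¹ i with hp
    have hpk := p.2
    have hlt : (2 * k + 1) * k + p < s := by nlinarith
    refine ⟨(2 * k + 1) * k + p, hlt, ?_, by nlinarith, fun t h1 h2 => ?_⟩
    · simp only [Nat.mod_eq_of_lt hlt]
      have e1 : ((2 * k + 1) * k + p) % k = p := by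
        rw [Nat.mul_add_mod', Nat.mod_eq_of_lt hpk]
      have : g₀ ((2 * k + 1) * k + p) = Sum.inl (A k p) := by
        simp only [g₀]
        rw [hpureA _ ((Nat.le_div_iff_mul_le hk0).2 (by nlinarith))]
        congr 2
        exact Fin.ext e1
      rw [this, hp]
      simp
    · dsimp only
      rw [Nat.mod_eq_of_lt (show t < s by nlinarith)]
      exact hlarge t (by nlinarith)

section Embedding

variable {V : Type} [DecidableEq V]

theorem spansCs_image_range {k s : ℕ} {E : Finset (Finset V)} (hks : k ≤ s) {y : ℕ → V}
    (hy : Function.Periodic y s) (hinj : ∀ t < s, ∀ t' < s, y t = y t' → t = t')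
    (hE : ∀ t < s, (Ico t (t + k)).image y ∈ E) : SpansCs k s E ((range s).image y) := by
  have hCC : (List.range s).map y ++ (List.range s).map y = (List.range (s + s)).map y := by
    rw [List.range_add, List.map_append, List.map_map]
    congr 1
    apply List.map_congr_left
    intro a _
    simp only [Function.comp]
    rw [add_comm, hy]
  refine ⟨(List.range s).map y, by simp, ⟨?_, fun i hi => ?_⟩, ?_⟩
  · refine List.Nodup.map_on (fun a ha b hb h => ?_) List.nodup_range
    exact hinj a (List.mem_range.1 ha) b (List.mem_range.1 hb) h
  · simp only [List.length_map, List.length_range] at hi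
    rw [hCC, ← List.map_drop, ← List.map_take]
    convert hE i hi using 1
    ext x
    simp only [List.mem_toFinset, List.mem_map, mem_image, mem_Ico, List.range_eq_range']
    refine exists_congr fun m => and_congr_left fun _ => ?_
    rw [List.drop_range', List.take_range'_of_length_ge (by omega), List.mem_range'_1]
    omega
  · ext x
    simp

variable {k s : ℕ} {E : Finset (Finset V)}

/-- `f` sends every label edge to an edge of the hypergraph. -/
def IsLabelled (E : Finset (Finset V)) (f : Fin k ⊕ Fin k → V) : Prop :=
  ∀ L ∈ labelEdges k, L.image f ∈ E

theorem exists_section_of_window {g : ℕ → Fin k ⊕ Fin k} [NeZero s]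
    {t : ℕ} (hwin : (Ico t (t + k)).image g ∈ labelEdges k) :
    ∃ τ : Fin k ⊕ Fin k → Fin s, ∀ m ∈ Ico t (t + k), τ (g m) = Fin.ofNat s m := by
  classical
  have hinj : Set.InjOn g (Ico t (t + k)) := by
    apply card_image_iff.1
    rw [card_of_mem_labelEdges hwin]; simp
  refine ⟨fun l => if h : ∃ m ∈ Ico t (t + k), g m = l then Fin.ofNat s h.choose else 0,
    fun m hm => ?_⟩
  have h : ∃ m' ∈ Ico t (t + k), g m' = g m := ⟨m, hm, rfl⟩
  dsimp only
  rw [dif_pos h, hinj h.choose_spec.1 hm h.choose_spec.2]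

theorem exists_tile_of_walk (hk : 0 < k) (hks : k ≤ s) {g : ℕ → Fin k ⊕ Fin k}
    (hper : Function.Periodic g s)
    (hwin : ∀ t, (Ico t (t + k)).image g ∈ labelEdges k) (F : Fin k ⊕ Fin k → Fin s → V)
    (hinj : ∀ l l' a a', F l a = F l' a' → l = l' ∧ a = a')
    (hF : ∀ τ : Fin k ⊕ Fin k → Fin s, IsLabelled E fun l => F l (τ l)) :
    ∃ A, SpansCs k s E A ∧ (∀ v ∈ A, ∃ l a, v = F l a) ∧
      ∀ (w : V → ℝ) (b : Fin k ⊕ Fin k → ℝ), (∀ l a, w (F l a) ≤ b l) →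
      ∑ v ∈ A, w v ≤ ∑ t ∈ range s, b (g t) := by
  have : NeZero s := ⟨by omega⟩
  set y : ℕ → V := fun t => F (g t) (Fin.ofNat s t) with hy
  have hyinj : ∀ t < s, ∀ t' < s, y t = y t' → t = t' := by
    intro t ht t' ht' h
    have := Fin.ext_iff.1 (hinj _ _ _ _ h).2
    simpa [Fin.ofNat, Nat.mod_eq_of_lt ht, Nat.mod_eq_of_lt ht'] using this
  refine ⟨(range s).image y, spansCs_image_range hks (fun t => ?_) hyinj fun t _ => ?_, ?_, ?_⟩
  · simp only [hy, hper t]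
    congr 1
    ext
    simp [Fin.ofNat]
  · obtain ⟨τ, hτ⟩ := exists_section_of_window (s := s) (hwin t)
    have := hF τ _ (hwin t)
    rw [image_image] at this
    convert this using 1
    exact image_congr fun m hm => by simp only [hy, Function.comp, hτ m hm]
  · intro v hv
    obtain ⟨t, -, rfl⟩ := mem_image.1 hv
    exact ⟨_, _, rfl⟩
  · intro w b hb
    rw [sum_image fun t ht t' ht' h =>
      hyinj t (mem_range.1 ht) t' (mem_range.1 ht') h]
    exact sum_le_sum fun t _ => hb _ _

theorem exists_exchange_set (hks : k ≤ s) {g : ℕ → Fin k ⊕ Fin k}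
    (hper : Function.Periodic g s)
    (hwin : ∀ t, (Ico t (t + k)).image g ∈ labelEdges k) (i₀ : Fin k)
    (hi₀ : ∃ t₀ < s, g t₀ = Sum.inl i₀ ∧ k ≤ t₀ ∧
      ∀ t, t₀ < t + k → t < t₀ + k → ∃ a, g t = Sum.inl a)
    (F : Fin k ⊕ Fin k → Fin s → V)
    (hinj : ∀ l l' a a', F l a = F l' a' → l = l' ∧ a = a')
    (hF : ∀ τ : Fin k ⊕ Fin k → Fin s, IsLabelled E fun l => F l (τ l)) :
    ∃ Z : Finset V, Z.card = s - 1 ∧ (∀ v ∈ Z, ∃ l a, v = F l a) ∧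
      ∀ x, x ∉ Z →
        (∀ τ : Fin k ⊕ Fin k → Fin s,
          insert x ((univ.erase i₀).image fun i => F (Sum.inl i) (τ (Sum.inl i))) ∈ E) →
        SpansCs k s E (insert x Z) := by
  obtain ⟨t₀, ht₀, hgt₀, hkt₀, hpure⟩ := hi₀
  have : NeZero s := ⟨by omega⟩
  set y : ℕ → V := fun t => F (g t) (Fin.ofNat s t) with hy
  have hyinj : ∀ t < s, ∀ t' < s, y t = y t' → t = t' := by
    intro t ht t' ht' h
    have := Fin.ext_iff.1 (hinj _ _ _ _ h).2
    simpa [Fin.ofNat, Nat.mod_eq_of_lt ht, Nat.mod_eq_of_lt ht'] using this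
  have hyper : Function.Periodic y s := fun t => by
    simp only [hy, hper t]
    congr 1
    ext
    simp [Fin.ofNat]
  refine ⟨((range s).erase t₀).image y, ?_, ?_, fun x hx hxE => ?_⟩
  · rw [card_image_of_injOn, card_erase_of_mem (mem_range.2 ht₀), card_range]
    intro t ht t' ht' h
    simp only [coe_erase, coe_range, Set.mem_sdiff, Set.mem_Iio] at ht ht'
    exact hyinj t ht.1 t' ht'.1 h
  · intro v hv
    obtain ⟨t, -, rfl⟩ := mem_image.1 hv
    exact ⟨_, _, rfl⟩
  set z : ℕ → V := fun t => if t % s = t₀ then x else y t with hz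
  have hzy : ∀ t, t % s ≠ t₀ → z t = y t := fun t h => if_neg h
  have hzx : z t₀ = x := if_pos (Nat.mod_eq_of_lt ht₀)
  have himg : insert x (((range s).erase t₀).image y) = (range s).image z := by
    rw [← insert_erase (mem_range.2 ht₀), image_insert, hzx, erase_insert (by simp)]
    congr 1
    refine image_congr fun t ht => (hzy t ?_).symm
    simp only [coe_erase, coe_range, Set.mem_sdiff, Set.mem_Iio, Set.mem_singleton_iff] at ht
    rw [Nat.mod_eq_of_lt ht.1]; exact ht.2
  rw [himg]
  refine spansCs_image_range hks (fun t => ?_) (fun t ht t' ht' h => ?_) fun t ht => ?_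
  · simp only [hz, Nat.add_mod_right, hyper t]
  · simp only [hz, Nat.mod_eq_of_lt ht, Nat.mod_eq_of_lt ht'] at h
    split_ifs at h with h1 h2 h2
    · rw [h1, h2]
    · exact absurd (h ▸ mem_image_of_mem y (mem_erase.2 ⟨h2, mem_range.2 ht'⟩)) hx
    · exact absurd (h ▸ mem_image_of_mem y (mem_erase.2 ⟨h1, mem_range.2 ht⟩)) hx
    · exact hyinj t ht t' ht' h
  · obtain ⟨τ, hτ⟩ := exists_section_of_window (s := s) (hwin t)
    by_cases hmem : t₀ ∈ Ico t (t + k)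
    · rw [mem_Ico] at hmem
      have hL : (Ico t (t + k)).image g = univ.image Sum.inl := by
        rcases hwin t with h | ⟨i, j, -, -, h⟩
        · exact h
        · have : (Sum.inr j : Fin k ⊕ Fin k) ∈ (Ico t (t + k)).image g := by rw [h]; simp
          obtain ⟨m, hm, hgm⟩ := mem_image.1 this
          rw [mem_Ico] at hm
          obtain ⟨a, ha⟩ := hpure m (by omega) (by omega)
          rw [ha] at hgm; cases hgm
      have hginj : Set.InjOn g (Ico t (t + k)) := by
        apply card_image_iff.1
        rw [card_of_mem_labelEdges (hwin t)]; simp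
      have hmod : ∀ m ∈ Ico t (t + k), m ≠ t₀ → m % s ≠ t₀ := by
        intro m hm hne h
        rw [mem_Ico] at hm
        rcases Nat.lt_or_ge m s with h1 | h1
        · rw [Nat.mod_eq_of_lt h1] at h; exact hne h
        · obtain ⟨r, rfl⟩ := Nat.exists_eq_add_of_le h1
          rw [Nat.add_mod_left, Nat.mod_eq_of_lt (by omega)] at h
          omega
      convert hxE τ using 1
      ext v
      simp only [mem_image, mem_insert, mem_erase, mem_univ, and_true]
      constructor
      · rintro ⟨m, hm, rfl⟩
        by_cases hmt : m = t₀
        · left; rw [hmt, hzx]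
        · right
          have : g m ∈ univ.image Sum.inl := hL ▸ mem_image_of_mem g hm
          obtain ⟨i, -, hi⟩ := mem_image.1 this
          refine ⟨i, ?_, ?_⟩
          · rintro rfl
            exact hmt (hginj hm (mem_Ico.2 hmem) (by rw [← hi, hgt₀]))
          · rw [hzy m (hmod m hm hmt), hi, hτ m hm]
      · rintro (rfl | ⟨i, hi, rfl⟩)
        · exact ⟨t₀, mem_Ico.2 hmem, hzx⟩
        · have : (Sum.inl i : Fin k ⊕ Fin k) ∈ (Ico t (t + k)).image g := by rw [hL]; simp
          obtain ⟨m, hm, hgm⟩ := mem_image.1 this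
          refine ⟨m, hm, ?_⟩
          have hmt : m ≠ t₀ := by
            rintro rfl
            rw [hgt₀] at hgm
            exact hi (Sum.inl_injective hgm).symm
          rw [hzy m (hmod m hm hmt), ← hgm, hτ m hm]
    · have hmod : ∀ m ∈ Ico t (t + k), m % s ≠ t₀ := by
        intro m hm h
        have hm' := mem_Ico.1 hm
        rcases Nat.lt_or_ge m s with h1 | h1
        · rw [Nat.mod_eq_of_lt h1] at h
          exact hmem (h ▸ hm)
        · obtain ⟨r, rfl⟩ := Nat.exists_eq_add_of_le h1
          rw [Nat.add_mod_left, Nat.mod_eq_of_lt (by omega)] at h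
          omega
      have := hF τ _ (hwin t)
      rw [image_image] at this
      convert this using 1
      refine image_congr fun m hm => ?_
      rw [hzy m (hmod m hm)]
      simp only [hy, Function.comp, hτ m hm]

theorem mul_card_filter_walk_le {g : ℕ → Fin k ⊕ Fin k} (hper : Function.Periodic g s)
    (hwin : ∀ t, (Ico t (t + k)).image g ∈ labelEdges k) (l : Fin k ⊕ Fin k) :
    k * ((range s).filter fun t => g t = l).card ≤ s := by
  have hshift : ∀ d, ∑ t ∈ range s, (if g (t + d) = l then 1 else 0)
      = ((range s).filter fun t => g t = l).card := by
    intro d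
    rw [card_filter]
    induction d with
    | zero => simp
    | succ d ih =>
      rw [← ih]
      have h1 := sum_range_succ (fun t => if g (t + d) = l then 1 else 0) s
      have h2 := sum_range_succ' (fun t => if g (t + d) = l then 1 else 0) s
      have h3 : g (s + d) = g (0 + d) := by rw [add_comm s, hper, zero_add]
      rw [h3] at h1
      have h4 : ∀ t, t + 1 + d = t + (d + 1) := fun t => by ring
      simp only [h4] at h2
      omega
  have hwin1 : ∀ t, ∑ d ∈ range k, (if g (t + d) = l then 1 else 0) ≤ 1 := by
    intro t
    have hginj : Set.InjOn g (Ico t (t + k)) := by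
      apply card_image_iff.1
      rw [card_of_mem_labelEdges (hwin t)]; simp
    rw [← card_filter, card_le_one]
    intro a ha b hb
    simp only [mem_filter, mem_range] at ha hb
    have := hginj (x₁ := t + a) (x₂ := t + b) (by simp; omega) (by simp; omega)
      (by rw [ha.2, hb.2])
    omega
  calc k * _ = ∑ d ∈ range k, ∑ t ∈ range s, (if g (t + d) = l then 1 else 0) := by
        simp only [hshift, sum_const, card_range, smul_eq_mul]
    _ = ∑ t ∈ range s, ∑ d ∈ range k, (if g (t + d) = l then 1 else 0) := sum_comm
    _ ≤ ∑ t ∈ range s, 1 := sum_le_sum fun t _ => hwin1 t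
    _ = s := by simp

theorem exists_core_of_walk {g : ℕ → Fin k ⊕ Fin k}
    (hwin : ∀ t, (Ico t (t + k)).image g ∈ labelEdges k) (hk : 0 < k) (t : ℕ) (j : Fin k)
    (h : g t = Sum.inr j) : (j : ℕ) + 1 < k := by
  have hmem : g t ∈ (Ico t (t + k)).image g := mem_image_of_mem g (by simp [hk])
  rcases hwin t with e | ⟨i, j', hj', -, e⟩
  · rw [e, h] at hmem; simp at hmem
  · rw [e, h] at hmem
    simp only [mem_insert, Sum.inr.injEq, mem_image, reduceCtorEq, and_false, exists_false,
      or_false] at hmem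
    rw [hmem]; exact hj'

/-- The weight of a closed walk, in terms of an increasing sequence of bounds on the weights of
the labels. -/
theorem sum_walk_le (hk : 2 ≤ k) (hs : 5 * k ^ 2 ≤ s) (hnd : ¬ k ∣ s) {g : ℕ → Fin k ⊕ Fin k}
    (hper : Function.Periodic g s)
    (hwin : ∀ t, (Ico t (t + k)).image g ∈ labelEdges k)
    (huniq : ∀ t t', t < s → t' < s → ∀ j, g t = Sum.inr j → g t' = Sum.inr j → t = t')
    (i₀ j₀ : Fin k) {θ₀ θ₁ θ₂ θ₃ : ℝ} (h01 : θ₀ ≤ θ₁) (h12 : θ₁ ≤ θ₂) (h23 : θ₂ ≤ θ₃) :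
    ∑ t ∈ range s, Sum.elim (fun i => if i = i₀ then θ₁ else θ₀)
        (fun j => if j = j₀ then θ₃ else θ₂) (g t)
      ≤ s * θ₀ + (s + 1) / 2 * (θ₁ - θ₀) + (s + 3) / 4 * (θ₂ - θ₁) + (θ₃ - θ₂) := by
  set c := ((range s).filter fun t => g t = Sum.inl i₀).card with hc
  set P := (range s).filter fun t => ∃ j, g t = Sum.inr j with hP
  set Q := (range s).filter fun t => g t = Sum.inr j₀ with hQ
  have hQ1 : Q.card ≤ 1 := by
    rw [card_le_one]
    intro a ha b hb
    simp only [hQ, mem_filter, mem_range] at ha hb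
    exact huniq a b ha.1 hb.1 j₀ ha.2 hb.2
  have hP1 : P.card ≤ k - 1 := by
    rw [← card_range (k - 1)]
    refine card_le_card_of_injOn (fun t => Sum.elim (fun _ => 0) (fun j : Fin k => (j : ℕ)) (g t))
      ?_ ?_
    · intro t ht
      simp only [hP, coe_filter, Set.mem_ofPred_eq] at ht
      obtain ⟨j, hj⟩ := ht.2
      have := exists_core_of_walk hwin (by omega) t j hj
      simp only [hj, Sum.elim_inr, coe_range, Set.mem_Iio]
      omega
    · intro t ht t' ht' h
      simp only [hP, coe_filter, Set.mem_ofPred_eq, mem_range] at ht ht'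
      obtain ⟨j, hj⟩ := ht.2
      obtain ⟨j', hj'⟩ := ht'.2
      simp only [hj, hj', Sum.elim_inr] at h
      have : j = j' := Fin.ext h
      subst this
      exact huniq t t' ht.1 ht'.1 j hj hj'
  have hck := mul_card_filter_walk_le hper hwin (Sum.inl i₀)
  rw [← hc] at hck
  have hsum : ∑ t ∈ range s, Sum.elim (fun i => if i = i₀ then θ₁ else θ₀)
        (fun j => if j = j₀ then θ₃ else θ₂) (g t)
      = s * θ₀ + (c + P.card) * (θ₁ - θ₀) + P.card * (θ₂ - θ₁) + Q.card * (θ₃ - θ₂) := by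
    have e : ∀ t, Sum.elim (fun i => if i = i₀ then θ₁ else θ₀)
        (fun j => if j = j₀ then θ₃ else θ₂) (g t) = θ₀ +
          ((if g t = Sum.inl i₀ then 1 else 0) + (if ∃ j, g t = Sum.inr j then 1 else 0))
            * (θ₁ - θ₀) + (if ∃ j, g t = Sum.inr j then 1 else 0) * (θ₂ - θ₁)
          + (if g t = Sum.inr j₀ then 1 else 0) * (θ₃ - θ₂) := by
      intro t
      rcases g t with i | j
      · by_cases hi : i = i₀ <;> simp [hi]
      · by_cases hj : j = j₀ <;> simp [hj]
    simp only [e, sum_add_distrib, ← sum_mul, sum_const, card_range, nsmul_eq_mul]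
    rw [hc, hP, hQ, card_filter, card_filter, card_filter]
    push_cast
    rfl
  rw [hsum]
  have hsk : (5 : ℝ) * k ^ 2 ≤ s := by exact_mod_cast hs
  have hk2 : (2 : ℝ) ≤ k := by exact_mod_cast hk
  have hPr : (P.card : ℝ) + 1 ≤ k := by
    have : P.card + 1 ≤ k := by omega
    exact_mod_cast this
  have hQr : (Q.card : ℝ) ≤ 1 := by exact_mod_cast hQ1
  have hcP : ((c : ℝ) + P.card) ≤ (s + 1) / 2 := by
    rcases Nat.lt_or_ge 2 k with h3 | h3
    · have h3' : (3 : ℝ) ≤ k := by exact_mod_cast h3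
      have hckr : (k : ℝ) * c ≤ s := by exact_mod_cast hck
      have hc0 : (0 : ℝ) ≤ c := Nat.cast_nonneg _
      nlinarith
    · have hk' : k = 2 := by omega
      subst hk'
      have : 2 * (c + P.card) ≤ s + 1 := by omega
      have : (2 : ℝ) * (c + P.card) ≤ s + 1 := by exact_mod_cast this
      linarith
  have hP4 : (P.card : ℝ) ≤ (s + 3) / 4 := by nlinarith
  have a1 := mul_le_mul_of_nonneg_right hcP (sub_nonneg.2 h01)
  have a2 := mul_le_mul_of_nonneg_right hP4 (sub_nonneg.2 h12)
  have a3 := mul_le_mul_of_nonneg_right hQr (sub_nonneg.2 h23)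
  linarith

end Embedding

section Counting

theorem pow_mul_card_le_sum_pow {α : Type*} [Fintype α] {f : α → ℝ} (hf : ∀ a, 0 ≤ f a) {c : ℝ}
    (hc : 0 ≤ c) (h : c * Fintype.card α ≤ ∑ a, f a) (p : ℕ) :
    c ^ p * Fintype.card α ≤ ∑ a, f a ^ p := by
  rcases p with _ | p
  · simp
  rcases isEmpty_or_nonempty α with _ | _
  · simp
  have hpos : (0 : ℝ) < Fintype.card α := by exact_mod_cast Fintype.card_pos
  refine le_trans ?_ (pow_sum_div_card_le_sum_pow (s := univ) (fun i _ => hf i) p)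
  rw [card_univ, le_div_iff₀ (by positivity)]
  calc c ^ (p + 1) * Fintype.card α * Fintype.card α ^ p = (c * Fintype.card α) ^ (p + 1) := by
        ring
    _ ≤ _ := pow_le_pow_left₀ (by positivity) h _

/-- The weighted count of blow-ups of a partite structure. -/
theorem le_sum_prod_blowup {V : Type*} [Fintype V] [Nonempty V] (b m : ℕ) {W : (Fin m → V) → ℝ}
    (hW : ∀ f, 0 ≤ W f) {c : ℝ} (hc : 0 ≤ c)
    (h : c * (Fintype.card V : ℝ) ^ m ≤ ∑ f, W f) :
    c ^ b ^ m * (Fintype.card V : ℝ) ^ (m * b)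
      ≤ ∑ F : Fin m → Fin b → V, ∏ τ : Fin m → Fin b, W fun l => F l (τ l) := by
  induction m generalizing c with
  | zero =>
    simp only [pow_zero, mul_one, Fintype.sum_unique, pow_one, zero_mul, Fintype.prod_unique]
      at h ⊢
    convert h using 2
  | succ m ih =>
    set N : ℝ := ((Fintype.card V : ℕ) : ℝ) with hN
    have hN0 : 0 < N := by rw [hN]; exact_mod_cast Fintype.card_pos
    let W' : (Fin b → V) → (Fin m → V) → ℝ := fun a f => ∏ j, W (Fin.cons (a j) f)
    have hW' : ∀ a f, 0 ≤ W' a f := fun a f => prod_nonneg fun _ _ => hW _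
    have h1 : c ^ b * N ^ b * N ^ m ≤ ∑ a, ∑ f, W' a f := by
      have e : ∑ a, ∑ f, W' a f = ∑ f : Fin m → V, (∑ v, W (Fin.cons v f)) ^ b := by
        rw [sum_comm]
        exact sum_congr rfl fun f _ => (Fintype.sum_pow (fun v => W (Fin.cons v f)) b).symm
      rw [e]
      have := pow_mul_card_le_sum_pow (α := Fin m → V) (f := fun f => ∑ v, W (Fin.cons v f))
        (fun f => sum_nonneg fun _ _ => hW _) (c := c * N) (by positivity) (by
          rw [sum_comm, ← Fintype.sum_prod_type' (f := fun v f => W (Fin.cons v f))]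
          rw [Fintype.sum_equiv (Fin.consEquiv fun _ => V)
            (fun x => W (Fin.cons x.1 x.2)) W (fun _ => rfl)]
          refine le_trans (le_of_eq ?_) h
          simp only [Fintype.card_fun, Fintype.card_fin, Nat.cast_pow, ← hN]
          ring) b
      simpa only [Fintype.card_fun, Fintype.card_fin, Nat.cast_pow, ← hN, mul_pow] using this
    have h2 : ∀ a, ((∑ f, W' a f) / N ^ m) ^ b ^ m * N ^ (m * b)
        ≤ ∑ F : Fin m → Fin b → V, ∏ τ : Fin m → Fin b, W' a fun l => F l (τ l) := by
      intro a
      refine ih (hW' a) (div_nonneg (sum_nonneg fun _ _ => hW' a _) (by positivity)) ?_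
      rw [div_mul_cancel₀ _ (pow_pos hN0 m).ne']
    have h3 : (c ^ b) ^ b ^ m * N ^ b ≤ ∑ a, ((∑ f, W' a f) / N ^ m) ^ b ^ m := by
      have := pow_mul_card_le_sum_pow (α := Fin b → V) (f := fun a => (∑ f, W' a f) / N ^ m)
        (fun a => div_nonneg (sum_nonneg fun _ _ => hW' a _) (by positivity)) (c := c ^ b)
        (by positivity) (by
          simp only [Fintype.card_fun, Fintype.card_fin, Nat.cast_pow, ← hN]
          rwa [← sum_div, le_div_iff₀ (pow_pos hN0 m)]) (b ^ m)
      simpa only [Fintype.card_fun, Fintype.card_fin, Nat.cast_pow, ← hN] using this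
    calc c ^ b ^ (m + 1) * N ^ ((m + 1) * b) = ((c ^ b) ^ b ^ m * N ^ b) * N ^ (m * b) := by
          rw [← pow_mul]; ring
      _ ≤ (∑ a, ((∑ f, W' a f) / N ^ m) ^ b ^ m) * N ^ (m * b) :=
          mul_le_mul_of_nonneg_right h3 (by positivity)
      _ ≤ ∑ a : Fin b → V, ∑ F : Fin m → Fin b → V, ∏ τ : Fin m → Fin b,
            W' a fun l => F l (τ l) := by
          rw [sum_mul]; exact sum_le_sum fun a _ => h2 a
      _ = _ := by
          rw [← Fintype.sum_prod_type'
            (f := fun (a : Fin b → V) (F : Fin m → Fin b → V) => ∏ τ : Fin m → Fin b, W' a fun l => F l (τ l))]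
          refine Fintype.sum_equiv (Fin.consEquiv fun _ => Fin b → V) _ _ fun p => ?_
          rw [← Fintype.prod_equiv (Fin.consEquiv fun _ => Fin b)
            (fun q => W fun l => Fin.consEquiv (fun _ => Fin b → V) p l
              (Fin.consEquiv (fun _ => Fin b) q l)) _ (fun _ => rfl), Fintype.prod_prod_type_right]
          refine prod_congr rfl fun τ _ => prod_congr rfl fun j _ => ?_
          congr 1
          funext l
          refine Fin.cases ?_ (fun l => ?_) l <;> simp [Fin.consEquiv]

theorem card_not_injective_le {J V : Type*} [Fintype J] [DecidableEq J] [Fintype V]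
    [DecidableEq V] [DecidablePred fun x : J → V => ¬ Function.Injective x] :
    (univ.filter fun x : J → V => ¬ Function.Injective x).card
      ≤ Fintype.card J ^ 2 * Fintype.card V ^ (Fintype.card J - 1) := by
  have h1 : (univ.filter fun x : J → V => ¬ Function.Injective x)
      ⊆ (univ.filter fun p : J × J => p.1 ≠ p.2).biUnion
        fun p => univ.filter fun x : J → V => x p.1 = x p.2 := by
    intro x hx
    simp only [mem_filter, mem_univ, true_and, Function.Injective, not_forall] at hx
    obtain ⟨a, b, h, hab⟩ := hx
    simp only [mem_biUnion, mem_filter, mem_univ, true_and]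
    exact ⟨(a, b), hab, h⟩
  refine (card_le_card h1).trans ((card_biUnion_le_card_mul _ _
    (Fintype.card V ^ (Fintype.card J - 1)) fun p hp => ?_).trans ?_)
  · have hp' : p.1 ≠ p.2 := by simpa using hp
    have : Fintype.card V ^ (Fintype.card J - 1) = Fintype.card ({j // j ≠ p.1} → V) := by
      rw [Fintype.card_fun, Fintype.card_subtype_compl, Fintype.card_subtype_eq]
    rw [this]
    refine card_le_card_of_injOn (t := univ) (fun x j => x j) (fun _ _ => mem_coe.2 (mem_univ _)) ?_
    intro x hx y hy hxy
    simp only [coe_filter, mem_univ, true_and, Set.mem_ofPred_eq] at hx hy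
    funext j
    by_cases hj : j = p.1
    · rw [hj, hx, hy]
      exact congr_fun hxy ⟨p.2, hp'.symm⟩
    · exact congr_fun hxy ⟨j, hj⟩
  · refine Nat.mul_le_mul_right _ ((card_filter_le _ _).trans ?_)
    simp [sq]

open Classical in
/-- A positive proportion of configurations yields a positive proportion of blown-up
configurations with distinct vertices. -/
theorem exists_blowup_count (ι : Type) [Fintype ι] [Nonempty ι] (b : ℕ) (hb : 0 < b) (c : ℝ)
    (hc : 0 < c) : ∃ c' > 0, ∃ N₀ : ℕ, ∀ (V : Type) [Fintype V], N₀ ≤ Fintype.card V →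
      ∀ P : (ι → V) → Prop,
        c * (Fintype.card V : ℝ) ^ Fintype.card ι ≤ (univ.filter P).card →
        c' * (Fintype.card V : ℝ) ^ Fintype.card (ι × Fin b) ≤
          (univ.filter fun F : ι × Fin b → V => Function.Injective F ∧
            ∀ τ : ι → Fin b, P fun l => F (l, τ l)).card := by
  set m := Fintype.card ι with hm
  set J := ι × Fin b
  have hJ : Fintype.card J = m * b := by simp [J, hm]
  have hmpos : 0 < m := Fintype.card_pos
  set c₀ : ℝ := c ^ b ^ m with hc₀
  have hc₀pos : 0 < c₀ := by positivity
  obtain ⟨N₀, hN₀⟩ := exists_nat_ge (2 * (m * b : ℝ) ^ 2 / c₀)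
  refine ⟨c₀ / 2, by positivity, N₀ + 1, fun V _ hV P hP => ?_⟩
  set N : ℝ := ((Fintype.card V : ℕ) : ℝ) with hN
  have hNpos : 0 < N := by
    have : 0 < Fintype.card V := by omega
    rw [hN]; exact_mod_cast this
  have : Nonempty V := Fintype.card_pos_iff.1 (by omega)
  have hNN : 2 * (m * b : ℝ) ^ 2 ≤ c₀ * N := by
    have h1 : (N₀ : ℝ) ≤ N := by
      rw [hN]; exact_mod_cast (by omega : N₀ ≤ Fintype.card V)
    have h2 := hN₀.trans h1
    rw [div_le_iff₀ hc₀pos] at h2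
    linarith
  let e : ι ≃ Fin m := Fintype.equivFin ι
  let W : (Fin m → V) → ℝ := fun f => if P fun l => f (e l) then 1 else 0
  have hW : ∀ f, 0 ≤ W f := fun f => by simp only [W]; split_ifs <;> norm_num
  have h1 := le_sum_prod_blowup b m hW hc.le (by
    refine hP.trans (le_of_eq ?_)
    simp only [W]
    rw [card_filter]
    push_cast
    exact Fintype.sum_equiv (Equiv.arrowCongr e (Equiv.refl V)) _ _ fun f => by
      simp [Equiv.arrowCongr])
  have h2 : ∑ F : Fin m → Fin b → V, ∏ τ : Fin m → Fin b, W (fun l => F l (τ l))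
      = ((univ.filter fun F : J → V => ∀ τ : ι → Fin b, P fun l => F (l, τ l)).card : ℝ) := by
    rw [card_filter]
    push_cast
    symm
    refine Fintype.sum_equiv ((Equiv.curry ι (Fin b) V).trans
      (Equiv.arrowCongr e (Equiv.refl _))) _ _ fun F => ?_
    rw [prod_ite_zero]
    simp only [prod_const_one, mem_univ, true_implies]
    congr 1
    rw [eq_iff_iff]
    constructor
    · intro h τ
      simpa [Equiv.arrowCongr] using h fun l => τ (e l)
    · intro h τ
      simpa [Equiv.arrowCongr] using h fun l => τ (e.symm l)
  rw [h2] at h1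
  have h3 := card_not_injective_le (J := J) (V := V)
  have h4 : (univ.filter fun F : J → V => ∀ τ : ι → Fin b, P fun l => F (l, τ l)).card
      ≤ (univ.filter fun F : J → V => Function.Injective F ∧
            ∀ τ : ι → Fin b, P fun l => F (l, τ l)).card
        + (univ.filter fun x : J → V => ¬ Function.Injective x).card := by
    rw [← card_union_add_card_inter]
    refine (card_le_card ?_).trans (Nat.le_add_right _ _)
    intro F hF
    simp only [mem_filter, mem_univ, true_and, mem_union] at hF ⊢
    tauto
  have h5 := h4.trans (Nat.add_le_add_left h3 _)
  have h6 := (Nat.cast_le (α := ℝ)).2 h5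
  push_cast at h6
  rw [hJ] at h6 ⊢
  rw [← hN] at h6 h1
  obtain ⟨r, hr⟩ : ∃ r, m * b = r + 1 := ⟨m * b - 1, by
    have := Nat.mul_pos hmpos hb; omega⟩
  have hcast : ((m * b : ℕ) : ℝ) = (m : ℝ) * b := by push_cast; ring
  have h7 : ((m * b : ℕ) : ℝ) ^ 2 * N ^ (m * b - 1) ≤ c₀ / 2 * N ^ (m * b) := by
    rw [hcast]
    rw [hr, Nat.add_sub_cancel, pow_succ N r]
    have := mul_le_mul_of_nonneg_right hNN (pow_nonneg hNpos.le r)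
    nlinarith
  linarith

open Classical in
/-- Sequential counting: the `i`-th coordinate may be chosen in many ways, given valid choices of
the earlier ones. -/
theorem pow_le_card_of_sequential {V : Type*} [Fintype V] [Nonempty V] {m : ℕ}
    (C : Fin m → (Fin m → V) → Finset V)
    (hdep : ∀ i f f', (∀ j < i, f j = f' j) → C i f = C i f') {a : ℝ} (ha : 0 ≤ a)
    (hC : ∀ i f, (∀ j < i, f j ∈ C j f) → a ≤ (C i f).card) :
    a ^ m ≤ (univ.filter fun f : Fin m → V => ∀ i, f i ∈ C i f).card := by
  set N : ℝ := ((Fintype.card V : ℕ) : ℝ) with hN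
  have hNpos : 0 < N := by rw [hN]; exact_mod_cast Fintype.card_pos
  let G : ℕ → Finset (Fin m → V) := fun p =>
    univ.filter fun f => ∀ i : Fin m, (i : ℕ) < p → f i ∈ C i f
  have key : ∀ p ≤ m, a ^ p * N ^ (m - p) ≤ (G p).card := by
    intro p hp
    induction p with
    | zero => simp [G, hN]
    | succ p ih =>
      have hpm : p < m := by omega
      set i : Fin m := ⟨p, hpm⟩
      have h1 : ((G p).sigma fun f => C i f).card ≤ (G (p + 1) ×ˢ (univ : Finset V)).card := by
        refine card_le_card_of_injOn (fun q => (Function.update q.1 i q.2, q.1 i)) ?_ ?_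
        · rintro ⟨f, v⟩ hq
          simp only [coe_sigma, Set.mem_sigma_iff, mem_coe, G, mem_filter, mem_univ, true_and]
            at hq
          simp only [coe_product, Set.mem_prod, mem_coe, mem_univ, and_true, G, mem_filter,
            true_and]
          intro j hj
          have hup : ∀ j' < j, Function.update f i v j' = f j' := fun j' hj' =>
            Function.update_of_ne (by
              rintro rfl
              have := Fin.lt_def.1 hj'
              simp only [i] at this; omega) _ _
          rw [hdep j _ f hup]
          rcases eq_or_ne j i with rfl | hji
          · rw [Function.update_self]; exact hq.2
          · rw [Function.update_of_ne hji]
            refine hq.1 j ?_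
            have : (j : ℕ) ≠ p := fun h => hji (Fin.ext h)
            omega
        · rintro ⟨f, v⟩ - ⟨f', v'⟩ - h
          simp only [Prod.mk.injEq] at h
          have hv : v = v' := by
            have := congr_fun h.1 i
            simpa using this
          have hf : f = f' := by
            funext j
            rcases eq_or_ne j i with rfl | hji
            · exact h.2
            · have := congr_fun h.1 j
              simpa [Function.update_of_ne hji] using this
          rw [hf, hv]
      rw [card_sigma, card_product, card_univ] at h1
      have h2 : a * (G p).card ≤ (G (p + 1)).card * N := by
        have h3 : (∑ f ∈ G p, ((C i f).card : ℝ)) ≤ (G (p + 1)).card * N := by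
          rw [hN]; exact_mod_cast h1
        refine le_trans ?_ h3
        rw [mul_comm, ← nsmul_eq_mul]
        refine card_nsmul_le_sum _ _ _ fun f hf => hC i f fun j hj => ?_
        simp only [G, mem_filter, mem_univ, true_and] at hf
        exact hf j hj
      have h4 := mul_le_mul_of_nonneg_left (ih (by omega)) ha
      have h5 : m - p = (m - (p + 1)) + 1 := by omega
      rw [h5, pow_succ] at h4
      have h6 : a ^ (p + 1) * N ^ (m - (p + 1)) * N ≤ (G (p + 1)).card * N :=
        le_trans (le_of_eq (by ring)) (h4.trans h2)
      exact le_of_mul_le_mul_right h6 hNpos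
  have := key m le_rfl
  rw [Nat.sub_self, pow_zero, mul_one] at this
  refine this.trans (le_of_eq ?_)
  congr 2
  ext f
  simp [G]

open Classical in
/-- Extending core tuples by independent choices of pendant vertices. -/
theorem pow_le_card_sum_extend {V ι κ : Type*} [Fintype V] [Fintype ι] [Fintype κ]
    (S : Finset (ι → V)) (C : (ι → V) → κ → Finset V) {a b : ℝ} (ha : 0 ≤ a)
    (hS : b ≤ S.card) (hC : ∀ u ∈ S, ∀ j, a ≤ (C u j).card) :
    b * a ^ Fintype.card κ ≤ (univ.filter fun f : ι ⊕ κ → V =>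
      f ∘ Sum.inl ∈ S ∧ ∀ j, f (Sum.inr j) ∈ C (f ∘ Sum.inl) j).card := by
  have h1 : (univ.filter fun f : ι ⊕ κ → V =>
      f ∘ Sum.inl ∈ S ∧ ∀ j, f (Sum.inr j) ∈ C (f ∘ Sum.inl) j).card
      = (S.sigma fun u => Fintype.piFinset (C u)).card := by
    refine card_bij' (fun f _ => ⟨f ∘ Sum.inl, f ∘ Sum.inr⟩) (fun p _ => Sum.elim p.1 p.2)
      ?_ ?_ ?_ ?_
    · intro f hf
      simpa [Fintype.mem_piFinset] using hf
    · rintro ⟨u, x⟩ hp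
      simpa [Fintype.mem_piFinset] using hp
    · intro f _
      exact Sum.elim_comp_inl_inr f
    · rintro ⟨u, x⟩ _
      rfl
  rw [h1, card_sigma]
  push_cast
  calc b * a ^ Fintype.card κ ≤ S.card * a ^ Fintype.card κ :=
        mul_le_mul_of_nonneg_right hS (by positivity)
    _ = ∑ _u ∈ S, a ^ Fintype.card κ := by rw [sum_const, nsmul_eq_mul]
    _ ≤ _ := sum_le_sum fun u hu => by
        rw [Fintype.card_piFinset]
        push_cast
        rw [← card_univ, ← prod_const]
        exact prod_le_prod (fun _ _ => ha) fun j _ => hC u hu j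

end Counting

/-- A graph without three pairwise nonadjacent vertices is covered by two paths. -/
theorem exists_two_chains {α : Type*} [DecidableEq α] {G : α → α → Prop}
    (hsymm : ∀ a b, G a b → G b a)
    (htri : ∀ a b c, a ≠ b → a ≠ c → b ≠ c → G a b ∨ G a c ∨ G b c) (A : Finset α) :
    ∃ l₁ l₂ : List α, (l₁ ++ l₂).Nodup ∧ (∀ a, a ∈ l₁ ++ l₂ ↔ a ∈ A) ∧
      l₁.IsChain G ∧ l₂.IsChain G := by
  induction A using Finset.induction_on with
  | empty => exact ⟨[], [], by simp⟩
  | insert v A hv ih =>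
    obtain ⟨l₁, l₂, hnd, hA, h1, h2⟩ := ih
    have hv' : v ∉ l₁ ++ l₂ := fun h => hv ((hA v).1 h)
    rcases l₁ with _ | ⟨a, l₁⟩
    · exact ⟨[v], l₂, List.nodup_cons.2 ⟨hv', hnd⟩, fun a => by simp [← hA], by simp, h2⟩
    rcases l₂ with _ | ⟨b, l₂⟩
    · refine ⟨[v], a :: l₁, List.nodup_cons.2 ⟨by simpa using hv', by simpa using hnd⟩,
        fun a => by simp [← hA], by simp, h1⟩
    have hva : v ≠ a := by rintro rfl; simp at hv'
    have hvb : v ≠ b := by rintro rfl; simp at hv'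
    have hab : a ≠ b := by rintro rfl; simp at hnd
    rcases htri v a b hva hvb hab with h | h | h
    · refine ⟨v :: a :: l₁, b :: l₂, List.nodup_cons.2 ⟨hv', hnd⟩, fun a => by simp [← hA], ?_, h2⟩
      exact List.isChain_cons_cons.2 ⟨h, h1⟩
    · refine ⟨a :: l₁, v :: b :: l₂, ?_, fun x => ?_, h1, List.isChain_cons_cons.2 ⟨h, h2⟩⟩
      · rw [List.nodup_middle]; exact List.nodup_cons.2 ⟨hv', hnd⟩
      · rw [mem_insert, ← hA]
        simp only [List.mem_append, List.mem_cons]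
        tauto
    · refine ⟨[v], (a :: l₁).reverse ++ b :: l₂, ?_, fun x => ?_, by simp, ?_⟩
      · refine List.nodup_cons.2 ⟨by simp at hv' ⊢; tauto, ?_⟩
        refine (List.Perm.nodup_iff (List.Perm.append_right _ (List.reverse_perm _))).2 hnd
      · rw [mem_insert, ← hA]
        simp only [List.mem_append, List.mem_cons, List.mem_reverse, List.not_mem_nil, or_false]
      · rw [List.isChain_append, List.isChain_reverse]
        refine ⟨h1.imp fun a b => hsymm a b, h2, ?_⟩
        simpa using h

theorem exists_perm_of_no_three {k : ℕ} (hk : 0 < k) {G : Fin k → Fin k → Prop}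
    (hsymm : ∀ a b, G a b → G b a)
    (htri : ∀ a b c, a ≠ b → a ≠ c → b ≠ c → G a b ∨ G a c ∨ G b c) :
    ∃ (σ : Equiv.Perm (Fin k)) (j₀ : Fin k), ∀ (j : Fin k) (hj : (j : ℕ) + 1 < k), j ≠ j₀ →
      G (σ j) (σ ⟨j + 1, hj⟩) := by
  obtain ⟨l₁, l₂, hnd, hA, h1, h2⟩ := exists_two_chains hsymm htri univ
  have hmem : ∀ a, a ∈ l₁ ++ l₂ := fun a => (hA a).2 (mem_univ a)
  let e := hnd.getEquivOfForallMemList _ hmem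
  have hlen : (l₁ ++ l₂).length = k := by simpa using Fintype.card_congr e
  have hlen' : l₁.length + l₂.length = k := by simpa using hlen
  refine ⟨(finCongr hlen.symm).trans e, ⟨l₁.length - 1, by omega⟩, fun j hj hne => ?_⟩
  have hne' : (j : ℕ) ≠ l₁.length - 1 := fun h => hne (Fin.ext h)
  have hval : ∀ i : Fin k, ((finCongr hlen.symm).trans e) i = (l₁ ++ l₂)[(i : ℕ)] := fun _ => rfl
  rw [hval, hval]
  dsimp only
  rcases Nat.lt_or_ge ((j : ℕ) + 1) l₁.length with h | h
  · rw [List.getElem_append_left h, List.getElem_append_left (by omega)]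
    exact List.isChain_iff_getElem.1 h1 _ h
  · rw [List.getElem_append_right h, List.getElem_append_right (by omega)]
    have := List.isChain_iff_getElem.1 h2 (j - l₁.length) (by omega)
    convert this using 2
    omega

theorem exists_levels {V : Type*} [DecidableEq V] (X : Finset V) (hX : X.Nonempty) (w : V → ℝ) :
    ∃ (L : ℕ → Finset V) (θ : ℕ → ℝ), Monotone L ∧ Monotone θ ∧
      (∀ t, L t ⊆ X) ∧ (∀ t ≤ X.card, (L t).card = t) ∧ (∀ t, ∃ v, θ t = w v) ∧
      (∀ t, ∀ v ∈ L t, w v ≤ θ t) ∧ ∀ t, ∀ v ∈ X, v ∉ L t → θ t ≤ w v := by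
  obtain ⟨n, hn⟩ : ∃ n, X.card = n + 1 := ⟨X.card - 1, by have := hX.card_pos; omega⟩
  let e₀ : Fin (n + 1) ≃ X := (X.equivFinOfCardEq hn).symm
  let e : Fin (n + 1) ≃ X := (Tuple.sort fun i => w (e₀ i)).trans e₀
  have hmono : Monotone fun i => w (e i) := Tuple.monotone_sort fun i => w (e₀ i)
  refine ⟨fun t => (univ.filter fun i : Fin (n + 1) => (i : ℕ) < t).image fun i => (e i : V),
    fun t => w (e ⟨min (t - 1) n, by omega⟩), ?_, ?_, ?_, ?_, fun t => ⟨_, rfl⟩, ?_, ?_⟩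
  · intro t t' h
    refine image_subset_image fun i hi => ?_
    simp only [mem_filter, mem_univ, true_and] at hi ⊢
    omega
  · intro t t' h
    refine hmono (Fin.mk_le_mk.2 ?_)
    omega
  · intro t v hv
    obtain ⟨i, -, rfl⟩ := mem_image.1 hv
    exact (e i).2
  · intro t ht
    rw [card_image_of_injective _ fun a b h => e.injective (Subtype.ext h)]
    rw [Fin.card_filter_val_lt]
    omega
  · intro t v hv
    obtain ⟨i, hi, rfl⟩ := mem_image.1 hv
    simp only [mem_filter, mem_univ, true_and] at hi
    refine hmono (Fin.le_def.2 ?_)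
    have := i.2
    simp only
    omega
  · intro t v hv hvt
    obtain ⟨i, hi⟩ := e.surjective ⟨v, hv⟩
    have hiv : (e i : V) = v := by rw [hi]
    rw [← hiv]
    refine hmono (Fin.le_def.2 ?_)
    have : t ≤ i := by
      by_contra hlt
      exact hvt (mem_image.2 ⟨i, by simp; omega, hiv⟩)
    simp only
    omega

theorem card_add_card_le_card_inter_add {V : Type*} [DecidableEq V] {A B X : Finset V} (hA : A ⊆ X) (hB : B ⊆ X) :
    A.card + B.card ≤ (A ∩ B).card + X.card := by
  rw [← card_union_add_card_inter, add_comm]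
  exact Nat.add_le_add_left (card_le_card (union_subset hA hB)) _

theorem card_add_card_add_card_le {V : Type*} [DecidableEq V] {A B C X : Finset V} (hA : A ⊆ X) (hB : B ⊆ X) (hC : C ⊆ X) :
    A.card + B.card + C.card ≤
      X.card + (A ∩ B).card + (A ∩ C).card + (B ∩ C).card := by
  have h1 := card_union_add_card_inter A B
  have h2 := card_union_add_card_inter (A ∪ B) C
  have h3 : ((A ∪ B) ∩ C).card ≤ (A ∩ C).card + (B ∩ C).card := by
    rw [union_inter_distrib_right]; exact card_union_le _ _
  have h4 := card_le_card (union_subset (union_subset hA hB) hC)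
  omega

section Neighbours

variable {V : Type} [Fintype V] [DecidableEq V]

/-- The vertices forming an edge together with `S`. -/
def nbr (E : Finset (Finset V)) (S : Finset V) : Finset V :=
  univ.filter fun v => v ∉ S ∧ insert v S ∈ E

theorem mem_nbr {E : Finset (Finset V)} {S : Finset V} {v : V} :
    v ∈ nbr E S ↔ v ∉ S ∧ insert v S ∈ E := by simp [nbr]

theorem card_nbr {k : ℕ} (hk : 0 < k) {E : Finset (Finset V)} (hE : IsKGraph k E) {S : Finset V}
    (hS : S.card = k - 1) : (nbr E S).card = degS E S := by
  unfold degS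
  refine card_bij (fun v _ => insert v S) (fun v hv => ?_) (fun v hv w hw h => ?_) fun e he => ?_
  · rw [mem_nbr] at hv
    exact mem_filter.2 ⟨hv.2, subset_insert _ _⟩
  · rw [mem_nbr] at hv hw
    have : v ∈ insert w S := h ▸ mem_insert_self v S
    exact (mem_insert.1 this).resolve_right hv.1
  · rw [mem_filter] at he
    have h1 : (e \ S).card = 1 := by
      rw [card_sdiff_of_subset he.2, hE e he.1, hS]; omega
    obtain ⟨v, hv⟩ := card_eq_one.1 h1
    have hv' : v ∈ e \ S := by rw [hv]; exact mem_singleton_self v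
    have hins : insert v S = e := by
      rw [insert_eq, ← hv, sdiff_union_of_subset he.2]
    exact ⟨v, mem_nbr.2 ⟨(mem_sdiff.1 hv').2, hins ▸ he.1⟩, hins⟩

theorem isLabelled_of_mem_nbr {k : ℕ} {E : Finset (Finset V)} {f : Fin k ⊕ Fin k → V}
    (σ : Equiv.Perm (Fin k)) (hcore : univ.image (fun i => f (Sum.inl i)) ∈ E)
    (hx : ∀ (j : Fin k) (hj : (j : ℕ) + 1 < k),
      f (Sum.inr j) ∈ nbr E ((univ.erase (σ j)).image fun i => f (Sum.inl i)) ∧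
      f (Sum.inr j) ∈ nbr E ((univ.erase (σ ⟨j + 1, hj⟩)).image fun i => f (Sum.inl i))) :
    IsLabelled E fun l => f (Sum.map σ id l) := by
  rintro L (rfl | ⟨i, j, hj, hij, rfl⟩)
  · rw [image_image]
    convert hcore using 1
    ext v
    simp only [mem_image, mem_univ, true_and, Function.comp, Sum.map_inl]
    exact σ.exists_congr_left.trans (by simp)
  · have himg : (insert (Sum.inr j) ((univ.erase i).image Sum.inl)).image
        (fun l => f (Sum.map σ id l))
        = insert (f (Sum.inr j)) ((univ.erase (σ i)).image fun i => f (Sum.inl i)) := by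
      rw [image_insert, image_image]
      congr 1
      ext v
      simp only [mem_image, mem_erase, mem_univ, and_true, Function.comp, Sum.map_inl]
      constructor
      · rintro ⟨a, ha, rfl⟩
        exact ⟨σ a, fun h => ha (σ.injective h), rfl⟩
      · rintro ⟨a, ha, rfl⟩
        exact ⟨σ.symm a, by rintro rfl; simp at ha, by simp⟩
    rw [himg]
    rcases hij with rfl | h
    · exact (mem_nbr.1 (hx _ hj).1).2
    · have : i = ⟨j + 1, hj⟩ := Fin.ext h
      rw [this]
      exact (mem_nbr.1 (hx _ hj).2).2

end Neighbours

theorem injOn_of_notMem_image_Iio {ι V : Type*} [Fintype ι] [LinearOrder ι]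
    [LocallyFiniteOrderBot ι] [DecidableEq V] {u : ι → V} {S : Set ι}
    (h : ∀ j ∈ S, u j ∉ (Iio j).image u) : Set.InjOn u S := by
  intro a ha b hb hab
  rcases lt_trichotomy a b with hlt | heq | hlt
  · exact absurd (mem_image.2 ⟨a, mem_Iio.2 hlt, hab⟩) (h b hb)
  · exact heq
  · exact absurd (mem_image.2 ⟨b, mem_Iio.2 hlt, hab.symm⟩) (h a ha)

open Classical in
theorem exists_div_le_card_fiber {α β : Type*} [Fintype β] [Nonempty β] {Q : ℕ}
    (hQ : Fintype.card β = Q) (T : Finset α) (p : α → β) {x : ℝ} (h : x ≤ T.card) :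
    ∃ b, x / Q ≤ (T.filter fun a => p a = b).card := by
  subst hQ
  have hcard : (0 : ℝ) < Fintype.card β := by exact_mod_cast Fintype.card_pos
  obtain ⟨b, -, hb⟩ := exists_le_card_fiber_of_nsmul_le_card_of_maps_to
    (s := T) (t := univ) (f := p) (b := x / Fintype.card β)
    (fun _ _ => mem_univ _) univ_nonempty (by
      rw [card_univ, nsmul_eq_mul, mul_div_cancel₀ _ hcard.ne']
      exact h)
  exact ⟨b, hb⟩

section Tiles

variable {V : Type} [Fintype V] [DecidableEq V] {k s : ℕ} {E : Finset (Finset V)}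

open Classical in
/-- Many edges have all but the last vertex in `L₀` and the last one in `L₁`. -/
theorem card_cores_ge [Nonempty V] (last : Fin k) (hlast : (last : ℕ) + 1 = k) {X L₀ L₁ : Finset V}
    (h1 : L₁ ⊆ X) {q a : ℝ} (ha : 0 ≤ a)
    (hq : ∀ S : Finset V, S.card = k - 1 → q ≤ (nbr E S ∩ X).card)
    (ha0 : a + k ≤ L₀.card) (ha1 : a + X.card ≤ q + L₁.card) :
    a ^ k ≤ (univ.filter fun u : Fin k → V => Function.Injective u ∧ univ.image u ∈ E ∧
      (∀ i, i ≠ last → u i ∈ L₀) ∧ u last ∈ L₁).card := by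
  have hle : ∀ i : Fin k, i ≤ last := fun i => Fin.le_def.2 (by have := i.2; omega)
  let C : Fin k → (Fin k → V) → Finset V := fun i u =>
    if i ≠ last then L₀ \ (Iio i).image u else nbr E ((Iio i).image u) ∩ L₁
  have hnew : ∀ i u, u i ∈ C i u → u i ∉ (Iio i).image u := by
    intro i u h
    simp only [C] at h
    split_ifs at h with hi
    · exact (mem_sdiff.1 h).2
    · exact (mem_nbr.1 (mem_inter.1 h).1).1
  refine (pow_le_card_of_sequential C ?_ ha ?_).trans ?_
  · intro i f f' h
    have : (Iio i).image f = (Iio i).image f' := image_congr fun j hj => h j (mem_Iio.1 hj)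
    simp only [C, this]
  · intro i f hf
    simp only [C]
    split_ifs with hi
    · have h3 : ((Iio i).image f).card ≤ k := by
        refine card_image_le.trans ((card_le_univ _).trans ?_)
        simp
      have h4 := le_card_sdiff ((Iio i).image f) L₀
      have h5 : L₀.card ≤ (L₀ \ (Iio i).image f).card + k := by omega
      have h6 : (L₀.card : ℝ) ≤ (L₀ \ (Iio i).image f).card + k := by exact_mod_cast h5
      linarith
    · rw [not_not] at hi
      have h3 : ((Iio i).image f).card = k - 1 := by
        rw [card_image_of_injOn (injOn_of_notMem_image_Iio fun j hj =>
          hnew j f (hf j (mem_Iio.1 hj))), Fin.card_Iio, hi]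
        omega
      have h4 := hq _ h3
      have h5 := card_add_card_le_card_inter_add
        (inter_subset_right : nbr E ((Iio i).image f) ∩ X ⊆ X) h1
      have h6 : nbr E ((Iio i).image f) ∩ X ∩ L₁ = nbr E ((Iio i).image f) ∩ L₁ := by
        rw [inter_assoc, inter_eq_right.2 h1]
      rw [h6] at h5
      have h7 : ((nbr E ((Iio i).image f) ∩ X).card : ℝ) + L₁.card
          ≤ (nbr E ((Iio i).image f) ∩ L₁).card + X.card := by exact_mod_cast h5
      linarith
  · refine Nat.cast_le.2 (card_le_card fun u hu => ?_)
    simp only [mem_filter, mem_univ, true_and] at hu ⊢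
    have hinj : Function.Injective u := Set.injOn_univ.1
      (injOn_of_notMem_image_Iio fun j _ => hnew j u (hu j))
    have hl := hu last
    simp only [C, ne_eq, not_true_eq_false, if_false] at hl
    have hl' := mem_inter.1 hl
    refine ⟨hinj, ?_, fun i hi => ?_, hl'.2⟩
    · have : insert (u last) ((Iio last).image u) = univ.image u := by
        rw [← image_insert]
        congr 1
        ext i
        simp [hle i]
      rw [← this]
      exact (mem_nbr.1 hl'.1).2
    · have := hu i
      simp only [C, if_pos hi] at this
      exact (mem_sdiff.1 this).1

open Classical in
/-- The core vertices can be ordered such that consecutive ones have many common neighbours in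
`L₂`, with a single exception for which there are many in `L₃`. -/
theorem exists_order_core (hk : 0 < k) {X L₂ L₃ : Finset V} (h2 : L₂ ⊆ X) (h3 : L₃ ⊆ X) {q η : ℝ}
    (hq : ∀ S : Finset V, S.card = k - 1 → q ≤ (nbr E S ∩ X).card)
    (hη2 : 3 * X.card + 3 * η < 3 * q + 2 * L₂.card) (hη3 : 2 * X.card + η ≤ 2 * q + L₃.card)
    (hc2 : η ≤ L₂.card) (hc3 : η ≤ L₃.card) {u : Fin k → V} (hu : Function.Injective u) :
    ∃ (σ : Equiv.Perm (Fin k)) (j₀ : Fin k), ∀ j,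
      η ≤ ((if j = j₀ then L₃ else L₂).filter fun v => ∀ hj : (j : ℕ) + 1 < k,
        v ∈ nbr E ((univ.erase (σ j)).image u) ∧
        v ∈ nbr E ((univ.erase (σ ⟨j + 1, hj⟩)).image u)).card := by
  let M : Fin k → Finset V := fun i => nbr E ((univ.erase i).image u)
  have hM : ∀ i, q ≤ (M i ∩ X).card := fun i => hq _ (by
    rw [card_image_of_injective _ hu, card_erase_of_mem (mem_univ _)]; simp)
  have hML : ∀ i, q + L₂.card ≤ (M i ∩ L₂).card + X.card := by
    intro i
    have h5 := card_add_card_le_card_inter_add (inter_subset_right : M i ∩ X ⊆ X) h2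
    rw [inter_assoc, inter_eq_right.2 h2] at h5
    have h7 : ((M i ∩ X).card : ℝ) + L₂.card ≤ (M i ∩ L₂).card + X.card := by exact_mod_cast h5
    linarith [hM i]
  have hM3 : ∀ i j, η ≤ (M i ∩ M j ∩ L₃).card := by
    intro i j
    have h5 := card_add_card_le_card_inter_add (inter_subset_right : M i ∩ X ⊆ X)
      (inter_subset_right : M j ∩ X ⊆ X)
    have h6 := card_add_card_le_card_inter_add
      (inter_subset_left.trans inter_subset_right : M i ∩ X ∩ (M j ∩ X) ⊆ X) h3
    have e : M i ∩ X ∩ (M j ∩ X) ∩ L₃ = M i ∩ M j ∩ L₃ := by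
      ext v
      simp only [mem_inter]
      have := @h3 v
      tauto
    rw [e] at h6
    have h7 : ((M i ∩ X).card : ℝ) + (M j ∩ X).card + L₃.card
      ≤ (M i ∩ M j ∩ L₃).card + 2 * X.card := by
      have : (M i ∩ X).card + (M j ∩ X).card + L₃.card
        ≤ (M i ∩ M j ∩ L₃).card + 2 * X.card := by omega
      exact_mod_cast this
    linarith [hM i, hM j]
  obtain ⟨σ, j₀, h⟩ := exists_perm_of_no_three hk
    (G := fun i j => η ≤ (M i ∩ M j ∩ L₂).card)
    (fun a b h => by rwa [inter_comm (M b)]) (fun a b c _ _ _ => by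
      by_contra! hcon
      obtain ⟨g1, g2, g3⟩ := hcon
      have h5 := card_add_card_add_card_le (inter_subset_right : M a ∩ L₂ ⊆ L₂)
        (inter_subset_right : M b ∩ L₂ ⊆ L₂) (inter_subset_right : M c ∩ L₂ ⊆ L₂)
      rw [← inter_inter_distrib_right, ← inter_inter_distrib_right, ← inter_inter_distrib_right]
        at h5
      have h6 : ((M a ∩ L₂).card : ℝ) + (M b ∩ L₂).card + (M c ∩ L₂).card
        ≤ L₂.card + (M a ∩ M b ∩ L₂).card + (M a ∩ M c ∩ L₂).card + (M b ∩ M c ∩ L₂).card := by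
        exact_mod_cast h5
      linarith [hML a, hML b, hML c])
  refine ⟨σ, j₀, fun j => ?_⟩
  by_cases hj : (j : ℕ) + 1 < k
  · have hsub : ∀ L : Finset V, (M (σ j) ∩ M (σ ⟨j + 1, hj⟩) ∩ L) ⊆ L.filter fun v =>
        ∀ hj : (j : ℕ) + 1 < k, v ∈ nbr E ((univ.erase (σ j)).image u) ∧
        v ∈ nbr E ((univ.erase (σ ⟨j + 1, hj⟩)).image u) := by
      intro L v hv
      simp only [mem_inter, M] at hv
      simp only [mem_filter]
      exact ⟨hv.2, fun _ => hv.1⟩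
    split_ifs with hjj
    · exact (hM3 _ _).trans (Nat.cast_le.2 (card_le_card (hsub _)))
    · exact (h j hj hjj).trans (Nat.cast_le.2 (card_le_card (hsub _)))
  · rw [filter_true_of_mem fun v _ h => absurd h hj]
    split_ifs
    · exact hc3
    · exact hc2

open Classical in
/-- The structures from which tiles are built: for one ordering `σ` of the core labels and one
exceptional pendant label `j₀` there are many labellings respecting the four levels. -/
theorem exists_many_labellings [Nonempty V] (last : Fin k) (hlast : (last : ℕ) + 1 = k)
    {X L₀ L₁ L₂ L₃ : Finset V} (h0 : L₀ ⊆ X) (h1 : L₁ ⊆ X) (h2 : L₂ ⊆ X) (h3 : L₃ ⊆ X)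
    {q η a : ℝ} (ha : 0 ≤ a) (hη : 0 ≤ η)
    (hq : ∀ S : Finset V, S.card = k - 1 → q ≤ (nbr E S ∩ X).card)
    (ha0 : a + k ≤ L₀.card) (ha1 : a + X.card ≤ q + L₁.card)
    (hη2 : 3 * X.card + 3 * η < 3 * q + 2 * L₂.card) (hη3 : 2 * X.card + η ≤ 2 * q + L₃.card)
    (hc2 : η ≤ L₂.card) (hc3 : η ≤ L₃.card) :
    ∃ (σ : Equiv.Perm (Fin k)) (j₀ : Fin k),
      a ^ k * η ^ k / (k.factorial * k : ℕ) ≤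
      (univ.filter fun f : Fin k ⊕ Fin k → V => IsLabelled E (fun l => f (Sum.map σ id l)) ∧
        ∀ l, f l ∈ X ∧ f l ∈ Sum.elim (fun i => if i = last then L₁ else L₀)
          (fun j => if j = j₀ then L₃ else L₂) l).card := by
  have hk : 0 < k := by omega
  set S := univ.filter fun u : Fin k → V => Function.Injective u ∧ univ.image u ∈ E ∧
      (∀ i, i ≠ last → u i ∈ L₀) ∧ u last ∈ L₁ with hS
  have hScard : a ^ k ≤ S.card := card_cores_ge last hlast h1 ha hq ha0 ha1
  have hord : ∀ u : Fin k → V, ∃ p : Equiv.Perm (Fin k) × Fin k, u ∈ S → ∀ j,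
      η ≤ ((if j = p.2 then L₃ else L₂).filter fun v => ∀ hj : (j : ℕ) + 1 < k,
        v ∈ nbr E ((univ.erase (p.1 j)).image u) ∧
        v ∈ nbr E ((univ.erase (p.1 ⟨j + 1, hj⟩)).image u)).card := by
    intro u
    by_cases hu : u ∈ S
    · have hinj : Function.Injective u := ((mem_filter.1 hu).2).1
      obtain ⟨σ, j₀, h⟩ := exists_order_core hk h2 h3 hq hη2 hη3 hc2 hc3 hinj
      exact ⟨(σ, j₀), fun _ => h⟩
    · exact ⟨(1, last), fun h => absurd h hu⟩
  choose p hp using hord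
  let C : (Fin k → V) → Fin k → Finset V := fun u j =>
    (if j = (p u).2 then L₃ else L₂).filter fun v => ∀ hj : (j : ℕ) + 1 < k,
        v ∈ nbr E ((univ.erase ((p u).1 j)).image u) ∧
        v ∈ nbr E ((univ.erase ((p u).1 ⟨j + 1, hj⟩)).image u)
  set T := univ.filter fun f : Fin k ⊕ Fin k → V =>
      f ∘ Sum.inl ∈ S ∧ ∀ j, f (Sum.inr j) ∈ C (f ∘ Sum.inl) j with hTdef
  have hT : a ^ k * η ^ k ≤ T.card := by
    have h := pow_le_card_sum_extend S C hη hScard fun u hu j => hp u hu j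
    rw [Fintype.card_fin] at h
    refine h.trans (Nat.cast_le.2 (card_le_card fun f hf => ?_))
    simp only [hTdef, mem_filter, mem_univ, true_and] at hf ⊢
    exact hf
  have : Nonempty (Equiv.Perm (Fin k) × Fin k) := ⟨(1, last)⟩
  obtain ⟨⟨σ, j₀⟩, hσ⟩ := exists_div_le_card_fiber (by
    rw [Fintype.card_prod, Fintype.card_perm, Fintype.card_fin]) T (fun f => p (f ∘ Sum.inl)) hT
  refine ⟨σ, j₀, hσ.trans (Nat.cast_le.2 (card_le_card fun f hf => ?_))⟩
  simp only [T, mem_filter, mem_univ, true_and] at hf ⊢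
  obtain ⟨⟨hfS, hfC⟩, hpf⟩ := hf
  simp only [hS, mem_filter, mem_univ, true_and, Function.comp] at hfS
  obtain ⟨-, hE, hL0, hL1⟩ := hfS
  have hfC' : ∀ j, f (Sum.inr j) ∈ (if j = j₀ then L₃ else L₂) ∧ ∀ hj : (j : ℕ) + 1 < k,
        f (Sum.inr j) ∈ nbr E ((univ.erase (σ j)).image fun i => f (Sum.inl i)) ∧
        f (Sum.inr j) ∈ nbr E ((univ.erase (σ ⟨j + 1, hj⟩)).image fun i => f (Sum.inl i)) := by
    intro j
    have := hfC j
    simp only [C, hpf, mem_filter] at this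
    exact this
  refine ⟨isLabelled_of_mem_nbr σ hE fun j hj => (hfC' j).2 hj, ?_⟩
  have hmem : ∀ l, f l ∈ Sum.elim (fun i => if i = last then L₁ else L₀)
      (fun j => if j = j₀ then L₃ else L₂) l := by
    rintro (i | j)
    · simp only [Sum.elim_inl]
      split_ifs with hi
      · rw [hi]; exact hL1
      · exact hL0 i hi
    · exact (hfC' j).1
  refine fun l => ⟨?_, hmem l⟩
  have := hmem l
  rcases l with i | j
  · simp only [Sum.elim_inl] at this
    split_ifs at this
    · exact h1 this
    · exact h0 this
  · simp only [Sum.elim_inr] at this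
    split_ifs at this
    · exact h3 this
    · exact h2 this

end Tiles

/-- A nonnegative weight is bounded below in terms of its quantiles. -/
theorem sum_ge_of_levels {V : Type*} [DecidableEq V] {X L₀ L₁ L₂ L₃ : Finset V} {w : V → ℝ}
    (hw : ∀ v, 0 ≤ w v) {θ₀ θ₁ θ₂ θ₃ : ℝ} (h01 : L₀ ⊆ L₁) (h12 : L₁ ⊆ L₂) (h23 : L₂ ⊆ L₃)
    (h3 : L₃ ⊆ X) (hθ₀ : ∀ v ∈ X, v ∉ L₀ → θ₀ ≤ w v) (hθ₁ : ∀ v ∈ X, v ∉ L₁ → θ₁ ≤ w v)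
    (hθ₂ : ∀ v ∈ X, v ∉ L₂ → θ₂ ≤ w v) (hθ₃ : ∀ v ∈ X, v ∉ L₃ → θ₃ ≤ w v) :
    (X.card - L₀.card : ℝ) * θ₀ + (X.card - L₁.card : ℝ) * (θ₁ - θ₀) +
      (X.card - L₂.card : ℝ) * (θ₂ - θ₁) + (X.card - L₃.card : ℝ) * (θ₃ - θ₂) ≤ ∑ v ∈ X, w v := by
  have key : ∀ (L : Finset V) (c : ℝ), L ⊆ X →
      (X.card - L.card : ℝ) * c = ∑ v ∈ X, if v ∈ L then 0 else c := by
    intro L c hL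
    have h : X.filter (fun v => v ∉ L) = X \ L := by ext; simp
    have h' := card_sdiff_add_card_eq_card hL
    rw [sum_ite, sum_const_zero, zero_add, sum_const, nsmul_eq_mul, h, ← h']
    push_cast
    ring
  rw [key L₀ _ (h01.trans (h12.trans (h23.trans h3))), key L₁ _ (h12.trans (h23.trans h3)),
    key L₂ _ (h23.trans h3), key L₃ _ h3, ← sum_add_distrib, ← sum_add_distrib, ← sum_add_distrib]
  refine sum_le_sum fun v hv => ?_
  have a1 := @h01 v
  have a2 := @h12 v
  have a3 := @h23 v
  by_cases m3 : v ∈ L₃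
  · by_cases m2 : v ∈ L₂
    · by_cases m1 : v ∈ L₁
      · by_cases m0 : v ∈ L₀
        · simp [m0, m1, m2, m3, hw v]
        · simp [m0, m1, m2, m3, hθ₀ v hv m0]
      · have m0 : v ∉ L₀ := fun h => m1 (a1 h)
        simp [m0, m1, m2, m3, hθ₁ v hv m1]
    · have m1 : v ∉ L₁ := fun h => m2 (a2 h)
      have m0 : v ∉ L₀ := fun h => m1 (a1 h)
      simp [m0, m1, m2, m3, hθ₂ v hv m2]
  · have m2 : v ∉ L₂ := fun h => m3 (a3 h)
    have m1 : v ∉ L₁ := fun h => m2 (a2 h)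
    have m0 : v ∉ L₀ := fun h => m1 (a1 h)
    simp [m0, m1, m2, m3, hθ₃ v hv m3]

open Classical in
/-- Many labellings of a given type yield a tile whose weight is controlled by the levels. -/
theorem exists_tile_of_many_labellings {k s : ℕ} (hk : 2 ≤ k) (hks : k < s) (hs : 5 * k ^ 2 ≤ s)
    (hnd : ¬ k ∣ s) {c : ℝ} (hc : 0 < c) :
    ∃ N₀ : ℕ, ∀ (V : Type) [Fintype V] [DecidableEq V] (E : Finset (Finset V)),
      N₀ ≤ Fintype.card V →
      ∀ (X L₀ L₁ L₂ L₃ : Finset V) (last j₀ : Fin k) (σ : Equiv.Perm (Fin k)),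
      c * (Fintype.card V : ℝ) ^ (2 * k) ≤ (univ.filter fun f : Fin k ⊕ Fin k → V =>
        IsLabelled E (fun l => f (Sum.map σ id l)) ∧
        ∀ l, f l ∈ X ∧ f l ∈ Sum.elim (fun i => if i = last then L₁ else L₀)
          (fun j => if j = j₀ then L₃ else L₂) l).card →
      ∃ A ⊆ X, SpansCs k s E A ∧ ∀ (w : V → ℝ) (θ₀ θ₁ θ₂ θ₃ : ℝ), θ₀ ≤ θ₁ → θ₁ ≤ θ₂ → θ₂ ≤ θ₃ →
        (∀ v ∈ L₀, w v ≤ θ₀) → (∀ v ∈ L₁, w v ≤ θ₁) → (∀ v ∈ L₂, w v ≤ θ₂) →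
        (∀ v ∈ L₃, w v ≤ θ₃) →
        ∑ v ∈ A, w v ≤ s * θ₀ + (s + 1) / 2 * (θ₁ - θ₀) + (s + 3) / 4 * (θ₂ - θ₁) + (θ₃ - θ₂) := by
  obtain ⟨g, hper, hwin, huniq, -⟩ := exists_label_walk k s hk hs
  have : Nonempty (Fin k ⊕ Fin k) := ⟨Sum.inl ⟨0, by omega⟩⟩
  obtain ⟨c', hc', N₀, hN₀⟩ := exists_blowup_count (Fin k ⊕ Fin k) s (by omega) c hc
  refine ⟨N₀ + 1, fun V _ _ E hN X L₀ L₁ L₂ L₃ last j₀ σ hcount => ?_⟩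
  have hP := hN₀ V (by omega) (fun f => IsLabelled E (fun l => f (Sum.map σ id l)) ∧
        ∀ l, f l ∈ X ∧ f l ∈ Sum.elim (fun i => if i = last then L₁ else L₀)
          (fun j => if j = j₀ then L₃ else L₂) l) (by
    have h2k : Fintype.card (Fin k ⊕ Fin k) = 2 * k := by
      rw [Fintype.card_sum, Fintype.card_fin, two_mul]
    rw [h2k]
    refine hcount.trans (Nat.cast_le.2 (card_le_card fun f hf => ?_))
    simp only [mem_filter, mem_univ, true_and] at hf ⊢
    exact hf)
  have hpos : (0 : ℝ) < Fintype.card V := by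
    have : 0 < Fintype.card V := by omega
    exact_mod_cast this
  have hne := Nat.cast_pos.1 (lt_of_lt_of_le (by positivity) hP)
  obtain ⟨F, hF⟩ := card_pos.1 hne
  simp only [mem_filter, mem_univ, true_and] at hF
  obtain ⟨hinj, hF⟩ := hF
  let m : Fin k ⊕ Fin k ≃ Fin k ⊕ Fin k := Equiv.sumCongr σ (Equiv.refl _)
  have hm : ∀ l, m l = Sum.map σ id l := fun l => by rcases l with i | j <;> rfl
  obtain ⟨A, hA, hAF, hw⟩ := exists_tile_of_walk (E := E) (by omega) hks.le hper hwin
    (fun l a => F (m l, a))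
    (fun l l' a a' h => by
      have := Prod.ext_iff.1 (hinj h)
      exact ⟨m.injective this.1, this.2⟩)
    (fun τ => by
      have := (hF fun l => τ (m.symm l)).1
      simpa only [← hm, Equiv.symm_apply_apply] using this)
  have hFX : ∀ l a, F (l, a) ∈ X ∧ F (l, a) ∈ Sum.elim (fun i => if i = last then L₁ else L₀)
      (fun j => if j = j₀ then L₃ else L₂) l := fun l a => (hF fun _ => a).2 l
  refine ⟨A, fun v hv => ?_, hA, fun w θ₀ θ₁ θ₂ θ₃ h01 h12 h23 b0 b1 b2 b3 => ?_⟩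
  · obtain ⟨l, a, rfl⟩ := hAF v hv
    exact (hFX _ _).1
  · refine (hw w (Sum.elim (fun i => if i = σ.symm last then θ₁ else θ₀)
      (fun j => if j = j₀ then θ₃ else θ₂)) fun l a => ?_).trans
      (sum_walk_le hk hs hnd hper hwin huniq _ _ h01 h12 h23)
    have h := (hFX (m l) a).2
    rw [hm] at h ⊢
    rcases l with i | j
    · simp only [Sum.map_inl, Sum.elim_inl, Equiv.eq_symm_apply] at h ⊢
      split_ifs at h ⊢
      · exact b1 _ h
      · exact b0 _ h
    · simp only [Sum.map_inr, Sum.elim_inr, id] at h ⊢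
      split_ifs at h ⊢
      · exact b3 _ h
      · exact b2 _ h

theorem level_sum_le {s r ε τ n θ D₁ D₂ D₃ : ℝ} (hsr : s * r = 1 / 2) (hε : 0 ≤ ε)
    (hτ : τ ≤ ε / 2) (hτ' : τ ≤ 1 / 8) (hs : 0 ≤ s) (hn : 0 ≤ n) (hθ : 0 ≤ θ) (h1 : 0 ≤ D₁)
    (h2 : 0 ≤ D₂) (h3 : 0 ≤ D₃) :
    n * (s * θ + (s + 1) / 2 * D₁ + (s + 3) / 4 * D₂ + D₃) ≤
      (1 + ε) * s * ((n - τ * n) * θ + (n - (1 / 2 - r) * n) * D₁ +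
        (n - (3 / 4 - 3 / 2 * r) * n) * D₂ + (n - (1 - 2 * r) * n) * D₃) := by
  have p0 : n * (s * θ) ≤ (1 + ε) * s * ((n - τ * n) * θ) := by
    have h : 1 ≤ (1 + ε) * (1 - τ) := by nlinarith
    have h2 : 0 ≤ s * n * θ := by positivity
    have := mul_le_mul_of_nonneg_left h h2
    linarith
  have p1 : (1 + ε) * (s * ((n - (1 / 2 - r) * n) * D₁)) = (1 + ε) * (n * ((s + 1) / 2 * D₁)) := by
    linear_combination (1 + ε) * n * D₁ * hsr
  have p2 : (1 + ε) * (s * ((n - (3 / 4 - 3 / 2 * r) * n) * D₂)) =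
      (1 + ε) * (n * ((s + 3) / 4 * D₂)) := by
    linear_combination (1 + ε) * (3 / 2) * n * D₂ * hsr
  have p3 : (1 + ε) * (s * ((n - (1 - 2 * r) * n) * D₃)) = (1 + ε) * (n * D₃) := by
    linear_combination (1 + ε) * 2 * n * D₃ * hsr
  have q1 : 0 ≤ ε * (n * ((s + 1) / 2 * D₁)) := by positivity
  have q2 : 0 ≤ ε * (n * ((s + 3) / 4 * D₂)) := by positivity
  have q3 : 0 ≤ ε * (n * D₃) := by positivity
  linarith

open Classical in
/-- Weighted tile lemma: if all codegrees into `X` are large then `X` contains a tile whose weight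
is almost at most the average. -/
theorem exists_light_tile {k s : ℕ} (hk : 2 ≤ k) (hks : k < s) (hs : 5 * k ^ 2 ≤ s)
    (hnd : ¬ k ∣ s) {δ γ ε : ℝ} (hδ : 0 < δ) (hγ : 0 < γ) (hγ1 : γ ≤ 1 / 2) (hε : 0 < ε) :
    ∃ N₀ : ℕ, ∀ (V : Type) [Fintype V] [DecidableEq V] (E : Finset (Finset V)),
      N₀ ≤ Fintype.card V → ∀ X : Finset V, δ * Fintype.card V ≤ X.card →
      (∀ S : Finset V, S.card = k - 1 →
        (1 / 2 + 1 / (2 * s) + γ) * (X.card : ℝ) ≤ (nbr E S ∩ X).card) →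
      ∀ w : V → ℝ, (∀ v, 0 ≤ w v) →
      ∃ A ⊆ X, SpansCs k s E A ∧ X.card * ∑ v ∈ A, w v ≤ (1 + ε) * s * ∑ v ∈ X, w v := by
  have hs20 : (20 : ℝ) ≤ s := by
    have : 20 ≤ s := by nlinarith
    exact_mod_cast this
  have hs0 : (0 : ℝ) < s := by linarith
  set r : ℝ := 1 / (2 * s) with hr
  have hsr : s * r = 1 / 2 := by rw [hr]; field_simp
  have hr0 : 0 < r := by positivity
  have hr1 : r ≤ 1 / 40 := by nlinarith
  obtain ⟨τ₀, hτ0, hτ1, hτ2⟩ : ∃ τ₀ : ℝ, 0 < τ₀ ∧ τ₀ ≤ ε / 2 ∧ τ₀ ≤ 1 / 8 :=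
    ⟨min (ε / 2) (1 / 8), by positivity, min_le_left _ _, min_le_right _ _⟩
  obtain ⟨c₁, hc0, hc1, hc2⟩ : ∃ c₁ : ℝ, 0 < c₁ ∧ 2 * c₁ ≤ τ₀ ∧ 2 * c₁ ≤ γ :=
    ⟨min τ₀ γ / 2, by positivity, by linarith [min_le_left τ₀ γ], by linarith [min_le_right τ₀ γ]⟩
  set Q : ℝ := ((k.factorial * k : ℕ) : ℝ) with hQ
  have hQ0 : 0 < Q := by
    rw [hQ]
    exact_mod_cast Nat.mul_pos k.factorial_pos (by omega)
  obtain ⟨N₁, hN₁⟩ := exists_tile_of_many_labellings hk hks hs hnd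
    (c := (c₁ * δ) ^ k * (γ / 2 * δ) ^ k / Q) (by positivity)
  obtain ⟨N₂, hN₂⟩ := exists_nat_ge ((k + 1) / (c₁ * δ))
  refine ⟨N₁ + N₂ + 1, fun V _ _ E hN X hX hq w hw => ?_⟩
  have hV : Nonempty V := Fintype.card_pos_iff.1 (by omega)
  have hN2 : (N₂ : ℝ) ≤ (Fintype.card V : ℕ) := by
    have : N₂ ≤ Fintype.card V := by omega
    exact_mod_cast this
  have hN0 : (0 : ℝ) < (Fintype.card V : ℕ) := by exact_mod_cast Fintype.card_pos
  set N : ℝ := ((Fintype.card V : ℕ) : ℝ) with hNdef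
  set n : ℝ := (X.card : ℝ) with hn
  have hk2 : (2 : ℝ) ≤ k := by exact_mod_cast hk
  have hc₁N : (k + 1 : ℝ) ≤ c₁ * (δ * N) := by
    have h1 := hN₂.trans hN2
    rw [div_le_iff₀ (by positivity)] at h1
    linarith
  have hc₁n : c₁ * (δ * N) ≤ c₁ * n := mul_le_mul_of_nonneg_left hX hc0.le
  have hn0 : 0 < n := lt_of_lt_of_le (by positivity) hX
  have hγn : 2 * (c₁ * n) ≤ γ * n := by nlinarith
  have hτn : 2 * (c₁ * n) ≤ τ₀ * n := by nlinarith
  have hγn' : γ * (δ * N) ≤ γ * n := mul_le_mul_of_nonneg_left hX hγ.le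
  have hγn1 : γ * n ≤ 1 / 2 * n := mul_le_mul_of_nonneg_right hγ1 hn0.le
  have hrn : r * n ≤ 1 / 40 * n := mul_le_mul_of_nonneg_right hr1 hn0.le
  have hrn0 : 0 < r * n := by positivity
  have hτn8 : τ₀ * n ≤ 1 / 8 * n := mul_le_mul_of_nonneg_right hτ2 hn0.le
  obtain ⟨L, θ, hL, hθ, hLX, hLcard, hθw, hle, hge⟩ :=
    exists_levels X (card_pos.1 (Nat.cast_pos.1 hn0)) w
  have hfl : ∀ x : ℝ, 0 ≤ x → x ≤ n → ((L ⌊x⌋₊).card : ℝ) ≤ x ∧ x - 1 < (L ⌊x⌋₊).card := by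
    intro x hx0 hx
    have h1 : ⌊x⌋₊ ≤ X.card := Nat.floor_le_of_le hx
    rw [hLcard _ h1]
    exact ⟨Nat.floor_le hx0, Nat.sub_one_lt_floor x⟩
  set x₀ := τ₀ * n with hx₀
  set x₁ := (1 / 2 - r) * n with hx₁
  set x₂ := (3 / 4 - 3 / 2 * r) * n with hx₂
  set x₃ := (1 - 2 * r) * n with hx₃
  have g0 : 0 ≤ x₀ := by positivity
  have g01 : x₀ ≤ x₁ := by linarith
  have g12 : x₁ ≤ x₂ := by linarith
  have g23 : x₂ ≤ x₃ := by linarith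
  have g3 : x₃ ≤ n := by linarith
  have f0 := hfl x₀ (by linarith) (by linarith)
  have f1 := hfl x₁ (by linarith) (by linarith)
  have f2 := hfl x₂ (by linarith) (by linarith)
  have f3 := hfl x₃ (by linarith) (by linarith)
  have e01 := Nat.floor_mono g01
  have e12 := Nat.floor_mono g12
  have e23 := Nat.floor_mono g23
  obtain ⟨σ, j₀, hmany⟩ := exists_many_labellings (E := E) (k := k) ⟨k - 1, by omega⟩
    (show k - 1 + 1 = k by omega) (hLX ⌊x₀⌋₊) (hLX ⌊x₁⌋₊) (hLX ⌊x₂⌋₊) (hLX ⌊x₃⌋₊)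
    (q := (1 / 2 + r + γ) * n) (η := γ / 2 * δ * N) (a := c₁ * δ * N)
    (by positivity) (by positivity) hq (by linarith) (by linarith) (by linarith) (by linarith)
    (by linarith) (by linarith)
  obtain ⟨A, hAX, hA, hAw⟩ := hN₁ V E (by omega) X _ _ _ _ _ j₀ σ (by
    refine le_trans (le_of_eq ?_) hmany
    rw [mul_pow (c₁ * δ), mul_pow (γ / 2 * δ), two_mul k, pow_add]
    ring)
  refine ⟨A, hAX, hA, ?_⟩
  have hA1 := hAw w _ _ _ _ (hθ e01) (hθ e12) (hθ e23) (hle _) (hle _) (hle _) (hle _)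
  have hX1 := sum_ge_of_levels hw (hL e01) (hL e12) (hL e23) (hLX _) (hge _) (hge _) (hge _)
    (hge _)
  have hθ0 : 0 ≤ θ ⌊x₀⌋₊ := by
    obtain ⟨v, hv⟩ := hθw ⌊x₀⌋₊
    rw [hv]
    exact hw v
  set θ₀ := θ ⌊x₀⌋₊
  have d1 : 0 ≤ θ ⌊x₁⌋₊ - θ₀ := sub_nonneg.2 (hθ e01)
  have d2 : 0 ≤ θ ⌊x₂⌋₊ - θ ⌊x₁⌋₊ := sub_nonneg.2 (hθ e12)
  have d3 : 0 ≤ θ ⌊x₃⌋₊ - θ ⌊x₂⌋₊ := sub_nonneg.2 (hθ e23)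
  set D₁ := θ ⌊x₁⌋₊ - θ₀
  set D₂ := θ ⌊x₂⌋₊ - θ ⌊x₁⌋₊
  set D₃ := θ ⌊x₃⌋₊ - θ ⌊x₂⌋₊
  rw [← hn] at hX1
  have m0 : (n - x₀) * θ₀ ≤ (n - (L ⌊x₀⌋₊).card) * θ₀ :=
    mul_le_mul_of_nonneg_right (by linarith) hθ0
  have m1 : (n - x₁) * D₁ ≤ (n - (L ⌊x₁⌋₊).card) * D₁ :=
    mul_le_mul_of_nonneg_right (by linarith) d1
  have m2 : (n - x₂) * D₂ ≤ (n - (L ⌊x₂⌋₊).card) * D₂ :=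
    mul_le_mul_of_nonneg_right (by linarith) d2
  have m3 : (n - x₃) * D₃ ≤ (n - (L ⌊x₃⌋₊).card) * D₃ :=
    mul_le_mul_of_nonneg_right (by linarith) d3
  have hsum : (n - x₀) * θ₀ + (n - x₁) * D₁ + (n - x₂) * D₂ + (n - x₃) * D₃ ≤ ∑ v ∈ X, w v := by
    linarith
  have hfin := level_sum_le hsr hε.le hτ1 hτ2 hs0.le hn0.le hθ0 d1 d2 d3
  calc n * ∑ v ∈ A, w v ≤ _ := mul_le_mul_of_nonneg_left hA1 hn0.le
    _ ≤ _ := hfin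
    _ ≤ _ := mul_le_mul_of_nonneg_left hsum (by positivity)

/-- The sum over `i` of the exponentials of `-θ` times the density of `M i` in `X`. -/
noncomputable def densityPotential {V ι : Type*} [DecidableEq V] (θ : ℝ) (I : Finset ι)
    (M : ι → Finset V) (X : Finset V) : ℝ :=
  ∑ i ∈ I, Real.exp (-(θ * (((M i ∩ X).card : ℝ) / X.card)))

theorem densityPotential_nonneg {V ι : Type*} [DecidableEq V] (θ : ℝ) (I : Finset ι)
    (M : ι → Finset V) (X : Finset V) : 0 ≤ densityPotential θ I M X :=
  sum_nonneg fun _ _ => (Real.exp_pos _).le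

theorem exp_le_one_add_add_sq {u : ℝ} (hu : |u| ≤ 1) : Real.exp u ≤ 1 + u + u ^ 2 := by
  have := (abs_le.1 (Real.abs_exp_sub_one_sub_id_le hu)).2
  linarith

/-- Removing a set of at most average weight hardly increases the potential. -/
theorem densityPotential_sdiff_le {V ι : Type*} [DecidableEq V] {I : Finset ι}
    {M : ι → Finset V} {X A : Finset V} (hA : A ⊆ X) (hlt : A.card < X.card) {θ ε y : ℝ}
    (hθ : 0 ≤ θ) (hε : 0 ≤ ε) (hy : θ * A.card ≤ y * ((X.card : ℝ) - A.card)) (hy1 : y ≤ 1)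
    (hw : (X.card : ℝ) * ∑ v ∈ A, ∑ i ∈ I, (if v ∈ M i then
        Real.exp (-(θ * (((M i ∩ X).card : ℝ) / X.card))) else 0) ≤
      (1 + ε) * A.card * ∑ v ∈ X, ∑ i ∈ I, (if v ∈ M i then
        Real.exp (-(θ * (((M i ∩ X).card : ℝ) / X.card))) else 0)) :
    densityPotential θ I M (X \ A) ≤ (1 + (y ^ 2 + ε * y)) * densityPotential θ I M X := by
  set n : ℝ := (X.card : ℝ) with hn
  set a : ℝ := (A.card : ℝ) with ha
  have ha0 : 0 ≤ a := Nat.cast_nonneg _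
  have han : a < n := Nat.cast_lt.2 hlt
  have hn0 : 0 < n := by linarith
  have hna : 0 < n - a := by linarith
  set e : ι → ℝ := fun i => Real.exp (-(θ * (((M i ∩ X).card : ℝ) / n))) with he
  have he0 : ∀ i, 0 < e i := fun i => Real.exp_pos _
  have hsum : ∀ Y : Finset V, ∑ v ∈ Y, ∑ i ∈ I, (if v ∈ M i then e i else 0) =
      ∑ i ∈ I, e i * ((M i ∩ Y).card : ℝ) := by
    intro Y
    rw [sum_comm]
    refine sum_congr rfl fun i _ => ?_
    rw [← sum_filter, sum_const, nsmul_eq_mul, mul_comm, filter_mem_eq_inter, inter_comm]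
  rw [hsum, hsum] at hw
  have hcardX : ((X \ A).card : ℝ) = n - a := by
    rw [card_sdiff_of_subset hA, Nat.cast_sub hlt.le]
  set c : ι → ℝ := fun i => ((M i ∩ A).card : ℝ) with hc
  set d : ι → ℝ := fun i => ((M i ∩ X).card : ℝ) with hd
  have hc0 : ∀ i, 0 ≤ c i := fun i => Nat.cast_nonneg _
  have hd0 : ∀ i, 0 ≤ d i := fun i => Nat.cast_nonneg _
  have hca : ∀ i, c i ≤ a := fun i => Nat.cast_le.2 (card_le_card inter_subset_right)
  have hdn : ∀ i, d i ≤ n := fun i => Nat.cast_le.2 (card_le_card inter_subset_right)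
  have hcd : ∀ i, ((M i ∩ (X \ A)).card : ℝ) = d i - c i := by
    intro i
    have h1 : M i ∩ (X \ A) = (M i ∩ X) \ (M i ∩ A) := by
      ext v
      simp only [mem_inter, mem_sdiff]
      tauto
    have h2 : M i ∩ A ⊆ M i ∩ X := inter_subset_inter_left hA
    rw [h1, card_sdiff_of_subset h2, Nat.cast_sub (card_le_card h2)]
  have hy' : θ * a / (n - a) ≤ y := (div_le_iff₀ hna).2 hy
  have hy0 : 0 ≤ y := le_trans (by positivity) hy'
  have hterm : ∀ i, Real.exp (-(θ * (((M i ∩ (X \ A)).card : ℝ) / (X \ A).card))) ≤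
      e i * (1 + y ^ 2) + θ / (n - a) * (e i * c i - a / n * (e i * d i)) := by
    intro i
    rw [hcd, hcardX]
    set u := θ * (c i - a * (d i / n)) / (n - a) with hu
    have h1 : -(θ * ((d i - c i) / (n - a))) = -(θ * (d i / n)) + u := by
      rw [hu]
      field_simp
      ring
    have h2 : |u| ≤ θ * a / (n - a) := by
      have h3 : d i / n ≤ 1 := (div_le_one hn0).2 (hdn i)
      have h4 : 0 ≤ d i / n := div_nonneg (hd0 i) hn0.le
      have h5 : a * (d i / n) ≤ a := mul_le_of_le_one_right ha0 h3
      have h6 : 0 ≤ a * (d i / n) := mul_nonneg ha0 h4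
      have h7 : |c i - a * (d i / n)| ≤ a := abs_le.2 ⟨by linarith [hc0 i], by linarith [hca i]⟩
      rw [hu, abs_div, abs_mul, abs_of_nonneg hθ, abs_of_pos hna]
      gcongr
    have h3 := h2.trans hy'
    have h4 := exp_le_one_add_add_sq (h3.trans hy1)
    have h5 : u ^ 2 ≤ y ^ 2 := sq_le_sq' (by linarith [neg_abs_le u]) (by linarith [le_abs_self u])
    rw [h1, Real.exp_add]
    change e i * Real.exp u ≤ _
    have h6 : e i * Real.exp u ≤ e i * (1 + u + y ^ 2) :=
      mul_le_mul_of_nonneg_left (by linarith) (he0 i).le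
    refine h6.trans (le_of_eq ?_)
    rw [hu]
    field_simp
    ring
  have hΦ : densityPotential θ I M X = ∑ i ∈ I, e i := rfl
  have hed : ∑ i ∈ I, e i * d i ≤ n * ∑ i ∈ I, e i := by
    rw [mul_sum]
    refine sum_le_sum fun i _ => ?_
    rw [mul_comm]
    exact mul_le_mul_of_nonneg_right (hdn i) (he0 i).le
  have hsum2 : densityPotential θ I M (X \ A) ≤ (∑ i ∈ I, e i) * (1 + y ^ 2) +
      θ / (n - a) * (∑ i ∈ I, e i * c i - a / n * ∑ i ∈ I, e i * d i) := by
    refine (sum_le_sum fun i _ => hterm i).trans (le_of_eq ?_)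
    rw [sum_add_distrib, ← mul_sum, sum_sub_distrib, ← mul_sum, ← sum_mul]
  have h1 : ∑ i ∈ I, e i * c i - a / n * ∑ i ∈ I, e i * d i ≤ a * (ε * ∑ i ∈ I, e i) := by
    have h2 : n * (∑ i ∈ I, e i * c i - a / n * ∑ i ∈ I, e i * d i) ≤
        n * (a * (ε * ∑ i ∈ I, e i)) := by
      have h3 : n * (∑ i ∈ I, e i * c i - a / n * ∑ i ∈ I, e i * d i) =
          n * ∑ i ∈ I, e i * c i - a * ∑ i ∈ I, e i * d i := by
        field_simp
      have h4 : ε * a * ∑ i ∈ I, e i * d i ≤ ε * a * (n * ∑ i ∈ I, e i) :=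
        mul_le_mul_of_nonneg_left hed (by positivity)
      rw [h3]
      linarith
    exact le_of_mul_le_mul_left h2 hn0
  have hE : 0 ≤ ∑ i ∈ I, e i := sum_nonneg fun i _ => (he0 i).le
  have h2 : θ / (n - a) * (∑ i ∈ I, e i * c i - a / n * ∑ i ∈ I, e i * d i) ≤
      y * (ε * ∑ i ∈ I, e i) := by
    calc _ ≤ θ / (n - a) * (a * (ε * ∑ i ∈ I, e i)) :=
          mul_le_mul_of_nonneg_left h1 (by positivity)
      _ = θ * a / (n - a) * (ε * ∑ i ∈ I, e i) := by ring
      _ ≤ _ := mul_le_mul_of_nonneg_right hy' (by positivity)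
  rw [hΦ]
  linarith

theorem SpansCs.card_eq {V : Type} [DecidableEq V] {k s : ℕ} {E : Finset (Finset V)}
    {A : Finset V} (h : SpansCs k s E A) : A.card = s := by
  obtain ⟨C, hC, hcyc, rfl⟩ := h
  rw [List.toFinset_card_of_nodup hcyc.1, hC]

theorem IsCsTiling.empty {V : Type} [DecidableEq V] {k s : ℕ} {E : Finset (Finset V)} :
    IsCsTiling k s E ∅ := ⟨by simp, by simp⟩

theorem IsCsTiling.insert {V : Type} [DecidableEq V] {k s : ℕ} {E : Finset (Finset V)}
    {T : Finset (Finset V)} {A : Finset V} (hT : IsCsTiling k s E T) (hA : SpansCs k s E A)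
    (hd : Disjoint A (T.biUnion id)) : IsCsTiling k s E (insert A T) := by
  refine ⟨?_, fun B hB => ?_⟩
  · rw [coe_insert]
    exact hT.1.insert fun B hB _ => hd.mono_right (subset_biUnion_of_mem id hB)
  · rcases mem_insert.1 hB with rfl | hB
    · exact hA
    · exact hT.2 B hB

theorem exists_pow_lt_exp (k : ℕ) {c : ℝ} (hc : 0 < c) :
    ∃ N₀ : ℕ, ∀ N : ℕ, N₀ ≤ N → (N : ℝ) ^ k < Real.exp (c * N) := by
  have h := (Real.tendsto_pow_mul_exp_neg_atTop_nhds_zero k).comp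
    ((tendsto_natCast_atTop_atTop (R := ℝ)).const_mul_atTop hc)
  have h2 := h.eventually (gt_mem_nhds (show (0 : ℝ) < c ^ k by positivity))
  obtain ⟨N₀, hN₀⟩ := Filter.eventually_atTop.1 h2
  refine ⟨N₀, fun N hN => ?_⟩
  have h3 : (c * N) ^ k * Real.exp (-(c * N)) < c ^ k := hN₀ N hN
  rw [mul_pow, mul_assoc, Real.exp_neg] at h3
  have h4 := lt_of_mul_lt_mul_left (h3.trans_eq (mul_one _).symm) (by positivity)
  rwa [← div_eq_mul_inv, div_lt_one (Real.exp_pos _)] at h4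

/-- Repeatedly removing light tiles covers all but few vertices. -/
theorem exists_tiling_of_light_tiles {V : Type} [Fintype V] [DecidableEq V] {k s : ℕ}
    (hs : 0 < s) {E : Finset (Finset V)} {I : Finset (Finset V)} {θ ε y ρ m : ℝ} (hθ : 0 < θ)
    (hε : 0 ≤ ε) (hy1 : y ≤ 1) (hy : ∀ n : ℝ, m < n → θ * s ≤ y * (n - s)) (hsm : s ≤ m)
    (hlight : ∀ X : Finset V, m < X.card →
      (∀ S ∈ I, ρ * X.card ≤ (nbr E S ∩ X).card) → ∀ w : V → ℝ, (∀ v, 0 ≤ w v) →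
      ∃ A ⊆ X, SpansCs k s E A ∧ X.card * ∑ v ∈ A, w v ≤ (1 + ε) * s * ∑ v ∈ X, w v)
    (X : Finset V) (hX : (1 + (y ^ 2 + ε * y)) ^ X.card * densityPotential θ I (nbr E) X <
      Real.exp (-(θ * ρ))) :
    ∃ T, IsCsTiling k s E T ∧ T.biUnion id ⊆ X ∧ ((X \ T.biUnion id).card : ℝ) ≤ m := by
  induction hn : X.card using Nat.strong_induction_on generalizing X with
  | _ n ih =>
  subst hn
  by_cases hXm : (X.card : ℝ) ≤ m
  · exact ⟨∅, IsCsTiling.empty, by simp, by simpa using hXm⟩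
  rw [not_le] at hXm
  have hs0 : (0 : ℝ) < s := Nat.cast_pos.2 hs
  have hsX : (s : ℝ) < X.card := by linarith
  have hy0 : 0 ≤ y := by
    have h1 := hy _ hXm
    have h2 : 0 < θ * s := by positivity
    by_contra! h
    nlinarith
  have hx : 1 ≤ 1 + (y ^ 2 + ε * y) := by
    have : 0 ≤ y ^ 2 + ε * y := by positivity
    linarith
  have hΦ0 := densityPotential_nonneg θ I (nbr E) X
  have hΦ : densityPotential θ I (nbr E) X < Real.exp (-(θ * ρ)) :=
    (le_mul_of_one_le_left hΦ0 (one_le_pow₀ hx)).trans_lt hX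
  have hX0 : (0 : ℝ) < X.card := by linarith
  have hdens : ∀ S ∈ I, ρ * X.card ≤ (nbr E S ∩ X).card := by
    intro S hS
    have h1 : Real.exp (-(θ * (((nbr E S ∩ X).card : ℝ) / X.card))) ≤
        densityPotential θ I (nbr E) X :=
      single_le_sum (f := fun S => Real.exp (-(θ * (((nbr E S ∩ X).card : ℝ) / X.card))))
        (fun _ _ => (Real.exp_pos _).le) hS
    have h2 := Real.exp_lt_exp.1 (h1.trans_lt hΦ)
    have h3 : ρ < ((nbr E S ∩ X).card : ℝ) / X.card := by
      by_contra! h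
      have := mul_le_mul_of_nonneg_left h hθ.le
      linarith
    rw [lt_div_iff₀ hX0] at h3
    exact h3.le
  obtain ⟨A, hAX, hA, hw⟩ := hlight X hXm hdens
    (fun v => ∑ S ∈ I, if v ∈ nbr E S then
      Real.exp (-(θ * (((nbr E S ∩ X).card : ℝ) / X.card))) else 0)
    (fun v => sum_nonneg fun S _ => by split_ifs <;> positivity)
  have hAs := hA.card_eq
  have hstep := densityPotential_sdiff_le hAX (by rw [hAs]; exact_mod_cast hsX) hθ.le hε
    (by rw [hAs]; exact hy _ hXm) hy1 (by rw [hAs]; exact hw)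
  have hcard : (X \ A).card + s = X.card := by
    have := card_sdiff_add_card_eq_card hAX
    omega
  obtain ⟨T, hT, hTX, hTm⟩ := ih (X \ A).card (by omega) (X \ A) (by
    refine lt_of_le_of_lt ?_ hX
    calc _ ≤ (1 + (y ^ 2 + ε * y)) ^ (X \ A).card *
          ((1 + (y ^ 2 + ε * y)) * densityPotential θ I (nbr E) X) :=
          mul_le_mul_of_nonneg_left hstep (by positivity)
      _ = (1 + (y ^ 2 + ε * y)) ^ ((X \ A).card + 1) * densityPotential θ I (nbr E) X := by ring
      _ ≤ _ := mul_le_mul_of_nonneg_right (pow_le_pow_right₀ hx (by omega)) hΦ0) rfl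
  refine ⟨insert A T, hT.insert hA ?_, ?_, ?_⟩
  · exact (disjoint_sdiff (s := A) (t := X)).mono_right hTX
  · rw [biUnion_insert]
    exact union_subset hAX (hTX.trans sdiff_subset)
  · rwa [biUnion_insert, id, ← sup_eq_union, ← sdiff_sdiff_left]

/-- Almost perfect tilings. -/
theorem exists_almost_perfect_tiling {k s : ℕ} (hk : 2 ≤ k) (hks : k < s) (hs : 5 * k ^ 2 ≤ s)
    (hnd : ¬ k ∣ s) {δ γ : ℝ} (hδ : 0 < δ) (hδ1 : δ ≤ 1) (hγ : 0 < γ) (hγ1 : γ ≤ 1 / 2) :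
    ∃ N₀ : ℕ, ∀ (V : Type) [Fintype V] [DecidableEq V] (E : Finset (Finset V)),
      N₀ ≤ Fintype.card V → ∀ X : Finset V,
      (∀ S : Finset V, S.card = k - 1 →
        (1 / 2 + 1 / (2 * s) + γ) * (X.card : ℝ) ≤ (nbr E S ∩ X).card) →
      ∃ T, IsCsTiling k s E T ∧ T.biUnion id ⊆ X ∧
        ((X \ T.biUnion id).card : ℝ) ≤ δ * Fintype.card V := by
  have hs1 : (1 : ℝ) ≤ s := by
    have : 1 ≤ s := by omega
    exact_mod_cast this
  obtain ⟨y, hy⟩ : ∃ y : ℝ, y = γ * δ / (16 * s) := ⟨_, rfl⟩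
  have hy0 : 0 < y := by rw [hy]; positivity
  have hy1 : y ≤ 1 := by
    rw [hy, div_le_one (by positivity)]
    nlinarith
  obtain ⟨κ, hκ⟩ : ∃ κ : ℝ, κ = y * δ / (2 * s) := ⟨_, rfl⟩
  have hκ0 : 0 < κ := by rw [hκ]; positivity
  have hκs : 2 * (κ * s) = y * δ := by rw [hκ]; field_simp
  have hyκ : y ^ 2 + y * y = κ * γ / 4 := by rw [hκ, hy]; field_simp; ring
  obtain ⟨N₁, hN₁⟩ := exists_light_tile hk hks hs hnd hδ (half_pos hγ) (by linarith) hy0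
  obtain ⟨N₂, hN₂⟩ := exists_pow_lt_exp (k - 1) (c := κ * γ / 4) (by positivity)
  obtain ⟨N₃, hN₃⟩ := exists_nat_ge (2 * s / δ)
  refine ⟨N₁ + N₂ + N₃ + 1, fun V _ _ E hN X hX => ?_⟩
  have h2 := hN₂ (Fintype.card V) (by omega)
  have h3 : (N₃ : ℝ) ≤ (Fintype.card V : ℕ) := by
    have : N₃ ≤ Fintype.card V := by omega
    exact_mod_cast this
  have hNpos : (0 : ℝ) < (Fintype.card V : ℕ) := by
    have : 0 < Fintype.card V := by omega
    exact_mod_cast this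
  have hXN : (X.card : ℝ) ≤ (Fintype.card V : ℕ) := Nat.cast_le.2 (card_le_univ X)
  have hI : ((univ.powersetCard (k - 1) : Finset (Finset V)).card : ℝ) ≤
      ((Fintype.card V : ℕ) : ℝ) ^ (k - 1) := by
    rw [card_powersetCard, card_univ]
    exact_mod_cast Nat.choose_le_pow _ _
  have h1 := hN₁ V E (by omega)
  set N : ℝ := ((Fintype.card V : ℕ) : ℝ) with hNdef
  have hsN : 2 * s ≤ δ * N := by
    have h4 := hN₃.trans h3
    rw [div_le_iff₀ hδ] at h4
    linarith
  by_cases hXδ : (X.card : ℝ) ≤ δ * N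
  · exact ⟨∅, IsCsTiling.empty, by simp, by simpa using hXδ⟩
  rw [not_le] at hXδ
  have hX0 : (0 : ℝ) < X.card := by nlinarith
  set p : ℝ := 1 / 2 + 1 / (2 * s) with hp
  refine exists_tiling_of_light_tiles (θ := κ * N) (ε := y) (y := y) (ρ := p + γ / 2)
    (I := univ.powersetCard (k - 1)) (by omega) (by positivity) hy0.le hy1 ?_ (by linarith) ?_ X ?_
  · intro n hn
    have : y * (δ * N) ≤ y * (2 * (n - s)) := mul_le_mul_of_nonneg_left (by linarith) hy0.le
    have h5 : 2 * (κ * N * s) = y * (δ * N) := by linear_combination N * hκs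
    linarith
  · intro Y hY hYS w hw
    exact h1 Y hY.le (fun S hS => hYS S (mem_powersetCard.2 ⟨subset_univ _, hS⟩)) w hw
  · have hΦ : densityPotential (κ * N) (univ.powersetCard (k - 1)) (nbr E) X ≤
        N ^ (k - 1) * Real.exp (-(κ * N * (p + γ))) := by
      refine (sum_le_card_nsmul _ _ (Real.exp (-(κ * N * (p + γ)))) fun S hS => ?_).trans ?_
      · have h4 := hX S (mem_powersetCard.1 hS).2
        have h5 : p + γ ≤ ((nbr E S ∩ X).card : ℝ) / X.card := (le_div_iff₀ hX0).2 h4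
        rw [Real.exp_le_exp, neg_le_neg_iff]
        exact mul_le_mul_of_nonneg_left h5 (by positivity)
      · rw [nsmul_eq_mul]
        exact mul_le_mul_of_nonneg_right hI (Real.exp_pos _).le
    have hpow : (1 + (y ^ 2 + y * y)) ^ X.card ≤ Real.exp (κ * γ / 4 * N) := by
      have h4 : 1 + (y ^ 2 + y * y) ≤ Real.exp (κ * γ / 4) := by
        rw [hyκ, add_comm]
        exact Real.add_one_le_exp _
      refine (pow_le_pow_left₀ (by positivity) h4 _).trans ?_
      rw [← Real.exp_nat_mul, Real.exp_le_exp, mul_comm]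
      exact mul_le_mul_of_nonneg_left hXN (by positivity)
    calc _ ≤ Real.exp (κ * γ / 4 * N) * (N ^ (k - 1) * Real.exp (-(κ * N * (p + γ)))) :=
          mul_le_mul hpow hΦ (densityPotential_nonneg _ _ _ _) (Real.exp_pos _).le
      _ < Real.exp (κ * γ / 4 * N) * (Real.exp (κ * γ / 4 * N) *
            Real.exp (-(κ * N * (p + γ)))) := by
          refine mul_lt_mul_of_pos_left ?_ (Real.exp_pos _)
          exact mul_lt_mul_of_pos_right h2 (Real.exp_pos _)
      _ = _ := by
          rw [← Real.exp_add, ← Real.exp_add]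
          congr 1
          ring

open Classical in
/-- There are many labellings in which `x` and `y` can both replace a fixed core vertex. -/
theorem card_linking_labellings_ge {V : Type} [Fintype V] [DecidableEq V] [Nonempty V] {k : ℕ}
    {E : Finset (Finset V)} (hk : 2 ≤ k) (last : Fin k) (hlast : (last : ℕ) + 1 = k) {γ : ℝ}
    (hγ : 0 < γ) (hγ1 : γ ≤ 1 / 2)
    (hq : ∀ S : Finset V, S.card = k - 1 → (1 / 2 + γ) * Fintype.card V ≤ (nbr E S).card)
    (hN : (2 * (k + 2) : ℝ) ≤ Fintype.card V) (x y : V) :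
    γ ^ (2 * k) * (Fintype.card V : ℝ) ^ (2 * k) ≤
      (univ.filter fun f : Fin k ⊕ Fin k → V => IsLabelled E f ∧
        insert x ((univ.erase last).image fun i => f (Sum.inl i)) ∈ E ∧
        insert y ((univ.erase last).image fun i => f (Sum.inl i)) ∈ E).card := by
  have hle : ∀ i : Fin k, i ≤ last := fun i => Fin.le_def.2 (by have := i.2; omega)
  have hN0 : (0 : ℝ) < (Fintype.card V : ℕ) := by exact_mod_cast Fintype.card_pos
  set N : ℝ := ((Fintype.card V : ℕ) : ℝ) with hNdef
  have ha : 0 ≤ γ * N := by positivity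
  have hγN : γ * N ≤ 1 / 2 * N := mul_le_mul_of_nonneg_right hγ1 hN0.le
  have hk0 : (0 : ℝ) ≤ k := Nat.cast_nonneg k
  have hinter : ∀ S S' : Finset V, S.card = k - 1 → S'.card = k - 1 →
      γ * N ≤ (nbr E S ∩ nbr E S').card := by
    intro S S' hS hS'
    have h1 := card_add_card_le_card_inter_add (subset_univ (nbr E S)) (subset_univ (nbr E S'))
    rw [card_univ] at h1
    have h2 : ((nbr E S).card : ℝ) + (nbr E S').card ≤ (nbr E S ∩ nbr E S').card + N := by
      rw [hNdef]
      exact_mod_cast h1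
    linarith [hq S hS, hq S' hS']
  let C : Fin k → (Fin k → V) → Finset V := fun i u =>
    if (i : ℕ) + 1 = k then nbr E ((Iio i).image u)
    else if (i : ℕ) + 2 = k then
      (nbr E (insert x ((Iio i).image u)) ∩ nbr E (insert y ((Iio i).image u)))
    else univ \ insert x (insert y ((Iio i).image u))
  have hnew : ∀ i u, u i ∈ C i u → u i ∉ (Iio i).image u ∧
      ((i : ℕ) + 1 ≠ k → u i ≠ x ∧ u i ≠ y) := by
    intro i u h
    simp only [C] at h
    split_ifs at h with h1 h2
    · exact ⟨(mem_nbr.1 h).1, fun h' => absurd h1 h'⟩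
    · have h3 := (mem_nbr.1 (mem_inter.1 h).1).1
      have h4 := (mem_nbr.1 (mem_inter.1 h).2).1
      simp only [mem_insert, not_or] at h3 h4
      exact ⟨h3.2, fun _ => ⟨h3.1, h4.1⟩⟩
    · have h3 := (mem_sdiff.1 h).2
      simp only [mem_insert, not_or] at h3
      exact ⟨h3.2.2, fun _ => ⟨h3.1, h3.2.1⟩⟩
  have hcardS : (γ * N) ^ k ≤ (univ.filter fun u : Fin k → V => ∀ i, u i ∈ C i u).card := by
    refine (pow_le_card_of_sequential C ?_ ha ?_).trans
      (Nat.cast_le.2 (card_le_card fun u hu => by simpa using hu))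
    · intro i f f' h
      have : (Iio i).image f = (Iio i).image f' := image_congr fun j hj => h j (mem_Iio.1 hj)
      simp only [C, this]
    · intro i f hf
      have himg : ((Iio i).image f).card = i := by
        rw [card_image_of_injOn (injOn_of_notMem_image_Iio fun j hj =>
          (hnew j f (hf j (mem_Iio.1 hj))).1), Fin.card_Iio]
      simp only [C]
      split_ifs with h1 h2
      · have := hq ((Iio i).image f) (by omega)
        linarith
      · have hx : ∀ z, z = x ∨ z = y → z ∉ (Iio i).image f := by
          intro z hz h
          obtain ⟨j, hj, rfl⟩ := mem_image.1 h
          rw [mem_Iio] at hj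
          have := (hnew j f (hf j hj)).2 (by have := Fin.lt_def.1 hj; omega)
          tauto
        exact hinter _ _ (by rw [card_insert_of_notMem (hx x (Or.inl rfl)), himg]; omega)
          (by rw [card_insert_of_notMem (hx y (Or.inr rfl)), himg]; omega)
      · have h3 := le_card_sdiff (insert x (insert y ((Iio i).image f))) (univ : Finset V)
        have h4 : (insert x (insert y ((Iio i).image f))).card ≤ k + 2 := by
          have := card_insert_le x (insert y ((Iio i).image f))
          have := card_insert_le y ((Iio i).image f)
          omega
        rw [card_univ] at h3
        have h5 : Fintype.card V ≤
            (univ \ insert x (insert y ((Iio i).image f))).card + (k + 2) := by omega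
        have h6 : N ≤ (univ \ insert x (insert y ((Iio i).image f))).card + (k + 2) := by
          rw [hNdef]
          exact_mod_cast h5
        linarith
  let C' : (Fin k → V) → Fin k → Finset V := fun u j => if hj : (j : ℕ) + 1 < k then
    nbr E ((univ.erase j).image u) ∩ nbr E ((univ.erase ⟨j + 1, hj⟩).image u) else univ
  have hinj : ∀ u : Fin k → V, (∀ i, u i ∈ C i u) → Function.Injective u := fun u hu =>
    Set.injOn_univ.1 (injOn_of_notMem_image_Iio fun j _ => (hnew j u (hu j)).1)
  have hT := pow_le_card_sum_extend _ C' ha hcardS fun u hu j => by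
    have hu' := hinj u (by simpa only [mem_filter, mem_univ, true_and] using hu)
    have hS : ∀ i, ((univ.erase i).image u).card = k - 1 := fun i => by
      rw [card_image_of_injective _ hu', card_erase_of_mem (mem_univ _)]; simp
    simp only [C']
    split_ifs
    · exact hinter _ _ (hS _) (hS _)
    · rw [card_univ]
      linarith
  rw [Fintype.card_fin, ← pow_add, ← two_mul, mul_pow] at hT
  refine hT.trans (Nat.cast_le.2 (card_le_card fun f hf => ?_))
  simp only [mem_filter, mem_univ, true_and, Function.comp] at hf ⊢
  obtain ⟨hfC, hfC'⟩ := hf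
  have hIio : ∀ i : Fin k, insert (f (Sum.inl i)) ((Iio i).image (f ∘ Sum.inl)) =
      (Iic i).image (f ∘ Sum.inl) := fun i => by
    rw [← Iio_insert, image_insert, Function.comp]
  have hedge : univ.image (fun i => f (Sum.inl i)) ∈ E := by
    have h := hfC last
    simp only [C, if_pos hlast] at h
    have h2 := (mem_nbr.1 h).2
    rw [hIio, eq_univ_iff_forall.2 fun i => mem_Iic.2 (hle i)] at h2
    exact h2
  refine ⟨?_, ?_⟩
  · have := isLabelled_of_mem_nbr (f := f) 1 hedge fun j hj => by
      have h := hfC' j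
      simp only [C', dif_pos hj] at h
      exact mem_inter.1 h
    simpa using this
  · have h := hfC ⟨k - 2, by omega⟩
    simp only [C] at h
    rw [if_neg (by omega), if_pos (by omega)] at h
    have h3 := (mem_nbr.1 (mem_inter.1 h).1).2
    have h4 := (mem_nbr.1 (mem_inter.1 h).2).2
    have h5 : Iic (⟨k - 2, by omega⟩ : Fin k) = univ.erase last := by
      ext i
      simp only [mem_Iic, mem_erase, mem_univ, and_true, Fin.le_def, ne_eq, Fin.ext_iff]
      have := i.2
      omega
    rw [insert_comm, hIio, h5] at h3 h4
    exact ⟨h3, h4⟩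

open Classical in
/-- For any two vertices there are many structures containing a tile and a set which forms a tile
with either of the two vertices. -/
theorem exists_many_links {k s : ℕ} (hk : 2 ≤ k) (hks : k < s) (hs : 5 * k ^ 2 ≤ s) {γ : ℝ}
    (hγ : 0 < γ) (hγ1 : γ ≤ 1 / 2) :
    ∃ c > 0, ∃ N₀ : ℕ, ∀ (V : Type) [Fintype V] [DecidableEq V] (E : Finset (Finset V)),
      N₀ ≤ Fintype.card V →
      (∀ S : Finset V, S.card = k - 1 → (1 / 2 + γ) * Fintype.card V ≤ (nbr E S).card) →
      ∃ (Link : V → ((Fin k ⊕ Fin k) × Fin s → V) → Prop)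
        (A Z : ((Fin k ⊕ Fin k) × Fin s → V) → Finset V),
        (∀ x F, Link x F → A F ⊆ univ.image F ∧ SpansCs k s E (A F) ∧ Z F ⊆ univ.image F ∧
          (Z F).card = s - 1 ∧ (x ∉ Z F → SpansCs k s E (insert x (Z F)))) ∧
        ∀ x y, c * (Fintype.card V : ℝ) ^ Fintype.card ((Fin k ⊕ Fin k) × Fin s) ≤
          (univ.filter fun F => Link x F ∧ Link y F).card := by
  obtain ⟨g, hper, hwin, -, hpure⟩ := exists_label_walk k s hk hs
  set last : Fin k := ⟨k - 1, by omega⟩ with hlastdef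
  have hlast : (last : ℕ) + 1 = k := show k - 1 + 1 = k by omega
  have : Nonempty (Fin k ⊕ Fin k) := ⟨Sum.inl last⟩
  obtain ⟨c, hc, N₀, hN₀⟩ := exists_blowup_count (Fin k ⊕ Fin k) s (by omega) (γ ^ (2 * k))
    (by positivity)
  refine ⟨c, hc, N₀ + 2 * (k + 2), fun V _ _ E hN hq => ?_⟩
  have hV : Nonempty V := Fintype.card_pos_iff.1 (by omega)
  have hAZ : ∀ F : (Fin k ⊕ Fin k) × Fin s → V, ∃ A Z : Finset V, Function.Injective F →
      (∀ τ : Fin k ⊕ Fin k → Fin s, IsLabelled E fun l => F (l, τ l)) →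
      A ⊆ univ.image F ∧ SpansCs k s E A ∧ Z ⊆ univ.image F ∧ Z.card = s - 1 ∧
      ∀ x ∉ Z, (∀ τ : Fin k ⊕ Fin k → Fin s,
          insert x ((univ.erase last).image fun i => F (Sum.inl i, τ (Sum.inl i))) ∈ E) →
        SpansCs k s E (insert x Z) := by
    intro F
    by_cases h : Function.Injective F ∧
      ∀ τ : Fin k ⊕ Fin k → Fin s, IsLabelled E fun l => F (l, τ l)
    · have hinj : ∀ l l' a a', F (l, a) = F (l', a') → l = l' ∧ a = a' := fun l l' a a' h' =>
        Prod.ext_iff.1 (h.1 h')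
      obtain ⟨A, hA, hAF, -⟩ := exists_tile_of_walk (by omega) hks.le hper hwin
        (fun l a => F (l, a)) hinj h.2
      obtain ⟨Z, hZs, hZF, hZ⟩ := exists_exchange_set hks.le hper hwin last (hpure last)
        (fun l a => F (l, a)) hinj h.2
      refine ⟨A, Z, fun _ _ => ⟨fun v hv => ?_, hA, fun v hv => ?_, hZs, hZ⟩⟩
      · obtain ⟨l, a, rfl⟩ := hAF v hv
        exact mem_image_of_mem F (mem_univ _)
      · obtain ⟨l, a, rfl⟩ := hZF v hv
        exact mem_image_of_mem F (mem_univ _)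
    · exact ⟨∅, ∅, fun h1 h2 => absurd ⟨h1, h2⟩ h⟩
  choose A Z hAZ using hAZ
  refine ⟨fun x F => Function.Injective F ∧ ∀ τ : Fin k ⊕ Fin k → Fin s,
    (IsLabelled E fun l => F (l, τ l)) ∧
      insert x ((univ.erase last).image fun i => F (Sum.inl i, τ (Sum.inl i))) ∈ E,
    A, Z, fun x F hF => ?_, fun x y => ?_⟩
  · obtain ⟨h1, h2, h3, h4, h5⟩ := hAZ F hF.1 fun τ => (hF.2 τ).1
    exact ⟨h1, h2, h3, h4, fun hx => h5 x hx fun τ => (hF.2 τ).2⟩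
  · have h1 := card_linking_labellings_ge hk last hlast hγ hγ1 hq (by
      have : 2 * (k + 2) ≤ Fintype.card V := by omega
      exact_mod_cast this) x y
    have h2k : Fintype.card (Fin k ⊕ Fin k) = 2 * k := by
      rw [Fintype.card_sum, Fintype.card_fin, two_mul]
    refine (hN₀ V (by omega) (fun f => IsLabelled E f ∧
        insert x ((univ.erase last).image fun i => f (Sum.inl i)) ∈ E ∧
        insert y ((univ.erase last).image fun i => f (Sum.inl i)) ∈ E) ?_).trans ?_
    · rw [h2k]
      refine h1.trans (Nat.cast_le.2 (card_le_card fun f hf => ?_))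
      simp only [mem_filter, mem_univ, true_and] at hf ⊢
      exact hf
    · refine Nat.cast_le.2 (card_le_card fun F hF => ?_)
      simp only [mem_filter, mem_univ, true_and] at hF ⊢
      exact ⟨⟨hF.1, fun τ => ⟨(hF.2 τ).1, (hF.2 τ).2.1⟩⟩,
        ⟨hF.1, fun τ => ⟨(hF.2 τ).1, (hF.2 τ).2.2⟩⟩⟩

theorem hasPerfectCsTilingOn_biUnion {V : Type} [DecidableEq V] {ι : Type*} {k s : ℕ}
    {E : Finset (Finset V)} (I : Finset ι) {B : ι → Finset V}
    (hd : (I : Set ι).PairwiseDisjoint B) (hB : ∀ i ∈ I, HasPerfectCsTilingOn k s E (B i)) :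
    HasPerfectCsTilingOn k s E (I.biUnion B) := by
  classical
  choose! T hT hTB using hB
  refine ⟨I.biUnion T, ⟨?_, fun A hA => ?_⟩, ?_⟩
  · intro A hA A' hA' hne
    obtain ⟨i, hi, hAi⟩ := mem_biUnion.1 (mem_coe.1 hA)
    obtain ⟨j, hj, hAj⟩ := mem_biUnion.1 (mem_coe.1 hA')
    by_cases hij : i = j
    · subst hij
      exact (hT i hi).1 hAi hAj hne
    · refine (hd hi hj hij).mono ?_ ?_
      · rw [← hTB i hi]
        exact subset_biUnion_of_mem id hAi
      · rw [← hTB j hj]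
        exact subset_biUnion_of_mem id hAj
  · obtain ⟨i, hi, hAi⟩ := mem_biUnion.1 hA
    exact (hT i hi).2 A hAi
  · rw [biUnion_biUnion]
    exact biUnion_congr rfl hTB

theorem SpansCs.hasPerfectCsTilingOn {V : Type} [DecidableEq V] {k s : ℕ} {E : Finset (Finset V)}
    {A : Finset V} (h : SpansCs k s E A) : HasPerfectCsTilingOn k s E A :=
  ⟨{A}, ⟨by simp, by simpa using h⟩, by simp⟩

theorem HasPerfectCsTilingOn.union {V : Type} [DecidableEq V] {k s : ℕ} {E : Finset (Finset V)}
    {A B : Finset V} (hA : HasPerfectCsTilingOn k s E A) (hB : HasPerfectCsTilingOn k s E B)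
    (hd : Disjoint A B) : HasPerfectCsTilingOn k s E (A ∪ B) := by
  have h := hasPerfectCsTilingOn_biUnion (k := k) (s := s) (E := E) (univ : Finset Bool)
    (B := fun b => cond b A B) ?_ ?_
  · simpa using h
  · rintro (_ | _) - (_ | _) - hne
    · exact absurd rfl hne
    · exact hd.symm
    · exact hd
    · exact absurd rfl hne
  · rintro (_ | _) -
    · exact hB
    · exact hA

/-- Replacing a tile `{c i}` by a transversal `{t i}` in an absorbing structure. -/
theorem hasPerfectCsTilingOn_absorb {V : Type} [DecidableEq V] {k s : ℕ} (hs : 0 < s)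
    {E : Finset (Finset V)} {A : Finset V} {Z : Fin s → Finset V} {c t : Fin s → V}
    (hc : Function.Injective c) (hcA : univ.image c = A) (ht : Function.Injective t)
    (hA : SpansCs k s E A) (hAZ : ∀ i, Disjoint A (Z i))
    (hZ : ∀ i j, i ≠ j → Disjoint (Z i) (Z j)) (hZs : ∀ i, (Z i).card = s - 1)
    (hcZ : ∀ i, c i ∉ Z i → SpansCs k s E (insert (c i) (Z i)))
    (htZ : ∀ i, t i ∉ Z i → SpansCs k s E (insert (t i) (Z i))) :
    (A ∪ univ.biUnion Z).card = s ^ 2 ∧ HasPerfectCsTilingOn k s E (A ∪ univ.biUnion Z) ∧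
      (Disjoint (A ∪ univ.biUnion Z) (univ.image t) →
        HasPerfectCsTilingOn k s E (A ∪ univ.biUnion Z ∪ univ.image t)) := by
  have hinsert : ∀ u : Fin s → V, univ.image u ∪ univ.biUnion Z =
      univ.biUnion fun i => insert (u i) (Z i) := by
    intro u
    ext v
    simp only [mem_union, mem_image, mem_univ, true_and, mem_biUnion, mem_insert]
    constructor
    · rintro (⟨i, rfl⟩ | ⟨i, hi⟩)
      · exact ⟨i, Or.inl rfl⟩
      · exact ⟨i, Or.inr hi⟩
    · rintro ⟨i, rfl | hi⟩
      · exact Or.inl ⟨i, rfl⟩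
      · exact Or.inr ⟨i, hi⟩
  have hdisj : ∀ u : Fin s → V, Function.Injective u → (∀ i j, u i ∉ Z j) →
      ((univ : Finset (Fin s)) : Set (Fin s)).PairwiseDisjoint fun i => insert (u i) (Z i) := by
    intro u hu huZ i _ j _ hij
    rw [Function.onFun, disjoint_insert_left, disjoint_insert_right, mem_insert, not_or]
    exact ⟨⟨fun h => hij (hu h), huZ i j⟩, huZ j i, hZ i j hij⟩
  have hcZ' : ∀ i j, c i ∉ Z j := fun i j h =>
    disjoint_left.1 (hAZ j) (hcA ▸ mem_image_of_mem c (mem_univ i)) h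
  refine ⟨?_, ?_, fun hd => ?_⟩
  · rw [card_union_of_disjoint ((disjoint_biUnion_right _ _ _).2 fun i _ => hAZ i), hA.card_eq,
      card_biUnion fun i _ j _ hij => hZ i j hij, sum_congr rfl fun i _ => hZs i, sum_const,
      card_univ, Fintype.card_fin, smul_eq_mul]
    obtain ⟨m, rfl⟩ := Nat.exists_eq_succ_of_ne_zero hs.ne'
    simp only [Nat.succ_eq_add_one, Nat.add_sub_cancel]
    ring
  · rw [← hcA, hinsert]
    exact hasPerfectCsTilingOn_biUnion _ (hdisj c hc hcZ') fun i _ =>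
      (hcZ i (hcZ' i i)).hasPerfectCsTilingOn
  · rw [disjoint_union_left] at hd
    have htZ' : ∀ i j, t i ∉ Z j := fun i j h =>
      disjoint_left.1 hd.2 (mem_biUnion.2 ⟨j, mem_univ _, h⟩) (mem_image_of_mem t (mem_univ i))
    rw [union_assoc, union_comm (univ.biUnion Z), hinsert]
    refine hA.hasPerfectCsTilingOn.union (hasPerfectCsTilingOn_biUnion _ (hdisj t ht htZ')
      fun i _ => (htZ i (htZ' i i)).hasPerfectCsTilingOn) ?_
    rw [← hinsert, disjoint_union_right]
    exact ⟨hd.1, (disjoint_biUnion_right _ _ _).2 fun i _ => hAZ i⟩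

theorem exists_enum_of_card_eq {V : Type*} [DecidableEq V] {s : ℕ} {A : Finset V}
    (h : A.card = s) : ∃ c : Fin s → V, Function.Injective c ∧ univ.image c = A := by
  refine ⟨fun i => (A.equivFinOfCardEq h).symm i, fun i j hij => ?_, ?_⟩
  · exact (A.equivFinOfCardEq h).symm.injective (Subtype.ext hij)
  · ext v
    simp only [mem_image, mem_univ, true_and]
    constructor
    · rintro ⟨i, rfl⟩
      exact Subtype.prop _
    · exact fun hv => ⟨A.equivFinOfCardEq h ⟨v, hv⟩, by simp⟩

/-- `A` is tileable, and stays tileable after adding the vertices in the image of `T`. -/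
def AbsorbsImage {V : Type} [DecidableEq V] (k s : ℕ) (E : Finset (Finset V)) {ι : Type*} [Fintype ι]
    (A : Finset V) (T : ι → V) : Prop :=
  A.card = s ^ 2 ∧ HasPerfectCsTilingOn k s E A ∧
    (Disjoint A (univ.image T) → HasPerfectCsTilingOn k s E (A ∪ univ.image T))

open Classical in
/-- Combining a tile and `s` linking structures gives many absorbers for every `s`-set. -/
theorem exists_absorbers_of_links {V : Type} [Fintype V] [DecidableEq V] [Nonempty V] {k s : ℕ}
    (hs : 0 < s) {E : Finset (Finset V)} {J : Type} [Fintype J] [DecidableEq J]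
    (Link : V → (J → V) → Prop) (A Z : (J → V) → Finset V)
    (hAZ : ∀ x F, Link x F → A F ⊆ univ.image F ∧ SpansCs k s E (A F) ∧ Z F ⊆ univ.image F ∧
      (Z F).card = s - 1 ∧ (x ∉ Z F → SpansCs k s E (insert x (Z F))))
    {a : ℝ} (ha : 0 ≤ a) (hcount : ∀ x y, a ≤ (univ.filter fun F => Link x F ∧ Link y F).card) :
    ∃ B : (Fin (s + 1) × J → V) → Finset V, ∀ T : Fin s → V, Function.Injective T →
      a ^ (s + 1) ≤ (univ.filter fun f => B f ⊆ univ.image f ∧ AbsorbsImage k s E (B f) T).card +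
        (univ.filter fun f : Fin (s + 1) × J → V => ¬ Function.Injective f).card := by
  have hc : ∀ F : J → V, ∃ c : Fin s → V, (A F).card = s →
      Function.Injective c ∧ univ.image c = A F := by
    intro F
    by_cases h : (A F).card = s
    · obtain ⟨c, hc⟩ := exists_enum_of_card_eq h
      exact ⟨c, fun _ => hc⟩
    · exact ⟨fun _ => Classical.arbitrary V, fun h' => absurd h' h⟩
  choose c hc using hc
  refine ⟨fun f => A (fun j => f (0, j)) ∪
    univ.biUnion fun i : Fin s => Z fun j => f (i.succ, j), fun T hT => ?_⟩
  set C : Fin (s + 1) → (Fin (s + 1) → J → V) → Finset (J → V) := fun i g =>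
    Fin.cases (univ.filter fun F => Link (Classical.arbitrary V) F ∧ Link (Classical.arbitrary V) F)
      (fun i => univ.filter fun F => Link (T i) F ∧ Link (c (g 0) i) F) i with hCdef
  have hseq := pow_le_card_of_sequential (V := J → V) C (a := a) ?_ ha ?_
  · refine hseq.trans ?_
    rw [← Nat.cast_add, Nat.cast_le]
    refine (card_le_card_of_injOn (t := (univ.filter fun f : Fin (s + 1) × J → V =>
      (A (fun j => f (0, j)) ∪ univ.biUnion fun i : Fin s => Z fun j => f (i.succ, j)) ⊆
        univ.image f ∧ AbsorbsImage k s E (A (fun j => f (0, j)) ∪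
          univ.biUnion fun i : Fin s => Z fun j => f (i.succ, j)) T) ∪
      (univ.filter fun f : Fin (s + 1) × J → V => ¬ Function.Injective f))
      (fun g p => g p.1 p.2) ?_ ?_).trans (card_union_le _ _)
    · intro g hg
      simp only [coe_filter, mem_univ, true_and, Set.mem_ofPred_eq] at hg
      simp only [coe_union, coe_filter, mem_univ, true_and, Set.mem_union, Set.mem_ofPred_eq]
      by_cases hinj : Function.Injective fun p : Fin (s + 1) × J => g p.1 p.2
      swap
      · exact Or.inr hinj
      left
      have h0 : Link (Classical.arbitrary V) (g 0) := by
        have := hg 0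
        simp only [hCdef, Fin.cases_zero, mem_filter, mem_univ, true_and] at this
        exact this.1
      have hi : ∀ i : Fin s, Link (T i) (g i.succ) ∧ Link (c (g 0) i) (g i.succ) := by
        intro i
        have := hg i.succ
        simpa only [hCdef, Fin.cases_succ, mem_filter, mem_univ, true_and] using this
      obtain ⟨hA1, hA2, -⟩ := hAZ _ _ h0
      have hZ1 : ∀ i : Fin s, Z (g i.succ) ⊆ univ.image (g i.succ) := fun i =>
        (hAZ _ _ (hi i).1).2.2.1
      have hdisj : ∀ i j, i ≠ j → Disjoint (univ.image (g i)) (univ.image (g j)) := by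
        intro i j hij
        rw [disjoint_left]
        intro v hv hv'
        obtain ⟨a, -, rfl⟩ := mem_image.1 hv
        obtain ⟨b, -, hb⟩ := mem_image.1 hv'
        exact hij (Prod.ext_iff.1 (@hinj (j, b) (i, a) hb)).1.symm
      have himage : ∀ i, univ.image (g i) ⊆
          univ.image fun p : Fin (s + 1) × J => g p.1 p.2 := by
        intro i v hv
        obtain ⟨a, -, rfl⟩ := mem_image.1 hv
        exact mem_image.2 ⟨(i, a), mem_univ _, rfl⟩
      obtain ⟨hc1, hc2⟩ := hc (g 0) hA2.card_eq
      refine ⟨union_subset (hA1.trans (himage 0))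
        (biUnion_subset.2 fun i _ => (hZ1 i).trans (himage i.succ)), ?_⟩
      exact hasPerfectCsTilingOn_absorb hs hc1 hc2 hT hA2
        (fun i => (hdisj 0 i.succ (Fin.succ_ne_zero i).symm).mono hA1 (hZ1 i))
        (fun i j hij => (hdisj _ _ fun h => hij (Fin.succ_injective _ h)).mono (hZ1 i) (hZ1 j))
        (fun i => (hAZ _ _ (hi i).1).2.2.2.1) (fun i => (hAZ _ _ (hi i).2).2.2.2.2)
        (fun i => (hAZ _ _ (hi i).1).2.2.2.2)
    · intro g _ g' _ h
      funext i j
      exact congrFun h (i, j)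
  · intro i f f' h
    refine Fin.cases ?_ (fun i h => ?_) i h
    · intro _
      rfl
    · simp only [hCdef, Fin.cases_succ, h 0 (Fin.succ_pos i)]
  · intro i f _
    refine Fin.cases ?_ (fun i => ?_) i
    · exact hcount _ _
    · exact hcount _ _

open Classical in
/-- For every `s`-set there are many absorbers. -/
theorem exists_many_absorbers {k s : ℕ} (hk : 2 ≤ k) (hks : k < s) (hs : 5 * k ^ 2 ≤ s) {γ : ℝ}
    (hγ : 0 < γ) (hγ1 : γ ≤ 1 / 2) :
    ∃ η > 0, ∃ N₀ : ℕ, ∀ (V : Type) [Fintype V] [DecidableEq V] (E : Finset (Finset V)),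
      N₀ ≤ Fintype.card V →
      (∀ S : Finset V, S.card = k - 1 → (1 / 2 + γ) * Fintype.card V ≤ (nbr E S).card) →
      ∃ B : (Fin (s + 1) × (Fin k ⊕ Fin k) × Fin s → V) → Finset V,
        ∀ T : Fin s → V, Function.Injective T →
        η * (Fintype.card V : ℝ) ^ Fintype.card (Fin (s + 1) × (Fin k ⊕ Fin k) × Fin s) ≤
          (univ.filter fun f => B f ⊆ univ.image f ∧ AbsorbsImage k s E (B f) T).card := by
  obtain ⟨c, hc, N₀, h⟩ := exists_many_links hk hks hs hγ hγ1
  set K := Fin (s + 1) × (Fin k ⊕ Fin k) × Fin s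
  set J := (Fin k ⊕ Fin k) × Fin s
  have hK : Fintype.card K = (s + 1) * Fintype.card J := by
    simp [K, J, Fintype.card_prod]
  obtain ⟨N₁, hN₁⟩ := exists_nat_ge (2 * (Fintype.card K : ℝ) ^ 2 / c ^ (s + 1))
  refine ⟨c ^ (s + 1) / 2, by positivity, N₀ + N₁ + 1, fun V _ _ E hN hq => ?_⟩
  have : Nonempty V := Fintype.card_pos_iff.1 (by omega)
  obtain ⟨Link, A, Z, hAZ, hcount⟩ := h V E (by omega) hq
  obtain ⟨B, hB⟩ := exists_absorbers_of_links (by omega) Link A Z hAZ (by positivity) hcount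
  refine ⟨B, fun T hT => ?_⟩
  have h1 := hB T hT
  have h2 : ((univ.filter fun f : K → V => ¬ Function.Injective f).card : ℝ) ≤
      (Fintype.card K : ℝ) ^ 2 * (Fintype.card V : ℝ) ^ (Fintype.card K - 1) := by
    exact_mod_cast card_not_injective_le
  have hKpos : 0 < Fintype.card K := by
    rw [hK]
    refine Nat.mul_pos (by omega) ?_
    simp only [J, Fintype.card_prod, Fintype.card_sum, Fintype.card_fin]
    exact Nat.mul_pos (by omega) (by omega)
  have h3 : (N₁ : ℝ) ≤ Fintype.card V := by
    exact_mod_cast (by omega : N₁ ≤ Fintype.card V)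
  rw [div_le_iff₀ (by positivity)] at hN₁
  have h4 : (Fintype.card V : ℝ) ^ Fintype.card K =
      (Fintype.card V : ℝ) * (Fintype.card V : ℝ) ^ (Fintype.card K - 1) := by
    rw [← pow_succ', Nat.sub_add_cancel hKpos]
  rw [mul_pow, ← pow_mul, mul_comm _ (s + 1), ← hK] at h1
  have h5 : 2 * (Fintype.card K : ℝ) ^ 2 * (Fintype.card V : ℝ) ^ (Fintype.card K - 1) ≤
      Fintype.card V * c ^ (s + 1) * (Fintype.card V : ℝ) ^ (Fintype.card K - 1) := by
    refine mul_le_mul_of_nonneg_right (hN₁.trans ?_) (by positivity)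
    exact mul_le_mul_of_nonneg_right h3 (by positivity)
  rw [h4] at h1 ⊢
  linarith

theorem card_not_disjoint_image_le {K V : Type*} [Fintype K] [DecidableEq K] [Fintype V]
    [DecidableEq V] (U : Finset V) :
    (univ.filter fun f : K → V => ¬ Disjoint (univ.image f) U).card ≤
      Fintype.card K * U.card * Fintype.card V ^ (Fintype.card K - 1) := by
  have hsub : (univ.filter fun f : K → V => ¬ Disjoint (univ.image f) U) ⊆
      (univ ×ˢ U).biUnion fun p : K × V => univ.filter fun f : K → V => f p.1 = p.2 := by
    intro f hf
    simp only [mem_filter, mem_univ, true_and, not_disjoint_iff, mem_image] at hf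
    obtain ⟨_, ⟨κ, rfl⟩, hu⟩ := hf
    exact mem_biUnion.2 ⟨(κ, f κ), by simpa using hu, by simp⟩
  refine (card_le_card hsub).trans ((card_biUnion_le_card_mul _ _
    (Fintype.card V ^ (Fintype.card K - 1)) fun p _ => ?_).trans ?_)
  · have h := Fintype.card_filter_piFinset_const_eq_of_mem (univ : Finset V) p.1 (mem_univ p.2)
    simp only [Fintype.piFinset_univ, card_univ] at h
    exact h.le
  · rw [card_product, card_univ]

open Classical in
/-- A greedy choice of pairwise disjoint sets, keeping a potential function small. -/
theorem exists_disjoint_family {V Ω τ : Type*} [Fintype Ω] [Nonempty Ω] [Fintype τ] [Nonempty τ]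
    (A : Ω → Finset V) (R : Ω → τ → Prop) {r M : ℕ} {η : ℝ} (hη : 0 < η)
    (hR : ∀ ω t, R ω t → (A ω).Nonempty ∧ (A ω).card ≤ r)
    (hmany : ∀ t (U : Finset V), U.card ≤ M * r →
      η * Fintype.card Ω ≤ (univ.filter fun ω => R ω t ∧ Disjoint (A ω) U).card)
    (m : ℕ) (hm : m ≤ M) :
    ∃ D : Finset Ω, D.card = m ∧ (D : Set Ω).PairwiseDisjoint A ∧ (∀ ω ∈ D, ∃ t, R ω t) ∧
      ∑ t, (1 / 2 : ℝ) ^ (D.filter fun ω => R ω t).card ≤ (1 - η / 2) ^ m * Fintype.card τ := by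
  have hη1 : η ≤ 1 := by
    have h := (hmany (Classical.arbitrary τ) ∅ (by simp)).trans
      (Nat.cast_le.2 (card_le_univ _))
    have hpos : (0 : ℝ) < Fintype.card Ω := by exact_mod_cast Fintype.card_pos
    exact le_of_mul_le_mul_right (by simpa using h) hpos
  induction m with
  | zero => exact ⟨∅, by simp⟩
  | succ m ih =>
    obtain ⟨D, hDm, hDd, hDR, hDs⟩ := ih (by omega)
    set a : τ → ℝ := fun t => (1 / 2 : ℝ) ^ (D.filter fun ω => R ω t).card with ha
    have hapos : ∀ t, 0 < a t := fun t => by positivity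
    set U := D.biUnion A with hU
    have hUcard : U.card ≤ M * r := by
      refine (card_biUnion_le_card_mul _ _ r fun ω hω => ?_).trans
        (Nat.mul_le_mul_right r (by omega))
      obtain ⟨t, ht⟩ := hDR ω hω
      exact (hR ω t ht).2
    have hsum : ∑ _ω : Ω, η * ∑ t, a t ≤
        ∑ ω : Ω, ∑ t, if R ω t ∧ Disjoint (A ω) U then a t else 0 := by
      rw [sum_comm, sum_const, nsmul_eq_mul, card_univ, ← mul_assoc, mul_sum]
      refine sum_le_sum fun t _ => ?_
      rw [← sum_filter, sum_const, nsmul_eq_mul]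
      refine mul_le_mul_of_nonneg_right ?_ (hapos t).le
      rw [mul_comm]
      exact hmany t U hUcard
    obtain ⟨ω, -, hω⟩ := exists_le_of_sum_le univ_nonempty hsum
    have hΦ : 0 < ∑ t, a t := sum_pos (fun t _ => hapos t) univ_nonempty
    obtain ⟨t₀, ht₀, hd⟩ : ∃ t, R ω t ∧ Disjoint (A ω) U := by
      by_contra! hcon
      rw [sum_eq_zero fun t _ => if_neg fun h => hcon t h.1 h.2] at hω
      exact absurd hω (not_le.2 (by positivity))
    have hωD : ω ∉ D := by
      intro hmem
      obtain ⟨v, hv⟩ := (hR ω t₀ ht₀).1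
      exact disjoint_left.1 hd hv (mem_biUnion.2 ⟨ω, hmem, hv⟩)
    refine ⟨insert ω D, by rw [card_insert_of_notMem hωD, hDm], ?_, ?_, ?_⟩
    · rw [coe_insert]
      refine hDd.insert fun ω' hω' _ => ?_
      exact hd.mono_right (subset_biUnion_of_mem A (mem_coe.1 hω'))
    · intro ω' hω'
      rcases mem_insert.1 hω' with rfl | h
      · exact ⟨t₀, ht₀⟩
      · exact hDR ω' h
    · have hstep : ∀ t, (1 / 2 : ℝ) ^ ((insert ω D).filter fun ω => R ω t).card =
          a t - 1 / 2 * if R ω t ∧ Disjoint (A ω) U then a t else 0 := by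
        intro t
        by_cases hRt : R ω t
        · rw [filter_insert, if_pos hRt, card_insert_of_notMem (by simp [hωD]), if_pos ⟨hRt, hd⟩,
            pow_succ]
          ring
        · rw [filter_insert, if_neg hRt, if_neg fun h => hRt h.1]
          ring
      rw [sum_congr rfl fun t _ => hstep t, sum_sub_distrib, ← mul_sum, pow_succ]
      calc _ ≤ (1 - η / 2) * ∑ t, a t := by linarith
        _ ≤ (1 - η / 2) * ((1 - η / 2) ^ m * Fintype.card τ) :=
          mul_le_mul_of_nonneg_left hDs (by linarith)
        _ = _ := by ring

open Classical in
/-- A greedy choice of pairwise disjoint sets containing many members for every target. -/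
theorem exists_disjoint_family_of_lt {V Ω τ : Type*} [Fintype Ω] [Nonempty Ω] [Fintype τ]
    [Nonempty τ] (A : Ω → Finset V) (R : Ω → τ → Prop) {r M m : ℕ} {η : ℝ} (hη : 0 < η)
    (hR : ∀ ω t, R ω t → (A ω).Nonempty ∧ (A ω).card ≤ r)
    (hmany : ∀ t (U : Finset V), U.card ≤ M * r →
      η * Fintype.card Ω ≤ (univ.filter fun ω => R ω t ∧ Disjoint (A ω) U).card)
    (hM : (1 - η / 2) ^ M * Fintype.card τ < (1 / 2) ^ m) :
    ∃ D : Finset Ω, D.card = M ∧ (D : Set Ω).PairwiseDisjoint A ∧ (∀ ω ∈ D, ∃ t, R ω t) ∧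
      ∀ t, m ≤ (D.filter fun ω => R ω t).card := by
  obtain ⟨D, h1, h2, h3, h4⟩ := exists_disjoint_family A R hη hR hmany M le_rfl
  refine ⟨D, h1, h2, h3, fun t => ?_⟩
  by_contra! hlt
  have h5 : (1 / 2 : ℝ) ^ m ≤ (1 / 2) ^ (D.filter fun ω => R ω t).card :=
    pow_le_pow_of_le_one (by norm_num) (by norm_num) hlt.le
  have h6 : (1 / 2 : ℝ) ^ (D.filter fun ω => R ω t).card ≤
      ∑ t, (1 / 2 : ℝ) ^ (D.filter fun ω => R ω t).card :=
    single_le_sum (f := fun t => (1 / 2 : ℝ) ^ (D.filter fun ω => R ω t).card)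
      (fun _ _ => by positivity) (mem_univ t)
  linarith

theorem exists_pow_mul_pow_lt_half_pow (s : ℕ) {η κ : ℝ} (hη : 0 < η) (hη1 : η ≤ 1) (hκ : 0 < κ) :
    ∃ N₀ : ℕ, ∀ N : ℕ, N₀ ≤ N → ∃ M m : ℕ, (M : ℝ) ≤ κ * N ∧ η * κ / 16 * N ≤ m ∧
      (1 - η / 2) ^ M * (N : ℝ) ^ s < (1 / 2) ^ m := by
  obtain ⟨N₁, hN₁⟩ := exists_pow_lt_exp s (show 0 < η * κ / 4 by positivity)
  obtain ⟨N₂, hN₂⟩ := exists_nat_ge (16 / (η * κ))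
  refine ⟨N₁ + N₂, fun N hN => ⟨⌊κ * N⌋₊, ⌊η * κ * N / 8⌋₊, Nat.floor_le (by positivity), ?_, ?_⟩⟩
  all_goals
    have hN2 : (N₂ : ℝ) ≤ N := by exact_mod_cast (by omega : N₂ ≤ N)
    have h16 : 16 ≤ η * κ * N := by
      rw [div_le_iff₀ (by positivity)] at hN₂
      nlinarith [mul_pos hη hκ]
  · have := Nat.lt_floor_add_one (η * κ * N / 8)
    linarith
  · have hM := Nat.lt_floor_add_one (κ * N)
    have hm := Nat.floor_le (show 0 ≤ η * κ * N / 8 by positivity)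
    have hpow := hN₁ N (by omega)
    set M := ⌊κ * N⌋₊
    set m := ⌊η * κ * N / 8⌋₊
    have h1 : (1 - η / 2) ^ M ≤ Real.exp (-(η / 2) * M) := by
      rw [mul_comm, Real.exp_nat_mul]
      exact pow_le_pow_left₀ (by linarith) (by linarith [Real.add_one_le_exp (-(η / 2))]) M
    have h2 : Real.exp (-(m : ℝ)) ≤ (1 / 2) ^ m := by
      rw [← mul_neg_one, Real.exp_nat_mul]
      refine pow_le_pow_left₀ (Real.exp_pos _).le ?_ m
      rw [Real.exp_neg, one_div]
      exact inv_anti₀ (by norm_num) (by linarith [Real.add_one_le_exp (1 : ℝ)])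
    calc (1 - η / 2) ^ M * (N : ℝ) ^ s
        ≤ Real.exp (-(η / 2) * M) * (N : ℝ) ^ s := mul_le_mul_of_nonneg_right h1 (by positivity)
      _ < Real.exp (-(η / 2) * M) * Real.exp (η * κ / 4 * N) :=
          mul_lt_mul_of_pos_left hpow (Real.exp_pos _)
      _ ≤ Real.exp (-(m : ℝ)) := by
          rw [← Real.exp_add, Real.exp_le_exp]
          nlinarith [mul_lt_mul_of_pos_left hM hη]
      _ ≤ _ := h2

open Classical in
/-- A small family of pairwise disjoint tileable sets which contains linearly many absorbers for
every `s`-set. -/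
theorem exists_absorbing_family {k s : ℕ} (hk : 2 ≤ k) (hks : k < s) (hs : 5 * k ^ 2 ≤ s)
    {γ μ : ℝ} (hγ : 0 < γ) (hγ1 : γ ≤ 1 / 2) (hμ : 0 < μ) :
    ∃ ν > (0 : ℝ), ∃ N₀ : ℕ, ∀ (V : Type) [Fintype V] [DecidableEq V] (E : Finset (Finset V)),
      N₀ ≤ Fintype.card V →
      (∀ S : Finset V, S.card = k - 1 → (1 / 2 + γ) * Fintype.card V ≤ (nbr E S).card) →
      ∃ (ι : Type) (D : Finset ι) (B : ι → Finset V), (D : Set ι).PairwiseDisjoint B ∧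
        (∀ i ∈ D, (B i).card = s ^ 2 ∧ HasPerfectCsTilingOn k s E (B i)) ∧
        ((D.biUnion B).card : ℝ) ≤ μ * Fintype.card V ∧
        ∀ T : Fin s → V, Function.Injective T →
          ν * Fintype.card V ≤ (D.filter fun i => AbsorbsImage k s E (B i) T).card := by
  obtain ⟨η₀, hη₀, N₁, h⟩ := exists_many_absorbers hk hks hs hγ hγ1
  set K := Fin (s + 1) × (Fin k ⊕ Fin k) × Fin s
  have hKpos : 0 < Fintype.card K := by
    simp only [K, Fintype.card_prod, Fintype.card_sum, Fintype.card_fin]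
    exact Nat.mul_pos (by omega) (Nat.mul_pos (by omega) (by omega))
  have hspos : (0 : ℝ) < s := by exact_mod_cast (by omega : 0 < s)
  have hKpos' : (0 : ℝ) < Fintype.card K := by exact_mod_cast hKpos
  set η := min (η₀ / 2) 1 with hηdef
  have hη : 0 < η := lt_min (by positivity) one_pos
  set κ := min (μ / s ^ 2) (η₀ / (2 * Fintype.card K * s ^ 2)) with hκdef
  have hκ : 0 < κ := lt_min (by positivity) (by positivity)
  obtain ⟨N₂, hN₂⟩ := exists_pow_mul_pow_lt_half_pow s hη (min_le_right _ _) hκ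
  refine ⟨η * κ / 16, by positivity, N₁ + N₂ + s, fun V _ _ E hN hq => ?_⟩
  obtain ⟨B, hB⟩ := h V E (by omega) hq
  obtain ⟨M, m, hM, hm, hpow⟩ := hN₂ (Fintype.card V) (by omega)
  have : Nonempty V := Fintype.card_pos_iff.1 (by omega)
  let τ := {T : Fin s → V // Function.Injective T}
  have hτ : Nonempty τ := by
    obtain ⟨e⟩ := Function.Embedding.nonempty_of_card_le
      (α := Fin s) (β := V) (by rw [Fintype.card_fin]; omega)
    exact ⟨⟨e, e.injective⟩⟩
  have hτcard : (Fintype.card τ : ℝ) ≤ (Fintype.card V : ℝ) ^ s := by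
    have := Fintype.card_subtype_le fun T : Fin s → V => Function.Injective T
    rw [Fintype.card_fun, Fintype.card_fin] at this
    exact_mod_cast this
  have hNpos : (0 : ℝ) < Fintype.card V := by exact_mod_cast Fintype.card_pos
  have hMη : (Fintype.card K : ℝ) * (M * s ^ 2) ≤ η₀ / 2 * Fintype.card V := by
    have h1 : κ ≤ η₀ / (2 * Fintype.card K * s ^ 2) := min_le_right _ _
    rw [le_div_iff₀ (by positivity)] at h1
    calc (Fintype.card K : ℝ) * (M * s ^ 2) ≤ Fintype.card K * (κ * Fintype.card V * s ^ 2) := by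
          gcongr
      _ = κ * (2 * Fintype.card K * s ^ 2) / 2 * Fintype.card V := by ring
      _ ≤ _ := by gcongr
  have hMμ : (M : ℝ) * s ^ 2 ≤ μ * Fintype.card V := by
    have h1 : κ ≤ μ / s ^ 2 := min_le_left _ _
    rw [le_div_iff₀ (by positivity)] at h1
    calc (M : ℝ) * s ^ 2 ≤ κ * Fintype.card V * s ^ 2 := by gcongr
      _ = κ * s ^ 2 * Fintype.card V := by ring
      _ ≤ _ := by gcongr
  have hfam := exists_disjoint_family_of_lt (τ := τ) B
    (fun f T => B f ⊆ univ.image f ∧ AbsorbsImage k s E (B f) T.1) (r := s ^ 2) (M := M) (m := m)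
    hη ?_ ?_ ?_
  · obtain ⟨D, hD1, hD2, hD3, hD4⟩ := hfam
    refine ⟨_, D, B, hD2, fun f hf => ?_, ?_, fun T hT => ?_⟩
    · obtain ⟨T, -, hT⟩ := hD3 f hf
      exact ⟨hT.1, hT.2.1⟩
    · refine le_trans ?_ hMμ
      rw [← hD1]
      refine mod_cast card_biUnion_le_card_mul _ _ (s ^ 2) fun f hf => ?_
      obtain ⟨T, -, hT⟩ := hD3 f hf
      exact hT.1.le
    · refine hm.trans (Nat.cast_le.2 ((hD4 ⟨T, hT⟩).trans (card_le_card fun f hf => ?_)))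
      simp only [mem_filter] at hf ⊢
      exact ⟨hf.1, hf.2.2⟩
  · rintro f T ⟨-, hT⟩
    refine ⟨card_pos.1 ?_, hT.1.le⟩
    rw [hT.1]
    exact pow_pos (by omega) 2
  · intro T U hU
    have h1 := hB T.1 T.2
    have h2 : (univ.filter fun f => B f ⊆ univ.image f ∧ AbsorbsImage k s E (B f) T.1).card ≤
        (univ.filter fun f => (B f ⊆ univ.image f ∧ AbsorbsImage k s E (B f) T.1) ∧
          Disjoint (B f) U).card +
        (univ.filter fun f : K → V => ¬ Disjoint (univ.image f) U).card := by
      refine (card_le_card fun f hf => ?_).trans (card_union_le _ _)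
      simp only [mem_union, mem_filter, mem_univ, true_and] at hf ⊢
      by_cases hd : Disjoint (univ.image f) U
      · exact Or.inl ⟨hf, hd.mono_left hf.1⟩
      · exact Or.inr hd
    have h3 := card_not_disjoint_image_le (K := K) U
    have h4 : ((univ.filter fun f : K → V => ¬ Disjoint (univ.image f) U).card : ℝ) ≤
        Fintype.card K * (M * s ^ 2) * (Fintype.card V : ℝ) ^ (Fintype.card K - 1) := by
      exact_mod_cast h3.trans (Nat.mul_le_mul_right _ (Nat.mul_le_mul_left _ hU))
    have h5 : (Fintype.card V : ℝ) ^ Fintype.card K =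
        (Fintype.card V : ℝ) * (Fintype.card V : ℝ) ^ (Fintype.card K - 1) := by
      rw [← pow_succ', Nat.sub_add_cancel hKpos]
    have h6 := mul_le_mul_of_nonneg_right hMη
      (show 0 ≤ (Fintype.card V : ℝ) ^ (Fintype.card K - 1) by positivity)
    have h7 : η * (Fintype.card V : ℝ) ^ Fintype.card K ≤
        η₀ / 2 * (Fintype.card V : ℝ) ^ Fintype.card K :=
      mul_le_mul_of_nonneg_right (min_le_left _ _) (by positivity)
    have h8 := (Nat.cast_le (α := ℝ)).2 h2
    rw [Nat.cast_add] at h8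
    rw [Fintype.card_fun, Nat.cast_pow]
    refine le_trans ?_ (Nat.cast_le.2 (card_le_card (s := univ.filter fun f =>
      (B f ⊆ univ.image f ∧ AbsorbsImage k s E (B f) T.1) ∧ Disjoint (B f) U) fun f hf => ?_))
    · rw [h5] at h1 h7 ⊢
      linarith
    · simp only [mem_filter, mem_univ, true_and] at hf ⊢
      exact hf
  · refine lt_of_le_of_lt (mul_le_mul_of_nonneg_left hτcard ?_) hpow
    exact pow_nonneg (by linarith [min_le_right (η₀ / 2) (1 : ℝ)]) _

open Classical in
/-- A vertex set which splits into few `s`-sets can be absorbed greedily. -/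
theorem hasPerfectCsTilingOn_biUnion_union {V ι : Type} [DecidableEq V] {k s : ℕ}
    {E : Finset (Finset V)} {B : ι → Finset V} (q : ℕ) (D : Finset ι) (Y : Finset V)
    (hd : (D : Set ι).PairwiseDisjoint B) (hB : ∀ i ∈ D, HasPerfectCsTilingOn k s E (B i))
    (hT : ∀ T : Fin s → V, Function.Injective T →
      q ≤ (D.filter fun i => AbsorbsImage k s E (B i) T).card)
    (hY : Y.card = s * q) (hYD : Disjoint (D.biUnion B) Y) :
    HasPerfectCsTilingOn k s E (D.biUnion B ∪ Y) := by
  induction q generalizing D Y with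
  | zero =>
    rw [mul_zero, card_eq_zero] at hY
    rw [hY, union_empty]
    exact hasPerfectCsTilingOn_biUnion D hd hB
  | succ q ih =>
    obtain ⟨S, hSY, hS⟩ := exists_subset_card_eq (s := Y) (n := s) (by rw [hY]; nlinarith)
    obtain ⟨T, hTinj, hTS⟩ := exists_enum_of_card_eq hS
    obtain ⟨i, hi⟩ := card_pos.1 (Nat.succ_pos q |>.trans_le (hT T hTinj))
    rw [mem_filter] at hi
    obtain ⟨hiD, -, -, hiT⟩ := hi
    rw [hTS] at hiT
    rw [disjoint_biUnion_left] at hYD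
    have h1 := hiT ((hYD i hiD).mono_right hSY)
    have h2 := ih (D.erase i) (Y \ S) (hd.subset (coe_subset.2 (erase_subset _ _)))
      (fun j hj => hB j (mem_of_mem_erase hj)) (fun T' hT' => ?_) ?_ ?_
    · have h3 := h1.union h2 ?_
      · rw [← insert_erase hiD, biUnion_insert]
        convert h3 using 1
        rw [union_union_union_comm, union_sdiff_of_subset hSY]
      · rw [disjoint_union_left, disjoint_union_right, disjoint_union_right,
          disjoint_biUnion_right, disjoint_biUnion_right]
        refine ⟨⟨fun j hj => ?_, (hYD i hiD).mono_right sdiff_subset⟩, fun j hj => ?_,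
          disjoint_sdiff⟩
        · exact hd hiD (mem_of_mem_erase hj) (ne_of_mem_erase hj).symm
        · exact ((hYD j (mem_of_mem_erase hj)).mono_right hSY).symm
    · rw [filter_erase]
      have := hT T' hT'
      have := pred_card_le_card_erase (s := D.filter fun i => AbsorbsImage k s E (B i) T') (a := i)
      omega
    · rw [card_sdiff_of_subset hSY, hY, hS, Nat.mul_succ, Nat.add_sub_cancel]
    · rw [disjoint_biUnion_left]
      exact fun j hj => (hYD j (mem_of_mem_erase hj)).mono_right sdiff_subset

theorem IsCsTiling.dvd_card {V : Type} [DecidableEq V] {k s : ℕ} {E T : Finset (Finset V)}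
    (hT : IsCsTiling k s E T) : s ∣ (T.biUnion id).card := by
  rw [card_biUnion hT.1]
  exact dvd_sum fun A hA => (hT.2 A hA).card_eq.symm.dvd

/-- for `2 ≤ k < s` with `s ≥ 5k²` and `k ∤ s`, every `k`-graph on `n ≥ n₀(k,s,γ)`
vertices with `s ∣ n` and minimum codegree at least `(1/2 + 1/(2s) + γ)n` has a perfect
`C_s^k`-tiling. -/
theorem tiling_threshold_upper (k s : ℕ) (hk : 2 ≤ k) (hks : k < s) (hs : 5 * k ^ 2 ≤ s)
    (hnd : ¬ k ∣ s) (γ : ℝ) (hγ : 0 < γ) :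
    ∃ n₀ : ℕ, ∀ (V : Type) [Fintype V] [DecidableEq V] (E : Finset (Finset V)),
      IsKGraph k E → n₀ ≤ Fintype.card V → s ∣ Fintype.card V →
      (∀ S : Finset V, S.card = k - 1 →
        ((1 : ℝ) / 2 + 1 / (2 * (s : ℝ)) + γ) * (Fintype.card V : ℝ) ≤ (degS E S : ℝ)) →
      HasPerfectCsTiling k s E := by
  classical
  have hspos : (0 : ℝ) < s := by exact_mod_cast (by omega : 0 < s)
  set ε := min γ (1 / 2) with hεdef
  have hε : 0 < ε := lt_min hγ (by norm_num)
  have hε1 : ε ≤ 1 / 2 := min_le_right _ _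
  obtain ⟨ν, hν, N₁, hN₁⟩ := exists_absorbing_family hk hks hs hε hε1 (half_pos hε)
  obtain ⟨N₂, hN₂⟩ := exists_almost_perfect_tiling hk hks hs hnd (δ := min (s * ν) 1)
    (lt_min (by positivity) one_pos) (min_le_right _ _) (half_pos hε) (by linarith)
  refine ⟨N₁ + N₂, fun V _ _ E hE hN hdvd hdeg => ?_⟩
  have hnbr : ∀ S : Finset V, S.card = k - 1 →
      (1 / 2 + 1 / (2 * (s : ℝ)) + ε) * Fintype.card V ≤ (nbr E S).card := by
    intro S hS
    rw [card_nbr (by omega) hE hS]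
    refine (mul_le_mul_of_nonneg_right ?_ (Nat.cast_nonneg _)).trans (hdeg S hS)
    linarith [min_le_left γ (1 / 2)]
  obtain ⟨ι, D, B, hDd, hDB, hDc, hDT⟩ := hN₁ V E (by omega) fun S hS =>
    (mul_le_mul_of_nonneg_right (by
      have : (0 : ℝ) ≤ 1 / (2 * (s : ℝ)) := by positivity
      linarith) (Nat.cast_nonneg _)).trans (hnbr S hS)
  set W := D.biUnion B with hW
  have htiling := hN₂ V E (by omega) (univ \ W) ?_
  · obtain ⟨T, hT, hTX, hTc⟩ := htiling
    set Y := (univ \ W) \ T.biUnion id with hY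
    have hWdvd : s ∣ W.card := by
      rw [hW, card_biUnion hDd]
      exact dvd_sum fun i hi => (hDB i hi).1 ▸ dvd_pow_self s two_ne_zero
    have hYdvd : s ∣ Y.card := by
      rw [hY, card_sdiff_of_subset hTX, card_sdiff_of_subset (subset_univ W), card_univ]
      exact Nat.dvd_sub (Nat.dvd_sub hdvd hWdvd) hT.dvd_card
    obtain ⟨q, hq⟩ := hYdvd
    have hqν : (q : ℝ) ≤ ν * Fintype.card V := by
      have h1 : (s : ℝ) * q ≤ s * (ν * Fintype.card V) := by
        rw [← mul_assoc]
        have h2 : (Y.card : ℝ) = s * q := by exact_mod_cast hq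
        rw [← h2]
        exact hTc.trans (mul_le_mul_of_nonneg_right (min_le_left _ _) (Nat.cast_nonneg _))
      exact le_of_mul_le_mul_left h1 hspos
    have hWY : Disjoint W Y := disjoint_sdiff.mono_right sdiff_subset
    have h1 := hasPerfectCsTilingOn_biUnion_union q D Y hDd (fun i hi => (hDB i hi).2)
      (fun T' hT' => by exact_mod_cast hqν.trans (hDT T' hT')) hq hWY
    have h2 := h1.union (B := T.biUnion id) ⟨T, hT, rfl⟩ (disjoint_union_left.2
      ⟨disjoint_sdiff.mono_right hTX, disjoint_sdiff.symm⟩)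
    rw [HasPerfectCsTiling]
    convert h2 using 1
    rw [union_assoc, hY, sdiff_union_of_subset hTX, ← hW, union_sdiff_of_subset (subset_univ W)]
  · intro S hS
    have h1 := hnbr S hS
    have h2 : ((nbr E S).card : ℝ) ≤ (nbr E S ∩ (univ \ W)).card + W.card := by
      rw [← Nat.cast_add, Nat.cast_le]
      refine (card_le_card fun v hv => ?_).trans (card_union_le _ _)
      simp only [mem_union, mem_inter, mem_sdiff, mem_univ, true_and]
      tauto
    have h3 : ((univ \ W).card : ℝ) ≤ Fintype.card V := Nat.cast_le.2 (card_le_univ _)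
    have h4 := mul_le_mul_of_nonneg_left h3
      (show (0 : ℝ) ≤ 1 / 2 + 1 / (2 * s) + ε / 2 by positivity)
    linarith
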